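/- For the even quartic oscillator, the spectral locus Z is the union of the two sets Z_even (points (a,λ) admitting an even eigenfunction) and Z_odd (points admitting an odd eigenfunction); Z_even and Z_odd are disjoint, and each of them is a nonempty connected subset of ℂ × ℂ. -/

import Mathlib

open Complex Filter

/-- `y` is an eigenfunction of the even quartic oscillator with parameter `a`
and eigenvalue `λ`: an entire function, not identically zero, satisfying
`-y'' + (z⁴ + a z²) y = λ y` and tending to `0` along the positive and
negative real axes. -/
def IsEvenQuarticEigenfunction (a lam : ℂ) (y : ℂ → ℂ) : Prop :=
  Differentiable ℂ y ∧ y ≠ 0 ∧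
  (∀ z : ℂ, -(deriv (deriv y) z) + (z ^ 4 + a * z ^ 2) * y z = lam * y z) ∧
  Tendsto (fun t : ℝ => y t) atTop (nhds 0) ∧
  Tendsto (fun t : ℝ => y t) atBot (nhds 0)

/-- The spectral locus of the even quartic oscillator. -/
def evenQuarticLocus : Set (ℂ × ℂ) :=
  {p : ℂ × ℂ | ∃ y : ℂ → ℂ, IsEvenQuarticEigenfunction p.1 p.2 y}

/-- The part of the spectral locus corresponding to even eigenfunctions. -/
def evenQuarticLocusEven : Set (ℂ × ℂ) :=
  {p : ℂ × ℂ | ∃ y : ℂ → ℂ, IsEvenQuarticEigenfunction p.1 p.2 y ∧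
    ∀ z : ℂ, y (-z) = y z}

/-- The part of the spectral locus corresponding to odd eigenfunctions. -/
def evenQuarticLocusOdd : Set (ℂ × ℂ) :=
  {p : ℂ × ℂ | ∃ y : ℂ → ℂ, IsEvenQuarticEigenfunction p.1 p.2 y ∧
    ∀ z : ℂ, y (-z) = -y z}

namespace EQ
open Metric Set MeasureTheory Topology

variable {E : Type*} [NormedAddCommGroup E] [NormedSpace ℂ E]

lemma norm_fderiv_le_cauchy {f : E → ℂ} {x : E} {R M : ℝ} (hR : 0 < R)
    (hf : DifferentiableOn ℂ f (ball x R)) (hM : ∀ y ∈ ball x R, ‖f y‖ ≤ M) :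
    ‖fderiv ℂ f x‖ ≤ 2 * M / R := by
  refine Complex.norm_fderiv_le_div_of_mapsTo_ball hf (fun y hy => ?_) hR
  rw [mem_closedBall, dist_eq_norm]
  have h1 := hM y hy
  have h2 := hM x (mem_ball_self hR)
  calc ‖f y - f x‖ ≤ ‖f y‖ + ‖f x‖ := norm_sub_le _ _
    _ ≤ 2 * M := by linarith

lemma differentiableAt_tsum_loc {f : ℕ → E → ℂ} {x : E} {R : ℝ} {u : ℕ → ℝ} (hR : 0 < R)
    (hf : ∀ n, DifferentiableOn ℂ (f n) (ball x R)) (hu : Summable u)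
    (hM : ∀ n, ∀ y ∈ ball x R, ‖f n y‖ ≤ u n) :
    DifferentiableAt ℂ (fun y => ∑' n, f n y) x := by
  let A : NormedSpace ℝ E := NormedSpace.restrictScalars ℝ ℂ _
  have hsub : ∀ y ∈ ball x (R/2), ball y (R/2) ⊆ ball x R := by
    intro y hy
    apply ball_subset_ball'
    rw [mem_ball] at hy
    linarith
  have h0 : x ∈ ball x (R/2) := mem_ball_self (by linarith)
  refine (hasFDerivAt_tsum_of_isPreconnected (s := ball x (R/2)) (u := fun n => 2 * u n / (R/2))
    (f' := fun n y => fderiv ℂ (f n) y) (x₀ := x)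
    ?_ isOpen_ball (convex_ball x (R/2)).isPreconnected ?_ ?_ h0 ?_ h0).differentiableAt
  · exact (hu.mul_left 2).div_const _
  · intro n y hy
    refine ((hf n).differentiableAt ?_).hasFDerivAt
    exact isOpen_ball.mem_nhds (hsub y hy (mem_ball_self (by linarith)))
  · intro n y hy
    exact norm_fderiv_le_cauchy (by linarith) ((hf n).mono (hsub y hy))
      (fun z hz => hM n z (hsub y hy hz))
  · exact Summable.of_norm_bounded hu (fun n => hM n x (mem_ball_self hR))

/-- Partial derivatives of jointly holomorphic functions are jointly holomorphic. -/
lemma differentiableOn_fderiv_apply [FiniteDimensional ℂ E] {f : E → ℂ} {Ω : Set E} (hΩ : IsOpen Ω)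
    (hf : DifferentiableOn ℂ f Ω) (v : E) :
    DifferentiableOn ℂ (fun x => fderiv ℂ f x v) Ω := by
  intro x hx
  apply DifferentiableAt.differentiableWithinAt
  -- choose ball
  have hc : ContinuousAt f x := (hf.differentiableAt (hΩ.mem_nhds hx)).continuousAt
  obtain ⟨R, hR, hRs⟩ : ∃ R > 0, ∀ y ∈ ball x R, y ∈ Ω ∧ ‖f y‖ ≤ ‖f x‖ + 1 := by
    have h1 : ∀ᶠ y in 𝓝 x, y ∈ Ω := hΩ.mem_nhds hx
    have h2 : ∀ᶠ y in 𝓝 x, ‖f y‖ < ‖f x‖ + 1 :=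
      hc.norm.eventually_lt_const (by simp)
    obtain ⟨R, hR, h⟩ := Metric.eventually_nhds_iff_ball.1 (h1.and h2)
    exact ⟨R, hR, fun y hy => ⟨(h y hy).1, (h y hy).2.le⟩⟩
  set M := ‖f x‖ + 1 with hMdef
  have hM0 : 0 < M := by positivity
  obtain ⟨r, hr, hrv⟩ : ∃ r > 0, r * ‖v‖ < R / 3 := by
    refine ⟨R / 3 / (‖v‖ + 1), by positivity, ?_⟩
    rw [div_mul_eq_mul_div, div_lt_iff₀ (by positivity)]
    nlinarith [norm_nonneg v]
  have hmem : ∀ y ∈ ball x (R/3), ∀ t : ℂ, ‖t‖ ≤ r → y + t • v ∈ ball x (2 * R / 3) := by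
    intro y hy t ht
    rw [mem_ball, dist_eq_norm] at hy ⊢
    calc ‖y + t • v - x‖ = ‖(y - x) + t • v‖ := by congr 1; abel
      _ ≤ ‖y - x‖ + ‖t‖ * ‖v‖ := by rw [← norm_smul]; exact norm_add_le _ _
      _ ≤ ‖y - x‖ + r * ‖v‖ := by gcongr
      _ < 2 * R / 3 := by linarith
  have hdiffO : ∀ y ∈ ball x R, DifferentiableAt ℂ f y := fun y hy =>
    hf.differentiableAt (hΩ.mem_nhds (hRs y hy).1)
  have hbig : ∀ y ∈ ball x (2 * R/3), ‖fderiv ℂ f y‖ ≤ 2 * M / (R / 3) := by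
    intro y hy
    have hs : ball y (R/3) ⊆ ball x R := by
      apply ball_subset_ball'
      rw [mem_ball] at hy
      linarith
    exact norm_fderiv_le_cauchy (by linarith)
      (fun z hz => (hdiffO z (hs hz)).differentiableWithinAt) (fun z hz => (hRs z (hs hz)).2)
  have hsub : ball x (2 * R / 3) ⊆ ball x R := ball_subset_ball (by linarith)
  -- Cauchy formula
  have hcauchy : ∀ y ∈ ball x (R/3), fderiv ℂ f y v =
      (2 * Real.pi * I)⁻¹ • ∮ t in C(0, r), (t ^ 2)⁻¹ • f (y + t • v) := by
    intro y hy
    have hd : DifferentiableOn ℂ (fun t : ℂ => f (y + t • v)) (closedBall 0 r) := by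
      intro t ht
      have ht' : ‖t‖ ≤ r := by simpa using ht
      refine DifferentiableAt.differentiableWithinAt ?_
      have := hdiffO _ (hsub (hmem y hy t ht'))
      exact DifferentiableAt.comp t this (by fun_prop)
    have h2 : HasDerivAt (fun t : ℂ => f (y + t • v)) (fderiv ℂ f y v) 0 := by
      have h3 : HasFDerivAt f (fderiv ℂ f y) (y + (0:ℂ) • v) := by
        simpa using (hdiffO y (hsub (by simpa using hmem y hy 0 (by simpa using hr.le)))).hasFDerivAt
      have h4 : HasDerivAt (fun t : ℂ => y + t • v) v 0 := by
        simpa using ((hasDerivAt_id (0:ℂ)).smul_const v).const_add y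
      exact h3.comp_hasDerivAt 0 h4
    have h5 := hd.deriv_eq_smul_circleIntegral hr
    rw [h2.deriv] at h5
    simp only [sub_zero, one_div] at h5
    rw [h5, smul_smul, inv_mul_cancel₀ (by simp [Real.pi_ne_zero]), one_smul]
  have hder : HasFDerivAt (fun y : E => ∫ θ in (0:ℝ)..(2 * Real.pi),
      deriv (circleMap 0 r) θ • (((circleMap 0 r θ) ^ 2)⁻¹ • f (y + circleMap 0 r θ • v)))
      (∫ θ in (0:ℝ)..(2 * Real.pi), deriv (circleMap 0 r) θ • (((circleMap 0 r θ) ^ 2)⁻¹ •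
        fderiv ℂ f (x + circleMap 0 r θ • v))) x := by
    have hcm : ∀ θ, ‖circleMap 0 r θ‖ = r := fun θ => by simp [abs_of_pos hr]
    have hcont : ∀ y ∈ ball x (R/3), Continuous (fun θ : ℝ =>
        deriv (circleMap 0 r) θ • (((circleMap 0 r θ) ^ 2)⁻¹ • f (y + circleMap 0 r θ • v))) := by
      intro y hy
      have h1 : Continuous (fun θ : ℝ => f (y + circleMap 0 r θ • v)) := by
        rw [continuous_iff_continuousAt]
        intro θ
        exact ContinuousAt.comp (g := f)
          (hdiffO _ (hsub (hmem y hy _ (hcm θ).le))).continuousAt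
          (by have := continuous_circleMap 0 r; fun_prop)
      have h2 : Continuous (fun θ : ℝ => ((circleMap 0 r θ) ^ 2)⁻¹) := by
        refine Continuous.inv₀ ((continuous_circleMap 0 r).pow 2) (fun θ => ?_)
        exact pow_ne_zero _ (by rw [← norm_pos_iff, hcm]; exact hr)
      have h3 : Continuous (fun θ : ℝ => deriv (circleMap 0 r) θ) := by
        simp only [deriv_circleMap]
        exact (continuous_circleMap 0 r).mul continuous_const
      exact h3.smul (h2.smul h1)
    refine intervalIntegral.hasFDerivAt_integral_of_dominated_of_fderiv_le
      (F' := fun y θ => deriv (circleMap 0 r) θ • (((circleMap 0 r θ) ^ 2)⁻¹ •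
        fderiv ℂ f (y + circleMap 0 r θ • v)))
      (bound := fun θ => r * ((r ^ 2)⁻¹ * (2 * M / (R/3)))) (s := ball x (R/3))
      (ball_mem_nhds x (by linarith)) ?_ ?_ ?_ ?_ ?_ ?_
    · filter_upwards [ball_mem_nhds x (show 0 < R/3 by linarith)] with y hy
      exact (hcont y hy).aestronglyMeasurable
    · exact (hcont x (mem_ball_self (by linarith))).intervalIntegrable _ _
    · have hmf : AEStronglyMeasurable (fun θ : ℝ => fderiv ℂ f (x + circleMap 0 r θ • v))
          (volume.restrict (Set.uIoc 0 (2 * Real.pi))) := by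
        borelize E
        borelize (E →L[ℂ] ℂ)
        have : ProperSpace (E →L[ℂ] ℂ) := FiniteDimensional.proper ℂ _
        have hm : Measurable (fderiv ℂ f) := measurable_fderiv ℂ f
        have hc2 : Continuous (fun θ : ℝ => x + circleMap 0 r θ • v) := by
          have := continuous_circleMap 0 r
          fun_prop
        exact (hm.comp hc2.measurable).aestronglyMeasurable
      have h2 : Continuous (fun θ : ℝ => ((circleMap 0 r θ) ^ 2)⁻¹) := by
        refine Continuous.inv₀ ((continuous_circleMap 0 r).pow 2) (fun θ => ?_)
        exact pow_ne_zero _ (by rw [← norm_pos_iff, hcm]; exact hr)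
      have h3 : Continuous (fun θ : ℝ => deriv (circleMap 0 r) θ) := by
        simp only [deriv_circleMap]
        exact (continuous_circleMap 0 r).mul continuous_const
      exact h3.aestronglyMeasurable.smul (h2.aestronglyMeasurable.smul hmf)
    · refine ae_of_all _ (fun θ _ y hy => ?_)
      rw [norm_smul, norm_smul, norm_inv, norm_pow, hcm, deriv_circleMap, norm_mul, hcm, norm_I,
        mul_one]
      gcongr
      exact hbig _ (hmem y hy _ (hcm θ).le)
    · exact intervalIntegrable_const
    · refine ae_of_all _ (fun θ _ y hy => ?_)
      have h1 := (hdiffO _ (hsub (hmem y hy _ (hcm θ).le))).hasFDerivAt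
      have h2 : HasFDerivAt (fun y : E => f (y + circleMap 0 r θ • v))
          (fderiv ℂ f (y + circleMap 0 r θ • v)) y := by
        exact (hasFDerivAt_comp_add_right (circleMap 0 r θ • v)).2 h1
      exact (h2.fun_const_smul _).fun_const_smul _
  have : DifferentiableAt ℂ (fun y : E =>
      (2 * Real.pi * I)⁻¹ • ∮ t in C(0, r), (t ^ 2)⁻¹ • f (y + t • v)) x := by
    exact hder.differentiableAt.fun_const_smul _
  refine this.congr_of_eventuallyEq ?_
  filter_upwards [ball_mem_nhds x (show 0 < R/3 by linarith)] with y hy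
  exact hcauchy y hy

end EQ

namespace EQ
open Metric Set MeasureTheory Topology

/-- Coefficients of the power series solution. -/
noncomputable def cf (κ : ℕ) (e a l : ℂ) : ℕ → ℂ
  | 0 => 1
  | 1 => -l / (2 * (1 + 2 * κ))
  | 2 => (a - l * cf κ e a l 1) / (4 * (2 + (1 + 2 * κ)))
  | (n+3) => (e * cf κ e a l n + a * cf κ e a l (n+1) - l * cf κ e a l (n+2)) /
      ((2 * n + 6) * (2 * n + 4 + (1 + 2 * κ)))

/-- The series solution in `w = z ^ 2`. -/
noncomputable def ff (κ : ℕ) (e a l w : ℂ) : ℂ := ∑' n, cf κ e a l n * w ^ n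

noncomputable def ff' (κ : ℕ) (e a l w : ℂ) : ℂ := deriv (ff κ e a l) w

lemma one_le_norm_nat {c : ℂ} {n : ℕ} (h : c = n) (hn : 1 ≤ n) : 1 ≤ ‖c‖ := by
  rw [h, Complex.norm_natCast]; exact_mod_cast hn

lemma cf_bound (κ : ℕ) (M ρ : ℝ) (hM : 1 ≤ M) (hρ : 1 ≤ ρ) :
    ∃ K : ℝ, ∀ e a l : ℂ, ‖e‖ ≤ M → ‖a‖ ≤ M → ‖l‖ ≤ M → ∀ n, ‖cf κ e a l n‖ * ρ ^ n ≤ K := by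
  set T : ℝ := 3 * M * ρ ^ 3 with hT
  have hT1 : 1 ≤ T := by
    have : 1 ≤ ρ ^ 3 := one_le_pow₀ hρ
    nlinarith
  let P : ℕ → ℝ := fun n => ∏ j ∈ Finset.range n, max 1 (T / (j + 1))
  have hPs : ∀ n, P (n+1) = P n * max 1 (T / (n + 1)) := fun n => Finset.prod_range_succ _ _
  have hP0 : P 0 = 1 := by simp [P]
  have hPpos : ∀ n, 0 < P n := fun n => Finset.prod_pos fun i _ => by positivity
  have hmono : Monotone P := by
    refine monotone_nat_of_le_succ fun n => ?_
    rw [hPs]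
    exact le_mul_of_one_le_right (hPpos n).le (le_max_left _ _)
  obtain ⟨N, hN⟩ := exists_nat_ge T
  have hPN : ∀ n, P n ≤ P N := by
    intro n
    rcases le_total n N with h | h
    · exact hmono h
    · induction n, h using Nat.le_induction with
      | base => exact le_rfl
      | succ n hn ih =>
        rw [hPs, max_eq_left, mul_one]
        · exact ih
        · rw [div_le_one (by positivity)]
          have : (N:ℝ) ≤ n := by exact_mod_cast hn
          linarith
  refine ⟨P N, fun e a l he ha hl n => le_trans ?_ (hPN n)⟩
  have hρ0 : 0 ≤ ρ := by linarith
  have hρ3 : ρ ≤ ρ ^ 3 := le_self_pow₀ hρ (by norm_num)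
  have hρ23 : ρ ^ 2 ≤ ρ ^ 3 := pow_le_pow_right₀ hρ (by norm_num)
  have hρ13 : 1 ≤ ρ ^ 3 := one_le_pow₀ hρ
  have hTP : ∀ n : ℕ, P n * (T / (n+1)) ≤ P (n+1) := by
    intro n
    rw [hPs]
    exact mul_le_mul_of_nonneg_left (le_max_right _ _) (hPpos n).le
  induction n using Nat.strong_induction_on with
  | _ n ih =>
  match n, ih with
  | 0, _ => simp [cf, hP0]
  | 1, _ =>
    have h1 : ‖cf κ e a l 1‖ ≤ M := by
      rw [cf, norm_div, norm_neg]
      refine (div_le_self (norm_nonneg _) ?_).trans hl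
      exact one_le_norm_nat (n := 2 * (1 + 2 * κ)) (by push_cast; ring) (by omega)
    have h2 := hTP 0
    simp only [hP0] at h2
    have h3 : ‖cf κ e a l 1‖ * ρ ^ 1 ≤ M * ρ ^ 3 := by
      rw [pow_one]; exact mul_le_mul h1 hρ3 hρ0 (by linarith)
    have h4 : 0 ≤ M * ρ ^ 3 := by positivity
    norm_num at h2
    simp only [hT] at h2
    linarith
  | 2, ih =>
    have i1 := ih 1 (by norm_num)
    have h1 : ‖cf κ e a l 2‖ ≤ (M + M * ‖cf κ e a l 1‖) / 2 := by
      rw [show cf κ e a l 2 = (a - l * cf κ e a l 1) / (4 * (2 + (1 + 2 * κ))) from rfl, norm_div]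
      have hd : 2 ≤ ‖(4 * (2 + (1 + 2 * κ)) : ℂ)‖ := by
        have : (4 * (2 + (1 + 2 * κ)) : ℂ) = ((4 * (2 + (1 + 2 * κ)) : ℕ) : ℂ) := by push_cast; ring
        rw [this, Complex.norm_natCast]
        exact_mod_cast (by omega : 2 ≤ 4 * (2 + (1 + 2 * κ)))
      refine div_le_div₀ (by positivity) ?_ (by norm_num) hd
      refine (norm_sub_le _ _).trans ?_
      rw [norm_mul]
      gcongr
    have h2 := hTP 1
    have hP1 : 1 ≤ P 1 := by rw [← hP0]; exact hmono (by norm_num)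
    norm_num at h2
    refine le_trans ?_ h2
    have h5 : ‖cf κ e a l 2‖ * ρ ^ 2 ≤ (M * ρ ^ 2 + M * ρ * (‖cf κ e a l 1‖ * ρ ^ 1)) / 2 := by
      have := mul_le_mul_of_nonneg_right h1 (by positivity : 0 ≤ ρ ^ 2)
      nlinarith
    have h6 : M * ρ * (‖cf κ e a l 1‖ * ρ ^ 1) ≤ M * ρ ^ 3 * P 1 :=
      mul_le_mul (by gcongr) i1 (by positivity) (by positivity)
    have h7 : M * ρ ^ 2 ≤ M * ρ ^ 3 * P 1 := by
      calc M * ρ ^ 2 ≤ M * ρ ^ 3 * 1 := by rw [mul_one]; gcongr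
        _ ≤ _ := by gcongr
    have h8 : 0 ≤ M * ρ ^ 3 * P 1 := mul_nonneg (by positivity) (hPpos 1).le
    rw [hT]
    linarith
  | n+3, ih =>
    have i0 := (ih n (by omega)).trans (hmono (by omega : n ≤ n + 2))
    have i1 := (ih (n+1) (by omega)).trans (hmono (by omega : n + 1 ≤ n + 2))
    have i2 := (ih (n+2) (by omega))
    have h1 : ‖cf κ e a l (n+3)‖ ≤ (M * ‖cf κ e a l n‖ + M * ‖cf κ e a l (n+1)‖
        + M * ‖cf κ e a l (n+2)‖) / (n + 3) := by
      rw [cf, norm_div]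
      have hd : (n + 3 : ℝ) ≤ ‖((2 * n + 6) * (2 * n + 4 + (1 + 2 * κ)) : ℂ)‖ := by
        have : ((2 * n + 6) * (2 * n + 4 + (1 + 2 * κ)) : ℂ)
          = (((2 * n + 6) * (2 * n + 4 + (1 + 2 * κ)) : ℕ) : ℂ) := by push_cast; ring
        rw [this, Complex.norm_natCast]
        have : n + 3 ≤ (2 * n + 6) * (2 * n + 4 + (1 + 2 * κ)) := by nlinarith
        exact_mod_cast this
      refine div_le_div₀ (by positivity) ?_ (by positivity) hd
      refine (norm_sub_le _ _).trans ?_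
      refine (add_le_add_left (norm_add_le _ _) _).trans ?_
      rw [norm_mul, norm_mul, norm_mul]
      gcongr
    have h2 := hTP (n+2)
    refine le_trans ?_ h2
    push_cast
    have e1 : (n:ℝ) + 2 + 1 = n + 3 := by ring
    rw [e1, mul_div_assoc', ]
    calc ‖cf κ e a l (n+3)‖ * ρ ^ (n+3) ≤ (M * ‖cf κ e a l n‖ + M * ‖cf κ e a l (n+1)‖
        + M * ‖cf κ e a l (n+2)‖) / (n + 3) * ρ ^ (n+3) := by gcongr
      _ = (M * ρ ^ 3 * (‖cf κ e a l n‖ * ρ ^ n) + M * ρ ^ 2 * (‖cf κ e a l (n+1)‖ * ρ ^ (n+1))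
        + M * ρ * (‖cf κ e a l (n+2)‖ * ρ ^ (n+2))) / (n + 3) := by ring
      _ ≤ (M * ρ ^ 3 * P (n+2) + M * ρ ^ 3 * P (n+2) + M * ρ ^ 3 * P (n+2)) / (n+3) := by
        have := (hPpos (n+2)).le
        gcongr
      _ = _ := by rw [hT]; ring

lemma cf_differentiable (κ n : ℕ) :
    Differentiable ℂ (fun q : ℂ × ℂ × ℂ => cf κ q.1 q.2.1 q.2.2 n) := by
  induction n using Nat.strong_induction_on with
  | _ n ih =>
  match n, ih with
  | 0, _ => simp only [cf]; fun_prop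
  | 1, _ => simp only [cf]; fun_prop
  | 2, ih =>
    have i1 := ih 1 (by norm_num)
    rw [show (fun q : ℂ × ℂ × ℂ => cf κ q.1 q.2.1 q.2.2 2) = fun q : ℂ × ℂ × ℂ =>
      (q.2.1 - q.2.2 * cf κ q.1 q.2.1 q.2.2 1) / (4 * (2 + (1 + 2 * κ))) from rfl]
    fun_prop
  | n+3, ih =>
    have i0 := ih n (by omega)
    have i1 := ih (n+1) (by omega)
    have i2 := ih (n+2) (by omega)
    rw [show (fun q : ℂ × ℂ × ℂ => cf κ q.1 q.2.1 q.2.2 (n+3)) = fun q : ℂ × ℂ × ℂ =>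
      (q.1 * cf κ q.1 q.2.1 q.2.2 n + q.2.1 * cf κ q.1 q.2.1 q.2.2 (n+1)
        - q.2.2 * cf κ q.1 q.2.1 q.2.2 (n+2)) /
      ((2 * n + 6) * (2 * n + 4 + (1 + 2 * κ))) from rfl]
    fun_prop

lemma ff_differentiable (κ : ℕ) :
    Differentiable ℂ (fun q : ℂ × ℂ × ℂ × ℂ => ff κ q.1 q.2.1 q.2.2.1 q.2.2.2) := by
  intro x
  obtain ⟨K, hK⟩ := cf_bound κ (‖x‖ + 1) (2 * (‖x‖ + 1)) (by linarith [norm_nonneg x])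
    (by linarith [norm_nonneg x])
  have hK0 : 0 ≤ K := by
    refine le_trans ?_ (hK 0 0 0 ?_ ?_ ?_ 0)
    · positivity
    all_goals simp; positivity
  refine differentiableAt_tsum_loc (f := fun n (q : ℂ × ℂ × ℂ × ℂ) => cf κ q.1 q.2.1 q.2.2.1 n *
    q.2.2.2 ^ n) (R := 1) (u := fun n => K * (1/2) ^ n) one_pos ?_ ?_ ?_
  · intro n
    have h := cf_differentiable κ n
    have h2 : Differentiable ℂ (fun q : ℂ × ℂ × ℂ × ℂ => cf κ q.1 q.2.1 q.2.2.1 n) :=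
      h.comp (g := fun q : ℂ × ℂ × ℂ => cf κ q.1 q.2.1 q.2.2 n)
        (f := fun q : ℂ × ℂ × ℂ × ℂ => ((q.1, q.2.1, q.2.2.1) : ℂ × ℂ × ℂ)) (by fun_prop)
    exact (h2.mul (by fun_prop)).differentiableOn
  · exact (summable_geometric_two).mul_left K
  · intro n y hy
    have hy' : ‖y‖ ≤ ‖x‖ + 1 := by
      rw [mem_ball, dist_eq_norm] at hy
      have := norm_le_norm_add_norm_sub' y x
      linarith
    have n1 : ‖y.1‖ ≤ ‖x‖ + 1 := (norm_fst_le y).trans hy'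
    have n2 : ‖y.2.1‖ ≤ ‖x‖ + 1 := (norm_fst_le y.2).trans ((norm_snd_le y).trans hy')
    have n22 : ‖y.2.2‖ ≤ ‖x‖ + 1 := (norm_snd_le y.2).trans ((norm_snd_le y).trans hy')
    have n3 : ‖y.2.2.1‖ ≤ ‖x‖ + 1 := (norm_fst_le y.2.2).trans n22
    have n4 : ‖y.2.2.2‖ ≤ ‖x‖ + 1 := (norm_snd_le y.2.2).trans n22
    have h := hK _ _ _ n1 n2 n3 n
    rw [norm_mul, norm_pow]
    rw [mul_pow] at h
    have h3 : ‖y.2.2.2‖ ^ n ≤ (‖x‖ + 1) ^ n := by gcongr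
    have h4 : ‖cf κ y.1 y.2.1 y.2.2.1 n‖ * ‖y.2.2.2‖ ^ n ≤
      ‖cf κ y.1 y.2.1 y.2.2.1 n‖ * (‖x‖ + 1) ^ n := by gcongr
    have h5 : (0:ℝ) < 2 ^ n := by positivity
    rw [one_div, inv_pow, ← div_eq_mul_inv, le_div_iff₀ h5]
    nlinarith

lemma ff_differentiable_w (κ : ℕ) (e a l : ℂ) : Differentiable ℂ (ff κ e a l) :=
  (ff_differentiable κ).comp (f := fun w : ℂ => ((e, a, l, w) : ℂ × ℂ × ℂ × ℂ)) (by fun_prop)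

lemma ff_hasDerivAt (κ : ℕ) (e a l w : ℂ) : HasDerivAt (ff κ e a l) (ff' κ e a l w) w :=
  (ff_differentiable_w κ e a l w).hasDerivAt

lemma ff'_differentiable (κ : ℕ) :
    Differentiable ℂ (fun q : ℂ × ℂ × ℂ × ℂ => ff' κ q.1 q.2.1 q.2.2.1 q.2.2.2) := by
  have h := differentiableOn_fderiv_apply isOpen_univ (ff_differentiable κ).differentiableOn
    ((0, 0, 0, 1) : ℂ × ℂ × ℂ × ℂ)
  rw [differentiableOn_univ] at h
  suffices heq : (fun q : ℂ × ℂ × ℂ × ℂ => ff' κ q.1 q.2.1 q.2.2.1 q.2.2.2) = fun x =>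
      (fderiv ℂ (fun q : ℂ × ℂ × ℂ × ℂ => ff κ q.1 q.2.1 q.2.2.1 q.2.2.2) x) (0, 0, 0, 1) by
    rw [heq]; exact h
  funext q
  have h1 : HasFDerivAt (fun q : ℂ × ℂ × ℂ × ℂ => ff κ q.1 q.2.1 q.2.2.1 q.2.2.2) _ q :=
    (ff_differentiable κ q).hasFDerivAt
  have h2 : HasDerivAt (fun w : ℂ => ((q.1, q.2.1, q.2.2.1, w) : ℂ × ℂ × ℂ × ℂ)) (0, 0, 0, 1) q.2.2.2 :=
    (hasDerivAt_const _ _).prodMk ((hasDerivAt_const _ _).prodMk ((hasDerivAt_const _ _).prodMk (hasDerivAt_id _)))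
  have h3 := HasFDerivAt.comp_hasDerivAt q.2.2.2 h1 h2
  exact (ff_hasDerivAt κ _ _ _ _).unique h3

lemma ff'_differentiable_w (κ : ℕ) (e a l : ℂ) : Differentiable ℂ (ff' κ e a l) :=
  (ff'_differentiable κ).comp (f := fun w : ℂ => ((e, a, l, w) : ℂ × ℂ × ℂ × ℂ)) (by fun_prop)

lemma cf_summable (κ : ℕ) (e a l : ℂ) (r : ℝ) (hr : 0 ≤ r) :
    Summable (fun n : ℕ => ‖cf κ e a l n‖ * r ^ n) := by
  obtain ⟨K, hK⟩ := cf_bound κ (‖e‖ + ‖a‖ + ‖l‖ + 1) (2 * (r + 1))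
    (by linarith [norm_nonneg e, norm_nonneg a, norm_nonneg l]) (by linarith)
  refine Summable.of_nonneg_of_le (fun n => by positivity) (fun n => ?_)
    ((summable_geometric_two).mul_left K)
  have h := hK e a l (by linarith [norm_nonneg e, norm_nonneg a, norm_nonneg l])
    (by linarith [norm_nonneg e, norm_nonneg a, norm_nonneg l])
    (by linarith [norm_nonneg e, norm_nonneg a, norm_nonneg l]) n
  rw [mul_pow] at h
  have h3 : r ^ n ≤ (r + 1) ^ n := by gcongr; linarith
  have h4 : ‖cf κ e a l n‖ * r ^ n ≤ ‖cf κ e a l n‖ * (r + 1) ^ n := by gcongr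
  have h5 : (0:ℝ) < 2 ^ n := by positivity
  rw [one_div, inv_pow, ← div_eq_mul_inv, le_div_iff₀ h5]
  nlinarith

lemma ff_hasSum (κ : ℕ) (e a l w : ℂ) :
    HasSum (fun n => cf κ e a l n * w ^ n) (ff κ e a l w) := by
  refine Summable.hasSum ?_
  refine Summable.of_norm ?_
  simpa only [norm_mul, norm_pow] using cf_summable κ e a l ‖w‖ (norm_nonneg _)

lemma pser {c : ℕ → ℂ} (h : ∀ r : ℝ, 0 ≤ r → Summable (fun n : ℕ => ‖c n‖ * r ^ n)) :
    (∀ r : ℝ, 0 ≤ r → Summable (fun n : ℕ => ‖(n + 1) * c (n + 1)‖ * r ^ n)) ∧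
    ∀ w, HasDerivAt (fun w => ∑' n, c n * w ^ n) (∑' n : ℕ, ((n + 1) * c (n + 1)) * w ^ n) w := by
  have hs : (∀ r : ℝ, 0 ≤ r → Summable (fun n : ℕ => ‖(n + 1) * c (n + 1)‖ * r ^ n)) := by
    intro r hr
    have h1 := (summable_nat_add_iff 1).2 (h (2 * (r + 1)) (by positivity))
    refine Summable.of_nonneg_of_le (fun n => by positivity) (fun n => ?_) h1
    have e1 : ‖((n:ℂ) + 1)‖ = n + 1 := by
      rw [show ((n:ℂ) + 1) = ((n + 1 : ℕ) : ℂ) by push_cast; ring, Complex.norm_natCast]; push_cast; ring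
    rw [norm_mul, e1, mul_pow]
    have e2 : (n:ℝ) + 1 ≤ 2 ^ (n + 1) := by
      have := (Nat.lt_two_pow_self (n := n + 1)).le
      exact_mod_cast this
    have e3 : r ^ n ≤ (r + 1) ^ (n + 1) := by
      calc r ^ n ≤ (r + 1) ^ n := by gcongr; linarith
        _ ≤ _ := pow_le_pow_right₀ (by linarith) (by omega)
    calc (n + 1) * ‖c (n+1)‖ * r ^ n = ‖c (n+1)‖ * ((n + 1) * r ^ n) := by ring
      _ ≤ _ := by gcongr
  refine ⟨hs, fun w => ?_⟩
  have hb : ∀ (n : ℕ) (z : ℂ), z ∈ ball (0:ℂ) (‖w‖ + 1) → ‖c n * z ^ n‖ ≤ ‖c n‖ * (‖w‖ + 1) ^ n := by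
    intro n z hz
    rw [norm_mul, norm_pow]
    rw [mem_ball_zero_iff] at hz
    gcongr
  have hd := differentiableOn_tsum_of_summable_norm (U := ball (0:ℂ) (‖w‖ + 1))
    (F := fun n w => c n * w ^ n) (h (‖w‖ + 1) (by positivity))
    (fun i => by fun_prop) isOpen_ball hb
  have hd2 := (hd.differentiableAt (isOpen_ball.mem_nhds (by simp : w ∈ ball (0:ℂ) (‖w‖ + 1)))).hasDerivAt
  have hsum := hasSum_deriv_of_summable_norm (U := ball (0:ℂ) (‖w‖ + 1)) (z := w)
    (F := fun n w => c n * w ^ n) (h (‖w‖ + 1) (by positivity))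
    (fun i => by fun_prop) isOpen_ball hb (by simp)
  rw [← (hasSum_nat_add_iff' 1)] at hsum
  simp only [Finset.range_one, Finset.sum_singleton, pow_zero, mul_one, deriv_const, sub_zero] at hsum
  convert! hd2 using 1
  rw [← hsum.tsum_eq]
  refine tsum_congr fun n => ?_
  simp
  ring

lemma ff'_hasSum (κ : ℕ) (e a l w : ℂ) :
    HasSum (fun n : ℕ => ((n + 1) * cf κ e a l (n + 1)) * w ^ n) (ff' κ e a l w) := by
  obtain ⟨h1, h2⟩ := pser (cf_summable κ e a l)
  rw [(ff_hasDerivAt κ e a l w).unique (h2 w)]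
  refine (Summable.of_norm ?_).hasSum
  simpa only [norm_mul, norm_pow] using h1 ‖w‖ (norm_nonneg _)

lemma ff_ode (κ : ℕ) (e a l w : ℂ) :
    4 * w * deriv (ff' κ e a l) w + 2 * (1 + 2 * κ) * ff' κ e a l w =
      (e * w ^ 2 + a * w - l) * ff κ e a l w := by
  obtain ⟨h1, h2⟩ := pser (cf_summable κ e a l)
  obtain ⟨h3, h4⟩ := pser h1
  have e1 : ff' κ e a l = (fun w => ∑' n : ℕ, ((n + 1) * cf κ e a l (n + 1)) * w ^ n) := by
    funext w; exact (ff'_hasSum κ e a l w).tsum_eq.symm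
  have d2 : HasSum (fun n : ℕ => ((n + 1) * (((n + 1 : ℕ) + 1) * cf κ e a l (n + 1 + 1))) * w ^ n)
      (deriv (ff' κ e a l) w) := by
    rw [e1, (h4 w).deriv]
    refine (Summable.of_norm ?_).hasSum
    simpa only [norm_mul, norm_pow] using h3 ‖w‖ (norm_nonneg _)
  have d1 := ff'_hasSum κ e a l w
  have d0 := ff_hasSum κ e a l w
  -- left side minus two terms
  have L1 := (d2.mul_left (4 * w))
  have L1' := (hasSum_nat_add_iff' 1).2 L1
  have L2' := (hasSum_nat_add_iff' 2).2 (d1.mul_left (2 * (1 + 2 * (κ:ℂ))))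
  have LL := L1'.add L2'
  have R0 := d0.mul_left (e * w ^ 2)
  have R1 := (hasSum_nat_add_iff' 1).2 (d0.mul_left (a * w))
  have R2 := (hasSum_nat_add_iff' 2).2 (d0.mul_left (-l))
  have RR := (R0.add R1).add R2
  have := LL.unique (RR.congr_fun ?_)
  · have hk : (1 + 2 * (κ:ℂ)) ≠ 0 := by
      have : ((1 + 2 * κ : ℕ) : ℂ) ≠ 0 := by exact_mod_cast (by omega)
      push_cast at this; exact this
    have hk2 : (2 + (1 + 2 * (κ:ℂ))) ≠ 0 := by
      have : ((2 + (1 + 2 * κ) : ℕ) : ℂ) ≠ 0 := by exact_mod_cast (by omega)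
      push_cast at this; exact this
    have c1 : 2 * (1 + 2 * (κ:ℂ)) * cf κ e a l 1 = -l := by rw [cf]; field_simp
    have c2 : 4 * (2 + (1 + 2 * (κ:ℂ))) * cf κ e a l 2 = a - l * cf κ e a l 1 := by
      rw [show cf κ e a l 2 = (a - l * cf κ e a l 1) / (4 * (2 + (1 + 2 * κ))) from rfl]; field_simp
    have c0 : cf κ e a l 0 = 1 := rfl
    simp [Finset.sum_range_succ, c0] at this
    linear_combination this + c1 + w * c2
  · intro n
    have h3 : ((2 * n + 6) * (2 * n + 4 + (1 + 2 * (κ:ℂ)))) * cf κ e a l (n+3) =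
      (e * cf κ e a l n + a * cf κ e a l (n+1) - l * cf κ e a l (n+2)) := by
      rw [show cf κ e a l (n+3) = (e * cf κ e a l n + a * cf κ e a l (n+1) - l * cf κ e a l (n+2)) /
      ((2 * n + 6) * (2 * n + 4 + (1 + 2 * κ))) from rfl]
      have hk : ((2 * n + 6) : ℂ) ≠ 0 := by
        have : ((2 * n + 6 : ℕ) : ℂ) ≠ 0 := Nat.cast_ne_zero.2 (by omega)
        push_cast at this; exact this
      have hk2 : (2 * n + 4 + (1 + 2 * (κ:ℂ))) ≠ 0 := by
        have : ((2 * n + 4 + (1 + 2 * κ) : ℕ) : ℂ) ≠ 0 := by exact_mod_cast (by omega)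
        push_cast at this; exact this
      field_simp
    push_cast
    simp only [show n + 1 + 1 = n + 2 from rfl, show n + 2 + 1 = n + 3 from rfl]
    linear_combination w^(n+2) * h3

lemma ff_zero (κ : ℕ) (e a l : ℂ) : ff κ e a l 0 = 1 := by
  rw [ff, tsum_eq_single 0]
  · simp [cf]
  · intro n hn; simp [hn]

lemma ff'_zero (κ : ℕ) (e a l : ℂ) : ff' κ e a l 0 = -l / (2 * (1 + 2 * κ)) := by
  rw [← (ff'_hasSum κ e a l 0).tsum_eq, tsum_eq_single 0]
  · simp [cf]
  · intro n hn; simp [hn]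

lemma cf_scale (κ : ℕ) (c e a l : ℂ) (n : ℕ) :
    cf κ (c ^ 6 * e) (c ^ 4 * a) (c ^ 2 * l) n = c ^ (2 * n) * cf κ e a l n := by
  induction n using Nat.strong_induction_on with
  | _ n ih =>
  match n, ih with
  | 0, _ => simp [cf]
  | 1, _ => simp only [cf]; ring
  | 2, _ => simp only [cf]; ring
  | n+3, ih =>
    have i0 := ih n (by omega)
    have i1 := ih (n+1) (by omega)
    have i2 := ih (n+2) (by omega)
    rw [cf, cf, i0, i1, i2]; ring

lemma ff_scale (κ : ℕ) (c e a l w : ℂ) :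
    ff κ (c ^ 6 * e) (c ^ 4 * a) (c ^ 2 * l) w = ff κ e a l (c ^ 2 * w) := by
  unfold ff
  refine tsum_congr fun n => ?_
  rw [cf_scale]; ring

lemma ff'_scale (κ : ℕ) (c e a l w : ℂ) :
    ff' κ (c ^ 6 * e) (c ^ 4 * a) (c ^ 2 * l) w = c ^ 2 * ff' κ e a l (c ^ 2 * w) := by
  have h1 := ff_hasDerivAt κ (c ^ 6 * e) (c ^ 4 * a) (c ^ 2 * l) w
  have h2 : HasDerivAt (fun w => ff κ e a l (c ^ 2 * w)) (ff' κ e a l (c ^ 2 * w) * (c ^ 2)) w := by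
    have h3 : HasDerivAt (fun w : ℂ => c ^ 2 * w) (c ^ 2) w := by
      simpa using (hasDerivAt_id w).const_mul (c ^ 2)
    exact (ff_hasDerivAt κ e a l (c ^ 2 * w)).comp w h3
  have h4 : ff κ (c ^ 6 * e) (c ^ 4 * a) (c ^ 2 * l) = fun w => ff κ e a l (c ^ 2 * w) := by
    funext w; exact ff_scale κ c e a l w
  rw [h4] at h1
  rw [h1.unique h2]; ring

/-- The even (`κ = 0`) or odd (`κ = 1`) solution of `y'' = (e z^4 + a z^2 - l) y`. -/
noncomputable def G (κ : ℕ) (e a l z : ℂ) : ℂ := z ^ κ * ff κ e a l (z ^ 2)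

noncomputable def G' (κ : ℕ) (e a l z : ℂ) : ℂ :=
  κ * z ^ (κ - 1) * ff κ e a l (z ^ 2) + z ^ κ * (2 * z * ff' κ e a l (z ^ 2))

lemma G_hasDerivAt (κ : ℕ) (e a l z : ℂ) : HasDerivAt (G κ e a l) (G' κ e a l z) z := by
  have h1 : HasDerivAt (fun z : ℂ => z ^ 2) (2 * z) z := by simpa using hasDerivAt_pow 2 z
  have h2 := (ff_hasDerivAt κ e a l (z ^ 2)).comp z h1
  have h3 := (hasDerivAt_pow κ z).mul h2
  refine h3.congr_deriv ?_
  simp only [G', Function.comp]; ring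

lemma G'_hasDerivAt (κ : ℕ) (hκ : κ = 0 ∨ κ = 1) (e a l z : ℂ) :
    HasDerivAt (G' κ e a l) ((e * z ^ 4 + a * z ^ 2 - l) * G κ e a l z) z := by
  have h1 : HasDerivAt (fun z : ℂ => z ^ 2) (2 * z) z := by simpa using hasDerivAt_pow 2 z
  have h2 := (ff_hasDerivAt κ e a l (z ^ 2)).comp z h1
  have h3 := ((ff'_differentiable_w κ e a l (z ^ 2)).hasDerivAt).comp z h1
  have h4 := ff_ode κ e a l (z ^ 2)
  have h5 := ((hasDerivAt_id z).const_mul 2).mul h3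
  have h6 := (hasDerivAt_pow κ z).mul h5
  rcases hκ with rfl | rfl
  · have h7 : G' 0 e a l = ((fun x => x ^ 0) * ((fun x : ℂ => 2 * id x) * ff' 0 e a l ∘ fun z => z ^ 2)) := by
      funext x; simp [G']
    rw [h7]
    refine h6.congr_deriv ?_
    simp [G] at h4 ⊢
    linear_combination h4
  · have h8 := h2.add h6
    have h7 : G' 1 e a l = (ff 1 e a l ∘ fun z => z ^ 2) + ((fun x => x ^ 1) * ((fun x : ℂ => 2 * id x) * ff' 1 e a l ∘ fun z => z ^ 2)) := by
      funext x; simp [G']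
    rw [h7]
    refine h8.congr_deriv ?_
    simp [G] at h4 ⊢
    linear_combination z * h4

lemma G_scale (κ : ℕ) (c e a l z : ℂ) :
    G κ e a l (c * z) = c ^ κ * G κ (c ^ 6 * e) (c ^ 4 * a) (c ^ 2 * l) z := by
  rw [G, G, ff_scale, mul_pow, mul_pow]; ring

lemma G_differentiable (κ : ℕ) :
    Differentiable ℂ (fun q : ℂ × ℂ × ℂ × ℂ => G κ q.1 q.2.1 q.2.2.1 q.2.2.2) := by
  unfold G
  have h := (ff_differentiable κ).comp (f := fun q : ℂ × ℂ × ℂ × ℂ =>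
    ((q.1, q.2.1, q.2.2.1, q.2.2.2 ^ 2) : ℂ × ℂ × ℂ × ℂ)) (by fun_prop)
  exact Differentiable.mul (by fun_prop) h

lemma G'_differentiable (κ : ℕ) :
    Differentiable ℂ (fun q : ℂ × ℂ × ℂ × ℂ => G' κ q.1 q.2.1 q.2.2.1 q.2.2.2) := by
  unfold G'
  have h := (ff_differentiable κ).comp (f := fun q : ℂ × ℂ × ℂ × ℂ =>
    ((q.1, q.2.1, q.2.2.1, q.2.2.2 ^ 2) : ℂ × ℂ × ℂ × ℂ)) (by fun_prop)
  have h' := (ff'_differentiable κ).comp (f := fun q : ℂ × ℂ × ℂ × ℂ =>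
    ((q.1, q.2.1, q.2.2.1, q.2.2.2 ^ 2) : ℂ × ℂ × ℂ × ℂ)) (by fun_prop)
  exact (Differentiable.mul (by fun_prop) h).add
    (Differentiable.mul (by fun_prop) (Differentiable.mul (by fun_prop) h'))

lemma G_neg (κ : ℕ) (e a l z : ℂ) : G κ e a l (-z) = (-1) ^ κ * G κ e a l z := by
  rw [G, G, neg_pow, neg_sq]; ring

end EQ

namespace EQ
open Metric Set MeasureTheory Topology

lemma wronsk_eq {U : Set ℂ} (hU : IsOpen U) (hc : IsPreconnected U) {V y y' u u' : ℂ → ℂ}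
    (h1 : ∀ z ∈ U, HasDerivAt y (y' z) z) (h2 : ∀ z ∈ U, HasDerivAt y' (V z * y z) z)
    (h3 : ∀ z ∈ U, HasDerivAt u (u' z) z) (h4 : ∀ z ∈ U, HasDerivAt u' (V z * u z) z)
    {z w : ℂ} (hz : z ∈ U) (hw : w ∈ U) :
    y z * u' z - y' z * u z = y w * u' w - y' w * u w := by
  have hd : ∀ z ∈ U, HasDerivAt (fun z => y z * u' z - y' z * u z) 0 z := by
    intro z hz
    refine (((h1 z hz).mul (h4 z hz)).sub ((h2 z hz).mul (h3 z hz))).congr_deriv ?_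
    ring
  exact hU.is_const_of_deriv_eq_zero hc (fun z hz => (hd z hz).differentiableAt.differentiableWithinAt)
    (fun z hz => (hd z hz).deriv) hz hw

lemma G_zero_zero (e a l : ℂ) : G 0 e a l 0 = 1 := by simp [G, ff_zero]
lemma G_one_zero (e a l : ℂ) : G 1 e a l 0 = 0 := by simp [G]
lemma G'_zero_zero (e a l : ℂ) : G' 0 e a l 0 = 0 := by simp [G']
lemma G'_one_zero (e a l : ℂ) : G' 1 e a l 0 = 1 := by simp [G', ff_zero]

lemma wronsk_EO (e a l z : ℂ) : G 0 e a l z * G' 1 e a l z - G' 0 e a l z * G 1 e a l z = 1 := by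
  rw [wronsk_eq (V := fun z => e * z ^ 4 + a * z ^ 2 - l) isOpen_univ isPreconnected_univ
    (fun z _ => G_hasDerivAt 0 e a l z) (fun z _ => G'_hasDerivAt 0 (Or.inl rfl) e a l z)
    (fun z _ => G_hasDerivAt 1 e a l z) (fun z _ => G'_hasDerivAt 1 (Or.inr rfl) e a l z)
    (mem_univ z) (mem_univ 0), G_zero_zero, G'_one_zero, G_one_zero, G'_zero_zero]
  ring

lemma G_G'_ne (κ : ℕ) (hκ : κ = 0 ∨ κ = 1) (e a l z : ℂ) (h : G κ e a l z = 0) :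
    G' κ e a l z ≠ 0 := by
  intro h'
  have := wronsk_EO e a l z
  rcases hκ with rfl | rfl <;> rw [h, h'] at this <;> simp at this

lemma ff_ff'_ne (κ : ℕ) (hκ : κ = 0 ∨ κ = 1) (e a l w : ℂ) (h : ff κ e a l w = 0) :
    ff' κ e a l w ≠ 0 := by
  intro h'
  obtain ⟨z, hz⟩ : ∃ z : ℂ, z ^ 2 = w := by
    obtain ⟨z, hz⟩ := IsAlgClosed.exists_pow_nat_eq w (n := 2) (by norm_num)
    exact ⟨z, hz⟩
  rw [← hz] at h h'
  refine G_G'_ne κ hκ e a l z ?_ ?_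
  · rw [G, h, mul_zero]
  · rw [G', h, h']; ring

/-- Entire solutions are combinations of the even and odd ones. -/
lemma entire_sol {e a l : ℂ} {y y' : ℂ → ℂ} (h1 : ∀ z, HasDerivAt y (y' z) z)
    (h2 : ∀ z, HasDerivAt y' ((e * z ^ 4 + a * z ^ 2 - l) * y z) z) (z : ℂ) :
    y z = y 0 * G 0 e a l z + y' 0 * G 1 e a l z := by
  have w1 := wronsk_eq (V := fun z => e * z ^ 4 + a * z ^ 2 - l) isOpen_univ isPreconnected_univ
    (fun z _ => h1 z) (fun z _ => h2 z)
    (fun z _ => G_hasDerivAt 0 e a l z) (fun z _ => G'_hasDerivAt 0 (Or.inl rfl) e a l z)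
    (mem_univ z) (mem_univ 0)
  have w2 := wronsk_eq (V := fun z => e * z ^ 4 + a * z ^ 2 - l) isOpen_univ isPreconnected_univ
    (fun z _ => h1 z) (fun z _ => h2 z)
    (fun z _ => G_hasDerivAt 1 e a l z) (fun z _ => G'_hasDerivAt 1 (Or.inr rfl) e a l z)
    (mem_univ z) (mem_univ 0)
  rw [G_zero_zero, G'_zero_zero] at w1
  rw [G_one_zero, G'_one_zero] at w2
  linear_combination (-y z) * wronsk_EO e a l z + G 0 e a l z * w2 - G 1 e a l z * w1

end EQ

namespace EQ
open Metric Set MeasureTheory Topology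

lemma hasFDerivAt_shift_integral {E : Type*} [NormedAddCommGroup E] [NormedSpace ℂ E]
    [FiniteDimensional ℂ E] {f : E → ℂ} {v x : E} {R : ℝ} {B : ℝ → ℝ} (hR : 0 < R)
    (hf : ∀ t : ℝ, 0 ≤ t → DifferentiableOn ℂ f (ball (x + (t:ℂ) • v) R))
    (hB : IntegrableOn B (Ioi 0)) (hB0 : Tendsto B atTop (𝓝 0))
    (hb : ∀ t : ℝ, 0 ≤ t → ∀ y ∈ ball x R, ‖f (y + (t:ℂ) • v)‖ ≤ B t) :
    ∃ L : E →L[ℂ] ℂ, HasFDerivAt (fun y => ∫ t in Ioi (0:ℝ), f (y + (t:ℂ) • v)) L x ∧ L v = - f x := by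
  have hdiff : ∀ t : ℝ, 0 ≤ t → ∀ y ∈ ball x R, DifferentiableAt ℂ f (y + (t:ℂ) • v) := by
    intro t ht y hy
    refine (hf t ht).differentiableAt (isOpen_ball.mem_nhds ?_)
    rw [mem_ball, dist_eq_norm] at hy ⊢
    simpa using hy
  have hcy : ∀ y ∈ ball x R, ContinuousOn (fun t : ℝ => f (y + (t:ℂ) • v)) (Ici 0) := by
    intro y hy t ht
    have h1 := (hdiff t ht y hy).continuousAt
    have h2 : ContinuousAt (fun t : ℝ => y + (t:ℂ) • v) t := by fun_prop
    exact (ContinuousAt.comp (f := fun t : ℝ => y + (t:ℂ) • v) h1 h2).continuousWithinAt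
  have hmy : ∀ y ∈ ball x R, AEStronglyMeasurable (fun t : ℝ => f (y + (t:ℂ) • v))
      (volume.restrict (Ioi 0)) := fun y hy =>
    ((hcy y hy).mono Ioi_subset_Ici_self).aestronglyMeasurable measurableSet_Ioi
  have hintg : IntegrableOn (fun t : ℝ => f (x + (t:ℂ) • v)) (Ioi 0) := by
    refine Integrable.mono' hB (hmy x (mem_ball_self hR)) ?_
    refine (ae_restrict_iff' measurableSet_Ioi).2 (Eventually.of_forall fun t ht => ?_)
    exact hb t (le_of_lt ht) x (mem_ball_self hR)
  have hfb : ∀ t : ℝ, 0 ≤ t → ∀ y ∈ ball x (R/2), ‖fderiv ℂ f (y + (t:ℂ) • v)‖ ≤ 2 * B t / (R/2) := by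
    intro t ht y hy
    have hsub : ∀ w ∈ ball (y + (t:ℂ) • v) (R/2), w - (t:ℂ) • v ∈ ball x R := by
      intro w hw
      rw [mem_ball, dist_eq_norm] at hw hy ⊢
      have : w - (t:ℂ) • v - x = (w - (y + (t:ℂ) • v)) + (y - x) := by abel
      rw [this]
      refine (norm_add_le _ _).trans_lt (by linarith)
    refine norm_fderiv_le_cauchy (half_pos hR) ?_ ?_
    · intro w hw
      have := hdiff t ht _ (hsub w hw)
      rw [sub_add_cancel] at this
      exact this.differentiableWithinAt
    · intro w hw
      have := hb t ht _ (hsub w hw)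
      rwa [sub_add_cancel] at this
  have hmf : AEStronglyMeasurable (fun t : ℝ => fderiv ℂ f (x + (t:ℂ) • v))
      (volume.restrict (Ioi 0)) := by
    borelize E
    borelize (E →L[ℂ] ℂ)
    have : ProperSpace (E →L[ℂ] ℂ) := FiniteDimensional.proper ℂ _
    have hm : Measurable (fderiv ℂ f) := measurable_fderiv ℂ f
    have hc2 : Continuous (fun t : ℝ => x + (t:ℂ) • v) := by fun_prop
    exact (hm.comp hc2.measurable).aestronglyMeasurable
  have hbi : IntegrableOn (fun t => 2 * B t / (R/2)) (Ioi 0) := (hB.const_mul 2).div_const _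
  have hfi : IntegrableOn (fun t : ℝ => fderiv ℂ f (x + (t:ℂ) • v)) (Ioi 0) := by
    refine Integrable.mono' hbi hmf ?_
    refine (ae_restrict_iff' measurableSet_Ioi).2 (Eventually.of_forall fun t ht => ?_)
    exact hfb t (le_of_lt ht) x (mem_ball_self (half_pos hR))
  refine ⟨∫ t in Ioi (0:ℝ), fderiv ℂ f (x + (t:ℂ) • v), ?_, ?_⟩
  · refine hasFDerivAt_integral_of_dominated_of_fderiv_le (F := fun y (t : ℝ) => f (y + (t:ℂ) • v))
      (F' := fun y (t : ℝ) => fderiv ℂ f (y + (t:ℂ) • v))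
      (ball_mem_nhds x (half_pos hR)) ?_ hintg hmf ?_ hbi ?_
    · exact eventually_of_mem (ball_mem_nhds x hR) hmy
    · refine (ae_restrict_iff' measurableSet_Ioi).2 (Eventually.of_forall fun t ht => ?_)
      exact hfb t (le_of_lt ht)
    · refine (ae_restrict_iff' measurableSet_Ioi).2 (Eventually.of_forall fun t ht => ?_)
      intro y hy
      have h1 := (hdiff t (le_of_lt ht) y (ball_subset_ball (by linarith) hy)).hasFDerivAt
      have h2 : HasFDerivAt (fun y : E => y + (t:ℂ) • v) (ContinuousLinearMap.id ℂ E) y :=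
        (hasFDerivAt_id y).add_const _
      exact h1.comp y h2
  · have h0 : (∫ t in Ioi (0:ℝ), fderiv ℂ f (x + (t:ℂ) • v)) v =
      ∫ t in Ioi (0:ℝ), fderiv ℂ f (x + (t:ℂ) • v) v :=
      ContinuousLinearMap.integral_apply hfi v
    rw [h0]
    have := integral_Ioi_of_hasDerivAt_of_tendsto' (a := (0:ℝ)) (f := fun t : ℝ => f (x + (t:ℂ) • v))
      (f' := fun t : ℝ => fderiv ℂ f (x + (t:ℂ) • v) v) (m := 0) ?_ ?_ ?_
    · rw [this]; simp
    · intro t ht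
      have h1 := (hdiff t ht x (mem_ball_self hR)).hasFDerivAt
      have h2 : HasDerivAt (fun t : ℂ => x + t • v) v (t:ℂ) := by
        simpa using ((hasDerivAt_id (t:ℂ)).smul_const v).const_add x
      have h3 := h1.comp_hasDerivAt (t:ℂ) h2
      exact h3.comp_ofReal
    · exact ((ContinuousLinearMap.apply ℂ ℂ v).integrable_comp hfi)
    · refine squeeze_zero_norm' ?_ hB0
      filter_upwards [eventually_ge_atTop 0] with t ht
      exact hb t ht x (mem_ball_self hR)

end EQ

namespace EQ
open Metric Set MeasureTheory Topology

noncomputable def mm (q : ℂ × ℂ × ℂ) : ℝ := ‖q.2.1‖ ^ 2 / 4 + ‖q.2.2‖ + ‖q.2.1‖ + 2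

def Om : Set (ℂ × ℂ × ℂ) := {q | 2 * mm q < q.1.re ∧ |q.1.im| < 0.6 * q.1.re}

def e1 : ℂ × ℂ × ℂ := (1, 0, 0)

noncomputable def AA (q : ℂ × ℂ × ℂ) : ℂ := q.1 ^ 2 * exp (2 * (q.1 ^ 3 / 3 + q.2.1 * q.1 / 2))

noncomputable def th (q : ℂ × ℂ × ℂ) : ℂ := q.1 ^ 2 + q.2.1 / 2 + 1 / q.1

noncomputable def rh (q : ℂ × ℂ × ℂ) : ℂ := q.2.2 + q.2.1 ^ 2 / 4 + q.2.1 / q.1 + 2 / q.1 ^ 2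

lemma mm_pos (q : ℂ × ℂ × ℂ) : 2 ≤ mm q := by unfold mm; nlinarith [norm_nonneg q.2.1, norm_nonneg q.2.2]

lemma isOpen_Om : IsOpen Om := by
  have h1 : Continuous mm := by unfold mm; fun_prop
  have h2 : Continuous (fun q : ℂ × ℂ × ℂ => q.1.re) := Complex.continuous_re.comp continuous_fst
  have h3 : Continuous (fun q : ℂ × ℂ × ℂ => q.1.im) := Complex.continuous_im.comp continuous_fst
  exact (isOpen_lt (h1.const_mul 2 |>.congr fun _ => rfl) h2).inter (isOpen_lt h3.abs (h2.const_mul 0.6 |>.congr fun _ => rfl))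

lemma shift_fst (q : ℂ × ℂ × ℂ) (t : ℂ) : (q + t • e1).1 = q.1 + t := by simp [e1]
lemma shift_snd (q : ℂ × ℂ × ℂ) (t : ℂ) : (q + t • e1).2 = q.2 := by simp [e1]

lemma mm_shift (q : ℂ × ℂ × ℂ) (t : ℂ) : mm (q + t • e1) = mm q := by
  unfold mm; rw [shift_snd]

lemma shift_mem {q : ℂ × ℂ × ℂ} (hq : q ∈ Om) {t : ℝ} (ht : 0 ≤ t) : q + (t:ℂ) • e1 ∈ Om := by
  obtain ⟨h1, h2⟩ := hq
  refine ⟨?_, ?_⟩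
  · rw [mm_shift, shift_fst]; simp; linarith
  · rw [shift_fst]; simp; linarith

lemma Om_re {q : ℂ × ℂ × ℂ} (hq : q ∈ Om) : 4 < q.1.re := by
  have := mm_pos q; have := hq.1; linarith

lemma Om_ne {q : ℂ × ℂ × ℂ} (hq : q ∈ Om) : q.1 ≠ 0 := by
  intro h; have := Om_re hq; rw [h] at this; simp at this; linarith

lemma Om_norm {q : ℂ × ℂ × ℂ} (hq : q ∈ Om) : 1 ≤ ‖q.1‖ := by
  have := Om_re hq; have := Complex.re_le_norm q.1; linarith

lemma AA_ne {q : ℂ × ℂ × ℂ} (hq : q ∈ Om) : AA q ≠ 0 :=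
  mul_ne_zero (pow_ne_zero _ (Om_ne hq)) (exp_ne_zero _)

lemma AA_differentiable : Differentiable ℂ AA := by unfold AA; fun_prop

lemma rh_differentiableAt {q : ℂ × ℂ × ℂ} (hq : q ∈ Om) : DifferentiableAt ℂ rh q := by
  have := Om_ne hq
  unfold rh; fun_prop (disch := simp [this])

lemma rh_bound {q : ℂ × ℂ × ℂ} (hq : q ∈ Om) : ‖rh q‖ ≤ mm q := by
  have h := Om_norm hq
  have h2 : 1 ≤ ‖q.1‖ ^ 2 := one_le_pow₀ h
  have a1 : ‖q.2.1 / q.1‖ ≤ ‖q.2.1‖ := by rw [norm_div]; exact div_le_self (norm_nonneg _) h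
  have a2 : ‖2 / q.1 ^ 2‖ ≤ 2 := by
    rw [norm_div, norm_pow]
    refine (div_le_self (norm_nonneg _) h2).trans (by simp)
  have a3 : ‖q.2.1 ^ 2 / 4‖ = ‖q.2.1‖ ^ 2 / 4 := by simp
  unfold rh mm
  have := norm_add_le (q.2.2 + q.2.1 ^ 2 / 4 + q.2.1 / q.1) (2 / q.1 ^ 2)
  have := norm_add_le (q.2.2 + q.2.1 ^ 2 / 4) (q.2.1 / q.1)
  have := norm_add_le (q.2.2) (q.2.1 ^ 2 / 4)
  linarith

lemma kernel_bound {q : ℂ × ℂ × ℂ} (hq : q ∈ Om) {t : ℝ} (ht : 0 ≤ t) :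
    ‖AA q‖ * ‖(AA (q + (t:ℂ) • e1))⁻¹‖ ≤ Real.exp (- (q.1.re ^ 2) * t) := by
  obtain ⟨hq1, hq2⟩ := id hq
  have hre := Om_re hq
  have hz : ‖q.1‖ ≤ ‖q.1 + t‖ := by
    rw [← sq_le_sq₀ (norm_nonneg _) (norm_nonneg _), ← Complex.normSq_eq_norm_sq, ← Complex.normSq_eq_norm_sq,
      Complex.normSq_apply, Complex.normSq_apply]
    simp
    nlinarith
  have hz1 := Om_norm hq
  rw [norm_inv, ← div_eq_mul_inv]
  unfold AA
  rw [shift_fst, shift_snd, norm_mul, norm_mul, mul_div_mul_comm, norm_pow, norm_pow, Complex.norm_exp,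
    Complex.norm_exp, ← Real.exp_sub]
  have f1 : ‖q.1‖ ^ 2 / ‖q.1 + t‖ ^ 2 ≤ 1 := by
    have : 0 < ‖q.1 + t‖ := by linarith
    rw [div_le_one (by positivity)]; gcongr
  have f2 : (2 * (q.1 ^ 3 / 3 + q.2.1 * q.1 / 2)).re -
      (2 * ((q.1 + t) ^ 3 / 3 + q.2.1 * (q.1 + t) / 2)).re ≤ - (q.1.re ^ 2) * t := by
    have e : (2 * (q.1 ^ 3 / 3 + q.2.1 * q.1 / 2)) -
      (2 * ((q.1 + t) ^ 3 / 3 + q.2.1 * (q.1 + t) / 2)) =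
      ((-2 * t : ℝ) : ℂ) * q.1 ^ 2 - ((2 * t ^ 2 : ℝ) : ℂ) * q.1 - ((2 * t ^ 3 / 3 : ℝ) : ℂ) - (t : ℂ) * q.2.1 := by
      push_cast; ring
    rw [← Complex.sub_re, e]
    simp only [Complex.sub_re, Complex.re_ofReal_mul, Complex.ofReal_re]
    have e2 : (q.1 ^ 2).re = q.1.re ^ 2 - q.1.im ^ 2 := by simp [pow_two]
    rw [e2]
    have h1 : q.1.im ^ 2 ≤ 0.36 * q.1.re ^ 2 := by
      rw [← sq_abs]
      nlinarith [abs_nonneg q.1.im]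
    have h2 : - q.2.1.re ≤ ‖q.2.1‖ := (neg_le_abs _).trans (Complex.abs_re_le_norm _)
    have h3 : ‖q.2.1‖ ≤ mm q := by unfold mm; nlinarith [norm_nonneg q.2.1, norm_nonneg q.2.2]
    have h4 : - q.2.1.re ≤ 0.28 * q.1.re ^ 2 := by nlinarith
    have h5 : 0 ≤ t ^ 2 * q.1.re := by positivity
    have h6 : 0 ≤ t ^ 3 := by positivity
    have h7 : t * (0.28 * q.1.re ^ 2 + q.2.1.re) ≥ 0 := mul_nonneg ht (by linarith)
    have h8 : t * (0.36 * q.1.re ^ 2 - q.1.im ^ 2) ≥ 0 := mul_nonneg ht (by linarith)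
    nlinarith
  calc _ ≤ 1 * Real.exp (- (q.1.re ^ 2) * t) := by gcongr
    _ = _ := one_mul _

noncomputable def II (f : ℂ × ℂ × ℂ → ℂ) (q : ℂ × ℂ × ℂ) : ℂ := ∫ t in Ioi (0:ℝ), f (q + (t:ℂ) • e1)

noncomputable def HH (f : ℂ × ℂ × ℂ → ℂ) (q : ℂ × ℂ × ℂ) : ℂ :=
  AA q * II (fun q => rh q * f q * (AA q)⁻¹) q

noncomputable def JJ (f : ℂ × ℂ × ℂ → ℂ) (q : ℂ × ℂ × ℂ) : ℂ := - II (HH f) q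

lemma integral_exp_neg (b : ℝ) (hb : 0 < b) :
    ∫ t in Ioi (0:ℝ), Real.exp (-b * t) = 1 / b := by
  rw [integral_exp_mul_Ioi (by linarith)]; simp [neg_div_neg_eq]

lemma HH_bound {f : ℂ × ℂ × ℂ → ℂ} {c : ℝ} (hc : ∀ q ∈ Om, ‖f q‖ ≤ c)
    {q : ℂ × ℂ × ℂ} (hq : q ∈ Om) : ‖HH f q‖ ≤ c * mm q / q.1.re ^ 2 := by
  have hc0 : 0 ≤ c := (norm_nonneg _).trans (hc q hq)
  have hre := Om_re hq
  have h1 : HH f q = ∫ t in Ioi (0:ℝ), AA q * (rh (q + (t:ℂ) • e1) * f (q + (t:ℂ) • e1) *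
      (AA (q + (t:ℂ) • e1))⁻¹) := by
    rw [HH, II, ← integral_const_mul]
  rw [h1]
  have h2 : ∫ t in Ioi (0:ℝ), c * mm q * Real.exp (-(q.1.re ^ 2) * t) = c * mm q / q.1.re ^ 2 := by
    rw [integral_const_mul, integral_exp_neg _ (by positivity)]; ring
  rw [← h2]
  refine norm_integral_le_of_norm_le ((exp_neg_integrableOn_Ioi 0 (by positivity)).const_mul _) ?_
  refine (ae_restrict_iff' measurableSet_Ioi).2 (Eventually.of_forall fun t ht => ?_)
  have ht' : 0 ≤ t := le_of_lt ht
  have hs := shift_mem hq ht'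
  have k1 := kernel_bound hq ht'
  have k2 := rh_bound hs
  rw [mm_shift] at k2
  have k3 := hc _ hs
  have hm := mm_pos q
  calc _ = ‖f (q + (t:ℂ) • e1)‖ * ‖rh (q + (t:ℂ) • e1)‖ * (‖AA q‖ * ‖(AA (q + (t:ℂ) • e1))⁻¹‖) := by
        simp only [norm_mul]; ring
    _ ≤ c * mm q * Real.exp (-(q.1.re ^ 2) * t) := by gcongr

lemma exists_ball_Om {q : ℂ × ℂ × ℂ} (hq : q ∈ Om) : ∃ R > 0, ball q R ⊆ Om ∧
    (∀ p ∈ ball q R, ‖(AA p)⁻¹‖ ≤ ‖(AA q)⁻¹‖ + 1 ∧ mm p ≤ mm q + 1) ∧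
    ∀ t : ℝ, 0 ≤ t → ball (q + (t:ℂ) • e1) R ⊆ Om := by
  have h1 : Om ∈ 𝓝 q := isOpen_Om.mem_nhds hq
  have h2 : ∀ᶠ p in 𝓝 q, ‖(AA p)⁻¹‖ < ‖(AA q)⁻¹‖ + 1 := by
    have : ContinuousAt (fun p => ‖(AA p)⁻¹‖) q :=
      ((AA_differentiable.continuous.continuousAt).inv₀ (AA_ne hq)).norm
    exact this.eventually_lt continuousAt_const (by simp)
  have h3 : ∀ᶠ p in 𝓝 q, mm p < mm q + 1 := by
    have : Continuous mm := by unfold mm; fun_prop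
    exact this.continuousAt.eventually_lt continuousAt_const (by simp)
  obtain ⟨R, hR, hb⟩ := Metric.mem_nhds_iff.1 (Filter.inter_mem h1 (Filter.inter_mem h2 h3))
  refine ⟨R, hR, fun p hp => (hb hp).1, fun p hp => ⟨le_of_lt (hb hp).2.1, le_of_lt (hb hp).2.2⟩, ?_⟩
  intro t ht p hp
  have : p - (t:ℂ) • e1 ∈ ball q R := by
    rw [mem_ball, dist_eq_norm] at hp ⊢
    rwa [sub_sub, add_comm ((t:ℂ) • e1)]
  have := shift_mem (hb this).1 ht
  rwa [sub_add_cancel] at this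

lemma AA_fderiv {q : ℂ × ℂ × ℂ} (hq : q ∈ Om) : fderiv ℂ AA q e1 = 2 * th q * AA q := by
  have h1 := (AA_differentiable q).hasFDerivAt
  have h2 : HasDerivAt (fun t : ℂ => q + t • e1) e1 0 := by
    simpa using ((hasDerivAt_id (0:ℂ)).smul_const e1).const_add q
  have h1' : HasFDerivAt AA (fderiv ℂ AA q) (q + (0:ℂ) • e1) := by simpa using h1
  have h3 := h1'.comp_hasDerivAt (0:ℂ) h2
  have h4 : HasDerivAt (fun t : ℂ => (q.1 + t) ^ 2 * exp (2 * ((q.1 + t) ^ 3 / 3 + q.2.1 * (q.1 + t) / 2)))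
      (2 * th q * AA q) 0 := by
    have hz : HasDerivAt (fun t : ℂ => q.1 + t) 1 0 := (hasDerivAt_id (0:ℂ)).const_add q.1
    have := (hz.pow 2).mul ((((hz.pow 3).div_const 3).add ((hz.const_mul q.2.1).div_const 2)).const_mul 2).cexp
    refine this.congr_deriv ?_
    have := Om_ne hq
    simp [th, AA]
    field_simp
    ring
  have h5 : (AA ∘ fun t : ℂ => q + t • e1) = fun t : ℂ => (q.1 + t) ^ 2 * exp (2 * ((q.1 + t) ^ 3 / 3 + q.2.1 * (q.1 + t) / 2)) := by
    funext t; simp only [Function.comp, AA, shift_fst, shift_snd]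
  rw [h5] at h3
  exact h3.unique h4

lemma HH_diff {f : ℂ × ℂ × ℂ → ℂ} {c : ℝ} (hf : DifferentiableOn ℂ f Om) (hc : ∀ q ∈ Om, ‖f q‖ ≤ c)
    {q : ℂ × ℂ × ℂ} (hq : q ∈ Om) : DifferentiableAt ℂ (HH f) q ∧
      fderiv ℂ (HH f) q e1 = 2 * th q * HH f q - rh q * f q := by
  have hc0 : 0 ≤ c := (norm_nonneg _).trans (hc q hq)
  obtain ⟨R, hR, hb1, hb2, hb3⟩ := exists_ball_Om hq
  have key := hasFDerivAt_shift_integral (f := fun q => rh q * f q * (AA q)⁻¹) (v := e1) (x := q)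
    (B := fun t => (mm q + 1) * c * (‖(AA q)⁻¹‖ + 1) * Real.exp (-1 * t)) hR ?_ ?_ ?_ ?_
  · obtain ⟨L, hL, hLv⟩ := key
    have hA := (AA_differentiable q).hasFDerivAt
    have hm := hA.mul hL
    have heq : HH f = fun y => AA y * (∫ (t : ℝ) in Ioi 0, rh (y + (t:ℂ) • e1) * f (y + (t:ℂ) • e1) * (AA (y + (t:ℂ) • e1))⁻¹) := rfl
    rw [heq]
    refine ⟨hm.differentiableAt, ?_⟩
    have := hm.fderiv
    simp only [Pi.mul_def] at this
    rw [this]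
    simp only [add_apply, smul_apply, smul_eq_mul]
    rw [hLv, AA_fderiv hq]
    have := AA_ne hq
    field_simp
    ring
  · intro t ht p hp
    have hp' := hb3 t ht hp
    exact (((rh_differentiableAt hp').mul (hf.differentiableAt (isOpen_Om.mem_nhds hp'))).mul
      ((AA_differentiable p).inv (AA_ne hp'))).differentiableWithinAt
  · exact (exp_neg_integrableOn_Ioi 0 one_pos).const_mul _
  · have : Tendsto (fun t : ℝ => Real.exp (-1 * t)) atTop (𝓝 0) := by
      simpa using Real.tendsto_exp_neg_atTop_nhds_zero
    simpa using this.const_mul ((mm q + 1) * c * (‖(AA q)⁻¹‖ + 1))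
  · intro t ht p hp
    have hp' := hb1 hp
    have hs := shift_mem hp' ht
    have k1 := kernel_bound hp' ht
    have k2 := (rh_bound hs)
    rw [mm_shift] at k2
    obtain ⟨k4, k5⟩ := hb2 p hp
    have k3 := hc _ hs
    have hre := Om_re hp'
    have hA : 0 < ‖AA p‖ := norm_pos_iff.2 (AA_ne hp')
    have k6 : ‖(AA (p + (t:ℂ) • e1))⁻¹‖ ≤ (‖(AA q)⁻¹‖ + 1) * Real.exp (-1 * t) := by
      have : ‖(AA (p + (t:ℂ) • e1))⁻¹‖ ≤ ‖(AA p)⁻¹‖ * Real.exp (- (p.1.re ^ 2) * t) := by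
        rw [norm_inv (AA p), inv_mul_eq_div, le_div_iff₀ hA, mul_comm]; exact k1
      refine this.trans ?_
      have : Real.exp (- (p.1.re ^ 2) * t) ≤ Real.exp (-1 * t) := by
        apply Real.exp_le_exp.2
        have : 1 ≤ p.1.re ^ 2 := by nlinarith
        nlinarith [mul_le_mul_of_nonneg_right this ht]
      gcongr
    have hm := mm_pos p
    have hm2 := mm_pos q
    rw [norm_mul, norm_mul, mul_assoc ((mm q + 1) * c)]
    gcongr
    exact k2.trans k5

lemma int_inv_sq {x : ℝ} (hx : 0 < x) : IntegrableOn (fun t : ℝ => 1 / (x + t) ^ 2) (Ioi 0) ∧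
    ∫ t in Ioi (0:ℝ), 1 / (x + t) ^ 2 = 1 / x := by
  have hd : ∀ t ∈ Ici (0:ℝ), HasDerivAt (fun t : ℝ => -(x + t)⁻¹) (1 / (x + t) ^ 2) t := by
    intro t ht
    have ht' : 0 ≤ t := ht
    have h1 : HasDerivAt (fun t : ℝ => x + t) 1 t := (hasDerivAt_id t).const_add x
    refine (h1.inv (by positivity)).neg.congr_deriv ?_
    ring
  have hl : Tendsto (fun t : ℝ => -(x + t)⁻¹) atTop (𝓝 0) := by
    have : Tendsto (fun t : ℝ => (x + t)⁻¹) atTop (𝓝 0) :=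
      tendsto_inv_atTop_zero.comp (tendsto_atTop_add_const_left _ _ tendsto_id)
    simpa using this.neg
  refine ⟨integrableOn_Ioi_deriv_of_nonneg' hd (fun t _ => by positivity) hl, ?_⟩
  rw [integral_Ioi_of_hasDerivAt_of_nonneg' hd (fun t _ => by positivity) hl]
  simp

lemma JJ_bound {f : ℂ × ℂ × ℂ → ℂ} {c : ℝ} (hc : ∀ q ∈ Om, ‖f q‖ ≤ c)
    {q : ℂ × ℂ × ℂ} (hq : q ∈ Om) : ‖JJ f q‖ ≤ c * mm q / q.1.re := by
  have hre := Om_re hq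
  obtain ⟨i1, i2⟩ := int_inv_sq (by linarith : 0 < q.1.re)
  have h2 : ∫ t in Ioi (0:ℝ), c * mm q * (1 / (q.1.re + t) ^ 2) = c * mm q / q.1.re := by
    rw [integral_const_mul, i2]; ring
  rw [JJ, norm_neg, II, ← h2]
  refine norm_integral_le_of_norm_le (i1.const_mul _) ?_
  refine (ae_restrict_iff' measurableSet_Ioi).2 (Eventually.of_forall fun t ht => ?_)
  have ht' : 0 ≤ t := le_of_lt ht
  have := HH_bound hc (shift_mem hq ht')
  rw [mm_shift, shift_fst] at this
  simp at this
  refine this.trans (le_of_eq (by ring))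

lemma JJ_diff {f : ℂ × ℂ × ℂ → ℂ} {c : ℝ} (hf : DifferentiableOn ℂ f Om) (hc : ∀ q ∈ Om, ‖f q‖ ≤ c)
    {q : ℂ × ℂ × ℂ} (hq : q ∈ Om) : DifferentiableAt ℂ (JJ f) q ∧ fderiv ℂ (JJ f) q e1 = HH f q := by
  have hc0 : 0 ≤ c := (norm_nonneg _).trans (hc q hq)
  obtain ⟨R, hR, hb1, hb2, hb3⟩ := exists_ball_Om hq
  obtain ⟨i1, i2⟩ := int_inv_sq one_pos
  have key := hasFDerivAt_shift_integral (f := HH f) (v := e1) (x := q)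
    (B := fun t => c * (mm q + 1) * (1 / (1 + t) ^ 2)) hR ?_ ?_ ?_ ?_
  · obtain ⟨L, hL, hLv⟩ := key
    have heq : JJ f = fun y => - (∫ (t : ℝ) in Ioi 0, HH f (y + (t:ℂ) • e1)) := rfl
    rw [heq]
    have := hL.neg
    refine ⟨this.differentiableAt, ?_⟩
    have h2 := this.fderiv
    simp only [Pi.neg_def] at h2
    rw [h2]
    simp [hLv]
  · intro t ht p hp
    exact (HH_diff hf hc (hb3 t ht hp)).1.differentiableWithinAt
  · exact i1.const_mul _
  · have : Tendsto (fun t : ℝ => 1 / (1 + t) ^ 2) atTop (𝓝 0) := by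
      simp only [one_div]
      refine tendsto_inv_atTop_zero.comp ?_
      exact (tendsto_pow_atTop (by norm_num)).comp (tendsto_atTop_add_const_left _ _ tendsto_id)
    simpa using this.const_mul (c * (mm q + 1))
  · intro t ht p hp
    have hp' := hb1 hp
    have k1 := HH_bound hc (shift_mem hp' ht)
    rw [mm_shift, shift_fst] at k1
    simp at k1
    have := (hb2 p hp).2
    have hre := Om_re hp'
    have := mm_pos p
    refine k1.trans ?_
    rw [mul_one_div]
    have h0 : 0 ≤ c * (mm q + 1) := mul_nonneg hc0 (by linarith)
    have h1 : 1 ≤ p.1.re := by linarith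
    gcongr

end EQ

namespace EQ
open Metric Set MeasureTheory Topology

noncomputable def gk (n : ℕ) : ℂ × ℂ × ℂ → ℂ := JJ^[n] (fun _ => 1)

lemma gk_succ (n : ℕ) : gk (n+1) = JJ (gk n) := by
  unfold gk; rw [Function.iterate_succ_apply']

lemma gk_prop (n : ℕ) : DifferentiableOn ℂ (gk n) Om ∧ ∀ q ∈ Om, ‖gk n q‖ ≤ (1/2 : ℝ) ^ n := by
  induction n with
  | zero =>
    refine ⟨?_, ?_⟩
    · simp only [gk, Function.iterate_zero, id]; fun_prop
    · intro q _; simp [gk]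
  | succ n ih =>
    rw [gk_succ]
    refine ⟨fun q hq => (JJ_diff ih.1 ih.2 hq).1.differentiableWithinAt, fun q hq => ?_⟩
    refine (JJ_bound ih.2 hq).trans ?_
    have hre := Om_re hq
    rw [div_le_iff₀ (by linarith), pow_succ]
    have h1 := hq.1
    have : (0:ℝ) < (1/2) ^ n := by positivity
    nlinarith

noncomputable def gg (q : ℂ × ℂ × ℂ) : ℂ := ∑' n, gk n q
noncomputable def hh (q : ℂ × ℂ × ℂ) : ℂ := ∑' n, HH (gk n) q

lemma gk_sum {q : ℂ × ℂ × ℂ} (hq : q ∈ Om) : HasSum (fun n => gk n q) (gg q) :=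
  (Summable.of_norm_bounded summable_geometric_two (fun n => (gk_prop n).2 q hq)).hasSum

lemma hk_bound {q : ℂ × ℂ × ℂ} (hq : q ∈ Om) (n : ℕ) :
    ‖HH (gk n) q‖ ≤ mm q / q.1.re ^ 2 * (1/2 : ℝ) ^ n :=
  (HH_bound (gk_prop n).2 hq).trans (le_of_eq (by ring))

lemma hk_bound' {q : ℂ × ℂ × ℂ} (hq : q ∈ Om) (n : ℕ) :
    ‖HH (gk n) q‖ ≤ (1/2 : ℝ) ^ n := by
  refine (hk_bound hq n).trans ?_
  have hre := Om_re hq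
  have h1 := hq.1
  have h2 := mm_pos q
  have : mm q / q.1.re ^ 2 ≤ 1 := by
    rw [div_le_one (by positivity)]; nlinarith
  exact mul_le_of_le_one_left (by positivity) this

lemma hk_sum {q : ℂ × ℂ × ℂ} (hq : q ∈ Om) : HasSum (fun n => HH (gk n) q) (hh q) :=
  (Summable.of_norm_bounded summable_geometric_two (fun n => hk_bound' hq n)).hasSum

lemma gg_bound {q : ℂ × ℂ × ℂ} (hq : q ∈ Om) : ‖gg q - 1‖ ≤ 2 * mm q / q.1.re := by
  have h := (hasSum_nat_add_iff' 1).2 (gk_sum hq)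
  simp [gk] at h
  have e : (fun n => (JJ^[n] (JJ fun x => 1)) q) = fun n => gk (n+1) q := by
    funext n; simp [gk]
  rw [← h.tsum_eq]
  have h2 : HasSum (fun n => mm q / q.1.re * (1/2:ℝ)^n) (mm q / q.1.re * 2) := hasSum_geometric_two.mul_left _
  have h3 := tsum_of_norm_bounded (f := fun n => gk (n+1) q) h2 (fun n => by
    rw [gk_succ]
    exact (JJ_bound (gk_prop n).2 hq).trans (le_of_eq (by ring)))
  rw [e]
  refine h3.trans (le_of_eq (by ring))

lemma hh_bound {q : ℂ × ℂ × ℂ} (hq : q ∈ Om) : ‖hh q‖ ≤ 2 * mm q / q.1.re ^ 2 := by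
  have h2 : HasSum (fun n => mm q / q.1.re ^ 2 * (1/2:ℝ)^n) (mm q / q.1.re ^ 2 * 2) := hasSum_geometric_two.mul_left _
  exact (tsum_of_norm_bounded h2 (hk_bound hq)).trans (le_of_eq (by ring))

lemma gg_diff {q : ℂ × ℂ × ℂ} (hq : q ∈ Om) : DifferentiableAt ℂ gg q := by
  obtain ⟨R, hR, hb1, -⟩ := exists_ball_Om hq
  exact differentiableAt_tsum_loc (f := gk) hR (fun n => (gk_prop n).1.mono hb1) summable_geometric_two
    (fun n y hy => (gk_prop n).2 y (hb1 hy))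

lemma hh_diff {q : ℂ × ℂ × ℂ} (hq : q ∈ Om) : DifferentiableAt ℂ hh q := by
  obtain ⟨R, hR, hb1, -⟩ := exists_ball_Om hq
  exact differentiableAt_tsum_loc (f := fun n => HH (gk n)) hR
    (fun n y hy => (HH_diff (gk_prop n).1 (gk_prop n).2 (hb1 hy)).1.differentiableWithinAt) summable_geometric_two
    (fun n y hy => hk_bound' (hb1 hy) n)

lemma slice {f : ℂ × ℂ × ℂ → ℂ} {z a l : ℂ} (h : DifferentiableAt ℂ f (z, a, l)) :
    HasDerivAt (fun z => f (z, a, l)) (fderiv ℂ f (z, a, l) e1) z := by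
  have h2 : HasDerivAt (fun w : ℂ => ((w, a, l) : ℂ × ℂ × ℂ)) e1 z :=
    (hasDerivAt_id z).prodMk ((hasDerivAt_const _ _).prodMk (hasDerivAt_const _ _))
  exact h.hasFDerivAt.comp_hasDerivAt z h2

lemma gg_slice {z a l : ℂ} (hq : (z, a, l) ∈ Om) :
    HasDerivAt (fun z => gg (z, a, l)) (hh (z, a, l)) z := by
  have h := slice (gg_diff hq)
  refine h.congr_deriv ?_
  let U : Set ℂ := {w | (w, a, l) ∈ Om}
  have hU : IsOpen U := isOpen_Om.preimage (by fun_prop : Continuous fun w : ℂ => ((w, a, l) : ℂ × ℂ × ℂ))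
  have hs := hasSum_deriv_of_summable_norm (F := fun n w => gk n (w, a, l)) (U := U) (z := z)
    summable_geometric_two ?_ hU ?_ hq
  · have h0 : deriv (fun w => ∑' i, gk i (w, a, l)) z = fderiv ℂ gg (z, a, l) e1 := h.deriv
    rw [← h0]
    refine hs.unique ?_
    have h1 := hk_sum hq
    -- deriv of gk 0 = 0, deriv gk (n+1) = HH (gk n)
    rw [← hasSum_nat_add_iff' 1]
    have e0 : deriv (fun w => gk 0 (w, a, l)) z = 0 := by simp [gk]
    have es : ∀ n, deriv (fun w => gk (n+1) (w, a, l)) z = HH (gk n) (z, a, l) := by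
      intro n
      rw [gk_succ]
      have := JJ_diff (gk_prop n).1 (gk_prop n).2 hq
      rw [(slice this.1).deriv, this.2]
    simp only [Finset.range_one, Finset.sum_singleton, e0, sub_zero, es]
    exact h1
  · intro n w hw
    exact (slice ((gk_prop n).1.differentiableAt (isOpen_Om.mem_nhds hw))).differentiableAt.differentiableWithinAt
  · intro n w hw
    exact (gk_prop n).2 _ hw

lemma hh_slice {z a l : ℂ} (hq : (z, a, l) ∈ Om) :
    HasDerivAt (fun z => hh (z, a, l)) (2 * th (z, a, l) * hh (z, a, l) - rh (z, a, l) * gg (z, a, l)) z := by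
  have h := slice (hh_diff hq)
  refine h.congr_deriv ?_
  let U : Set ℂ := {w | (w, a, l) ∈ Om}
  have hU : IsOpen U := isOpen_Om.preimage (by fun_prop : Continuous fun w : ℂ => ((w, a, l) : ℂ × ℂ × ℂ))
  have hs := hasSum_deriv_of_summable_norm (F := fun n w => HH (gk n) (w, a, l)) (U := U) (z := z)
    summable_geometric_two ?_ hU ?_ hq
  · have h0 : deriv (fun w => ∑' i, HH (gk i) (w, a, l)) z = fderiv ℂ hh (z, a, l) e1 := h.deriv
    rw [← h0]
    refine hs.unique ?_
    have h1 := ((hk_sum hq).mul_left (2 * th (z, a, l))).sub ((gk_sum hq).mul_left (rh (z, a, l)))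
    refine h1.congr_fun fun n => ?_
    have := HH_diff (gk_prop n).1 (gk_prop n).2 hq
    rw [(slice this.1).deriv, this.2]
  · intro n w hw
    exact (slice (HH_diff (gk_prop n).1 (gk_prop n).2 hw).1).differentiableAt.differentiableWithinAt
  · intro n w hw
    exact hk_bound' hw n

noncomputable def ph (q : ℂ × ℂ × ℂ) : ℂ := q.1⁻¹ * exp (-(q.1 ^ 3 / 3 + q.2.1 * q.1 / 2))

noncomputable def YY (q : ℂ × ℂ × ℂ) : ℂ := ph q * gg q
noncomputable def YY' (q : ℂ × ℂ × ℂ) : ℂ := ph q * (hh q - th q * gg q)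

lemma ph_diff {q : ℂ × ℂ × ℂ} (hq : q ∈ Om) : DifferentiableAt ℂ ph q := by
  have := Om_ne hq
  unfold ph; fun_prop (disch := simp [this])

lemma th_diff {q : ℂ × ℂ × ℂ} (hq : q ∈ Om) : DifferentiableAt ℂ th q := by
  have := Om_ne hq
  unfold th; fun_prop (disch := simp [this])

lemma YY_diff {q : ℂ × ℂ × ℂ} (hq : q ∈ Om) : DifferentiableAt ℂ YY q := (ph_diff hq).mul (gg_diff hq)

lemma YY'_diff {q : ℂ × ℂ × ℂ} (hq : q ∈ Om) : DifferentiableAt ℂ YY' q :=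
  (ph_diff hq).mul ((hh_diff hq).sub ((th_diff hq).mul (gg_diff hq)))

lemma ph_slice {z a l : ℂ} (hq : (z, a, l) ∈ Om) :
    HasDerivAt (fun z => ph (z, a, l)) (-(th (z, a, l)) * ph (z, a, l)) z := by
  have hz : z ≠ 0 := Om_ne hq
  have h := (hasDerivAt_inv hz).mul ((((hasDerivAt_pow 3 z).div_const 3).add
    (((hasDerivAt_id z).const_mul a).div_const 2)).neg.cexp)
  refine h.congr_deriv ?_
  simp [th, ph]
  field_simp

lemma th_slice {z a l : ℂ} (hq : (z, a, l) ∈ Om) :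
    HasDerivAt (fun z => th (z, a, l)) (2 * z - 1 / z ^ 2) z := by
  have hz : z ≠ 0 := Om_ne hq
  have h := ((hasDerivAt_pow 2 z).add_const (a / 2)).add (hasDerivAt_inv hz)
  have e : (fun z => th (z, a, l)) = ((fun x : ℂ => x ^ 2 + a / 2) + fun x => x⁻¹) := by
    funext x; simp [th]
  rw [e]
  refine h.congr_deriv ?_
  simp
  ring

lemma YY_slice {z a l : ℂ} (hq : (z, a, l) ∈ Om) :
    HasDerivAt (fun z => YY (z, a, l)) (YY' (z, a, l)) z := by
  refine ((ph_slice hq).mul (gg_slice hq)).congr_deriv ?_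
  simp only [YY']; ring

lemma YY'_slice {z a l : ℂ} (hq : (z, a, l) ∈ Om) :
    HasDerivAt (fun z => YY' (z, a, l)) ((1 * z ^ 4 + a * z ^ 2 - l) * YY (z, a, l)) z := by
  have hz : z ≠ 0 := Om_ne hq
  refine ((ph_slice hq).mul ((hh_slice hq).sub ((th_slice hq).mul (gg_slice hq)))).congr_deriv ?_
  have e : th (z, a, l) ^ 2 - (2 * z - 1 / z ^ 2) - rh (z, a, l) = z ^ 4 + a * z ^ 2 - l := by
    simp only [th, rh]; field_simp; ring
  simp only [YY, Pi.sub_apply, Pi.mul_apply]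
  linear_combination ph (z, a, l) * gg (z, a, l) * e

end EQ

namespace EQ
open Metric Set MeasureTheory Topology

/-- slice of the domain -/
def Sl (a l : ℂ) : Set ℂ := {z | (z, a, l) ∈ Om}

lemma isOpen_Sl (a l : ℂ) : IsOpen (Sl a l) :=
  isOpen_Om.preimage (by fun_prop : Continuous fun w : ℂ => ((w, a, l) : ℂ × ℂ × ℂ))

lemma mm_indep (z w a l : ℂ) : mm (z, a, l) = mm (w, a, l) := rfl

lemma isPreconnected_Sl (a l : ℂ) : IsPreconnected (Sl a l) := by
  refine Convex.isPreconnected ?_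
  rintro z ⟨hz1, hz2⟩ w ⟨hw1, hw2⟩ s t hs ht hst
  simp only at hz1 hz2 hw1 hw2
  rw [mm_indep w z] at hw1
  refine ⟨?_, ?_⟩
  · rw [mm_indep _ z]
    simp
    have : 2 * mm (z, a, l) = s * (2 * mm (z, a, l)) + t * (2 * mm (z, a, l)) := by
      rw [← add_mul, hst, one_mul]
    rw [this]
    rcases hs.eq_or_lt with rfl | hs'
    · have : t = 1 := by linarith
      subst this; simpa using hw1
    · have h1 := mul_lt_mul_of_pos_left hz1 hs'
      have h2 := mul_le_mul_of_nonneg_left hw1.le ht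
      linarith
  · simp
    rw [abs_lt] at *
    rcases hs.eq_or_lt with rfl | hs'
    · have : t = 1 := by linarith
      subst this; simpa using hw2
    · constructor
      · have h1 := mul_lt_mul_of_pos_left hz2.1 hs'
        have h2 := mul_le_mul_of_nonneg_left hw2.1.le ht
        linarith
      · have h1 := mul_lt_mul_of_pos_left hz2.2 hs'
        have h2 := mul_le_mul_of_nonneg_left hw2.2.le ht
        linarith

lemma real_mem_Sl {a l : ℂ} {t : ℝ} (ht : 2 * mm (0, a, l) < t) : (t : ℂ) ∈ Sl a l := by
  have := mm_pos (0, a, l)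
  refine ⟨?_, ?_⟩
  · rw [mm_indep _ 0]; simpa using ht
  · simp; linarith

/-- The spectral determinant. -/
noncomputable def F (κ : ℕ) (a l : ℂ) : ℂ :=
  G κ 1 a l ((2 * mm (0, a, l) + 1 : ℝ) : ℂ) * YY' (((2 * mm (0, a, l) + 1 : ℝ) : ℂ), a, l)
    - G' κ 1 a l ((2 * mm (0, a, l) + 1 : ℝ) : ℂ) * YY (((2 * mm (0, a, l) + 1 : ℝ) : ℂ), a, l)

lemma F_eq {κ : ℕ} (hκ : κ = 0 ∨ κ = 1) {a l z : ℂ} (hz : (z, a, l) ∈ Om) :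
    F κ a l = G κ 1 a l z * YY' (z, a, l) - G' κ 1 a l z * YY (z, a, l) := by
  refine wronsk_eq (V := fun z => 1 * z ^ 4 + a * z ^ 2 - l) (isOpen_Sl a l) (isPreconnected_Sl a l)
    (y := G κ 1 a l) (y' := G' κ 1 a l) (u := fun z => YY (z, a, l)) (u' := fun z => YY' (z, a, l))
    (fun z _ => G_hasDerivAt κ 1 a l z) (fun z _ => G'_hasDerivAt κ hκ 1 a l z)
    (fun z hz => YY_slice hz) (fun z hz => YY'_slice hz) ?_ hz
  exact real_mem_Sl (by linarith)

lemma F_differentiable {κ : ℕ} (hκ : κ = 0 ∨ κ = 1) : Differentiable ℂ (fun p : ℂ × ℂ => F κ p.1 p.2) := by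
  intro p
  set z : ℂ := ((2 * mm (0, p.1, p.2) + 1 : ℝ) : ℂ) with hz
  have hm : (z, p.1, p.2) ∈ Om := real_mem_Sl (by linarith)
  have hev : ∀ᶠ p' : ℂ × ℂ in 𝓝 p, (z, p'.1, p'.2) ∈ Om :=
    (isOpen_Om.preimage (by fun_prop : Continuous fun p' : ℂ × ℂ => ((z, p'.1, p'.2) : ℂ × ℂ × ℂ))).mem_nhds hm
  have heq : (fun p : ℂ × ℂ => F κ p.1 p.2) =ᶠ[𝓝 p]
      fun p => G κ 1 p.1 p.2 z * YY' (z, p.1, p.2) - G' κ 1 p.1 p.2 z * YY (z, p.1, p.2) :=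
    hev.mono fun p' hp' => F_eq hκ hp'
  refine DifferentiableAt.congr_of_eventuallyEq ?_ heq
  have d0 : DifferentiableAt ℂ (fun p : ℂ × ℂ => ((z, p.1, p.2) : ℂ × ℂ × ℂ)) p := by fun_prop
  have d00 : DifferentiableAt ℂ (fun p : ℂ × ℂ => ((1, p.1, p.2, z) : ℂ × ℂ × ℂ × ℂ)) p := by fun_prop
  have d1 : DifferentiableAt ℂ (fun p : ℂ × ℂ => YY (z, p.1, p.2)) p :=
    DifferentiableAt.comp p (g := YY) (f := fun p : ℂ × ℂ => ((z, p.1, p.2) : ℂ × ℂ × ℂ)) (YY_diff hm) d0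
  have d2 : DifferentiableAt ℂ (fun p : ℂ × ℂ => YY' (z, p.1, p.2)) p :=
    DifferentiableAt.comp p (g := YY') (f := fun p : ℂ × ℂ => ((z, p.1, p.2) : ℂ × ℂ × ℂ)) (YY'_diff hm) d0
  have d3 : DifferentiableAt ℂ (fun p : ℂ × ℂ => G κ 1 p.1 p.2 z) p :=
    DifferentiableAt.comp p (f := fun p : ℂ × ℂ => ((1, p.1, p.2, z) : ℂ × ℂ × ℂ × ℂ)) (G_differentiable κ _) d00
  have d4 : DifferentiableAt ℂ (fun p : ℂ × ℂ => G' κ 1 p.1 p.2 z) p :=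
    DifferentiableAt.comp p (f := fun p : ℂ × ℂ => ((1, p.1, p.2, z) : ℂ × ℂ × ℂ × ℂ)) (G'_differentiable κ _) d00
  exact (d3.mul d2).sub (d4.mul d1)

lemma gg_ne {q : ℂ × ℂ × ℂ} (hq : q ∈ Om) : gg q ≠ 0 := by
  intro h
  have h1 := gg_bound hq
  have hre := Om_re hq
  rw [h, zero_sub, norm_neg, norm_one, le_div_iff₀ (by linarith)] at h1
  linarith [hq.1]

lemma gg_le {q : ℂ × ℂ × ℂ} (hq : q ∈ Om) : ‖gg q‖ ≤ 2 := by
  have h1 := gg_bound hq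
  have hre := Om_re hq
  have : 2 * mm q / q.1.re ≤ 1 := by rw [div_le_one (by linarith)]; exact hq.1.le
  have h2 := norm_add_le (gg q - 1) 1
  rw [sub_add_cancel, norm_one] at h2
  linarith

lemma YY_ne {q : ℂ × ℂ × ℂ} (hq : q ∈ Om) : YY q ≠ 0 :=
  mul_ne_zero (mul_ne_zero (inv_ne_zero (Om_ne hq)) (exp_ne_zero _)) (gg_ne hq)

lemma ray_mem (a l : ℂ) {ζ : ℂ} (hζ : |ζ.im| < 0.6 * ζ.re) :
    ∀ᶠ x : ℝ in atTop, ζ * x ∈ Sl a l := by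
  have hre : 0 < ζ.re := by have := abs_nonneg ζ.im; linarith
  have : Tendsto (fun x : ℝ => ζ.re * x) atTop atTop := tendsto_id.const_mul_atTop hre
  filter_upwards [this.eventually_gt_atTop (2 * mm (0, a, l)), eventually_gt_atTop 0] with x hx hx0
  refine ⟨?_, ?_⟩
  · rw [mm_indep _ 0]; simpa using hx
  · simp; rw [abs_of_pos hx0]; nlinarith

lemma YY_decay (a l : ℂ) {ζ : ℂ} (hζ : |ζ.im| < 0.6 * ζ.re) (h3 : 0 < (ζ ^ 3).re) (n : ℕ) :
    Tendsto (fun x : ℝ => x ^ n * ‖YY (ζ * x, a, l)‖) atTop (𝓝 0) ∧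
    Tendsto (fun x : ℝ => x ^ n * ‖YY' (ζ * x, a, l)‖) atTop (𝓝 0) := by
  have hre : 0 < ζ.re := by have := abs_nonneg ζ.im; linarith
  have hmem := ray_mem a l hζ
  have hpoly : ∀ᶠ x : ℝ in atTop, x ≤ (ζ ^ 3).re * x ^ 3 / 3 + (a * ζ).re * x / 2 := by
    have : Tendsto (fun x : ℝ => (ζ ^ 3).re * x ^ 2 / 3) atTop atTop :=
      ((tendsto_pow_atTop (by norm_num)).const_mul_atTop h3).atTop_div_const (by norm_num)
    filter_upwards [this.eventually_ge_atTop (1 - (a * ζ).re / 2), eventually_gt_atTop 0] with x hx hx0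
    have := mul_le_mul_of_nonneg_right hx hx0.le
    nlinarith
  have hph : ∀ᶠ x : ℝ in atTop, ‖ph (ζ * x, a, l)‖ ≤ Real.exp (-x) := by
    filter_upwards [hmem, hpoly] with x hx hp
    unfold ph
    rw [norm_mul, norm_inv, Complex.norm_exp]
    have h1 : ‖(ζ * x)‖⁻¹ ≤ 1 := inv_le_one_of_one_le₀ (Om_norm hx)
    have h2 : (-((ζ * x) ^ 3 / 3 + a * (ζ * x) / 2)).re = -((ζ ^ 3).re * x ^ 3 / 3 + (a * ζ).re * x / 2) := by
      have : (-((ζ * x) ^ 3 / 3 + a * (ζ * x) / 2)) =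
        -(((x ^ 3 / 3 : ℝ) : ℂ) * ζ ^ 3 + ((x / 2 : ℝ) : ℂ) * (a * ζ)) := by push_cast; ring
      rw [this, Complex.neg_re, Complex.add_re, Complex.re_ofReal_mul, Complex.re_ofReal_mul]; ring
    simp only
    rw [h2]
    calc _ ≤ 1 * Real.exp (-x) := by gcongr
      _ = _ := one_mul _
  have hlim : ∀ (C : ℝ) (m : ℕ), Tendsto (fun x : ℝ => C * (x ^ m * Real.exp (-x))) atTop (𝓝 0) := by
    intro C m
    simpa using (Real.tendsto_pow_mul_exp_neg_atTop_nhds_zero m).const_mul C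
  constructor
  · refine squeeze_zero' ?_ ?_ (hlim 2 n)
    · filter_upwards [eventually_ge_atTop 0] with x hx; positivity
    · filter_upwards [hmem, hph, eventually_ge_atTop 0] with x hx hp hx0
      have := gg_le hx
      rw [YY, norm_mul]
      calc x ^ n * (‖ph (ζ * x, a, l)‖ * ‖gg (ζ * x, a, l)‖) ≤ x ^ n * (Real.exp (-x) * 2) := by gcongr
        _ = _ := by ring
  · refine squeeze_zero' ?_ ?_ (hlim (1 + (‖ζ‖ ^ 2 + ‖a‖ / 2 + 1) * 2) (n+2))
    · filter_upwards [eventually_ge_atTop 0] with x hx; positivity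
    · filter_upwards [hmem, hph, eventually_ge_atTop 1] with x hx hp hx1
      have g2 := gg_le hx
      have hOre : 4 < (ζ * x).re := Om_re hx
      have hh1 : ‖hh (ζ * x, a, l)‖ ≤ 1 := by
        refine (hh_bound hx).trans ?_
        rw [div_le_one (by positivity)]
        have : 2 * mm (ζ * x, a, l) < (ζ * x).re := hx.1
        simp only
        nlinarith
      have hx2 : 1 ≤ x ^ 2 := one_le_pow₀ hx1
      have hth : ‖th (ζ * x, a, l)‖ ≤ (‖ζ‖ ^ 2 + ‖a‖ / 2 + 1) * x ^ 2 := by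
        unfold th
        have i1 := norm_add_le ((ζ * x) ^ 2 + a / 2) (1 / (ζ * x))
        have i2 := norm_add_le ((ζ * x) ^ 2) (a / 2)
        have i3 : ‖1 / (ζ * x)‖ ≤ 1 := by
          rw [norm_div, norm_one]
          exact (div_le_one (by have := Om_norm hx; simp only at this; linarith)).2 (Om_norm hx)
        have i4 : ‖(ζ * x) ^ 2‖ = ‖ζ‖ ^ 2 * x ^ 2 := by
          rw [norm_pow, norm_mul, Complex.norm_real, Real.norm_of_nonneg (by linarith), mul_pow]
        have i5 : ‖a / 2‖ = ‖a‖ / 2 := by simp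
        simp only
        nlinarith [norm_nonneg a, norm_nonneg ζ]
      have hY : ‖YY' (ζ * x, a, l)‖ ≤ Real.exp (-x) * ((1 + (‖ζ‖ ^ 2 + ‖a‖ / 2 + 1) * 2) * x ^ 2) := by
        rw [YY', norm_mul]
        gcongr
        refine (norm_sub_le _ _).trans ?_
        rw [norm_mul]
        have : ‖th (ζ * x, a, l)‖ * ‖gg (ζ * x, a, l)‖ ≤ (‖ζ‖ ^ 2 + ‖a‖ / 2 + 1) * x ^ 2 * 2 := by gcongr
        nlinarith
      calc x ^ n * ‖YY' (ζ * x, a, l)‖ ≤ x ^ n * (Real.exp (-x) * ((1 + (‖ζ‖ ^ 2 + ‖a‖ / 2 + 1) * 2) * x ^ 2)) := by gcongr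
        _ = _ := by ring

/-- On the zero set of `F`, the solution `G` is a multiple of `Y`. -/
lemma G_eq_of_F {κ : ℕ} (hκ : κ = 0 ∨ κ = 1) {a l : ℂ} (hF : F κ a l = 0) :
    ∃ c : ℂ, c ≠ 0 ∧ ∀ z, (z, a, l) ∈ Om → G κ 1 a l z = c * YY (z, a, l) ∧
      G' κ 1 a l z = c * YY' (z, a, l) := by
  set z0 : ℂ := ((2 * mm (0, a, l) + 1 : ℝ) : ℂ)
  have h0 : z0 ∈ Sl a l := real_mem_Sl (by linarith)
  have hd : ∀ z ∈ Sl a l, HasDerivAt (fun z => G κ 1 a l z / YY (z, a, l)) 0 z := by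
    intro z hz
    refine ((G_hasDerivAt κ 1 a l z).div (YY_slice hz) (YY_ne hz)).congr_deriv ?_
    have := F_eq hκ hz
    rw [hF] at this
    rw [div_eq_zero_iff]; left
    linear_combination this
  have hc : ∀ z, (z, a, l) ∈ Om → G κ 1 a l z / YY (z, a, l) = G κ 1 a l z0 / YY (z0, a, l) := fun z hz =>
    (isOpen_Sl a l).is_const_of_deriv_eq_zero (isPreconnected_Sl a l)
      (fun z hz => (hd z hz).differentiableAt.differentiableWithinAt) (fun z hz => (hd z hz).deriv) hz h0
  have key : ∀ z, (z, a, l) ∈ Om → G κ 1 a l z = (G κ 1 a l z0 / YY (z0, a, l)) * YY (z, a, l) ∧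
      G' κ 1 a l z = (G κ 1 a l z0 / YY (z0, a, l)) * YY' (z, a, l) := by
    intro z hz
    have h1 := F_eq hκ hz
    rw [hF] at h1
    have hY := YY_ne hz
    rw [← hc z hz]
    constructor
    · field_simp
    · field_simp; linear_combination h1
  refine ⟨_, ?_, key⟩
  intro h
  have := key z0 h0
  rw [h, zero_mul, zero_mul] at this
  exact G_G'_ne κ hκ 1 a l z0 this.1 this.2

lemma one_ray : |(1:ℂ).im| < 0.6 * (1:ℂ).re := by norm_num
lemma one_ray3 : 0 < ((1:ℂ) ^ 3).re := by norm_num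

/-- A solution decaying at `+∞` has zero Wronskian with `Y`. -/
lemma wronsk_zero_of_decay {a l : ℂ} {y y' : ℂ → ℂ} (h1 : ∀ z, HasDerivAt y (y' z) z)
    (h2 : ∀ z, HasDerivAt y' ((1 * z ^ 4 + a * z ^ 2 - l) * y z) z)
    (hdec : Tendsto (fun t : ℝ => y t) atTop (𝓝 0)) {z : ℂ} (hz : (z, a, l) ∈ Om) :
    y z * YY' (z, a, l) - y' z * YY (z, a, l) = 0 := by
  set C := 1 + ‖a‖ + ‖l‖ with hC
  have hb : ∀ᶠ t : ℝ in atTop, ‖y t‖ ≤ 1 := by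
    have := (tendsto_zero_iff_norm_tendsto_zero.1 hdec).eventually_lt_const (one_pos)
    exact this.mono fun t ht => ht.le
  obtain ⟨T, hT⟩ := (hb.and (eventually_ge_atTop 1)).exists_forall_of_atTop
  have hT1 : 1 ≤ T := (hT T le_rfl).2
  have hy' : ∀ t : ℝ, T ≤ t → ‖y' t‖ ≤ (‖y' T‖ + C) * t ^ 5 := by
    intro t ht
    have h3 := (convex_Icc T t).norm_image_sub_le_of_norm_hasDerivWithin_le
      (f := fun s : ℝ => y' s) (f' := fun s : ℝ => (1 * (s:ℂ) ^ 4 + a * (s:ℂ) ^ 2 - l) * y s) (C := C * t ^ 4)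
      (fun s _ => (h2 s).comp_ofReal.hasDerivWithinAt) (fun s hs => by
        have hs1 := (hT s hs.1).1
        have hs2 := (hT s hs.1).2
        rw [norm_mul]
        have k1 : ‖(1 * (s:ℂ) ^ 4 + a * (s:ℂ) ^ 2 - l)‖ ≤ C * t ^ 4 := by
          have i1 := norm_sub_le (1 * (s:ℂ) ^ 4 + a * (s:ℂ) ^ 2) l
          have i2 := norm_add_le (1 * (s:ℂ) ^ 4) (a * (s:ℂ) ^ 2)
          have i3 : ‖(1 * (s:ℂ) ^ 4)‖ = s ^ 4 := by
            rw [one_mul, norm_pow, Complex.norm_real, Real.norm_of_nonneg (by linarith)]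
          have i4 : ‖(a * (s:ℂ) ^ 2)‖ = ‖a‖ * s ^ 2 := by
            rw [norm_mul, norm_pow, Complex.norm_real, Real.norm_of_nonneg (by linarith)]
          have j1 : s ^ 4 ≤ t ^ 4 := by have := hs.2; gcongr
          have j2 : s ^ 2 ≤ t ^ 4 := le_trans (pow_le_pow_right₀ hs2 (by norm_num)) j1
          have j3 : 1 ≤ t ^ 4 := one_le_pow₀ (by linarith)
          have j4 : ‖a‖ * s ^ 2 ≤ ‖a‖ * t ^ 4 := by gcongr
          have j5 : ‖l‖ ≤ ‖l‖ * t ^ 4 := le_mul_of_one_le_right (norm_nonneg _) j3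
          rw [hC]; linarith
        have : 0 ≤ C * t ^ 4 := (norm_nonneg _).trans k1
        calc _ ≤ C * t ^ 4 * 1 := by gcongr
          _ = _ := mul_one _) (left_mem_Icc.2 ht) (right_mem_Icc.2 ht)
    rw [Real.norm_of_nonneg (by linarith)] at h3
    have h4 := norm_sub_norm_le (y' t) (y' T)
    have hC0 : 0 ≤ C := by rw [hC]; positivity
    have h5 : C * t ^ 4 * (t - T) ≤ C * t ^ 4 * t := by gcongr; linarith
    have h6 : ‖y' T‖ ≤ ‖y' T‖ * t ^ 5 := le_mul_of_one_le_right (norm_nonneg _) (one_le_pow₀ (by linarith))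
    nlinarith
  have hconst : ∀ t : ℝ, 2 * mm (0, a, l) < t → y z * YY' (z, a, l) - y' z * YY (z, a, l) =
      y t * YY' (t, a, l) - y' t * YY (t, a, l) := fun t ht =>
    wronsk_eq (V := fun z => 1 * z ^ 4 + a * z ^ 2 - l) (isOpen_Sl a l) (isPreconnected_Sl a l)
    (y := y) (y' := y') (u := fun z => YY (z, a, l)) (u' := fun z => YY' (z, a, l))
    (fun z _ => h1 z) (fun z _ => h2 z)
    (fun z hz => YY_slice hz) (fun z hz => YY'_slice hz) hz (real_mem_Sl ht)
  have hlim : Tendsto (fun t : ℝ => ‖y t * YY' (t, a, l) - y' t * YY (t, a, l)‖) atTop (𝓝 0) := by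
    have l1 := (YY_decay a l one_ray one_ray3 0).2
    have l2 := ((YY_decay a l one_ray one_ray3 5).1).const_mul (‖y' T‖ + C)
    have l3 := l1.add l2
    simp only [mul_zero, add_zero] at l3
    refine squeeze_zero' (Eventually.of_forall fun t => norm_nonneg _) ?_ l3
    filter_upwards [eventually_ge_atTop T] with t ht
    refine (norm_sub_le _ _).trans ?_
    rw [norm_mul, norm_mul, one_mul, pow_zero]
    refine add_le_add ?_ ?_
    · exact mul_le_mul_of_nonneg_right (hT t ht).1 (norm_nonneg _)
    · rw [← mul_assoc]
      exact mul_le_mul_of_nonneg_right (hy' t ht) (norm_nonneg _)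
  have hlim2 : Tendsto (fun t : ℝ => ‖y t * YY' (t, a, l) - y' t * YY (t, a, l)‖) atTop
      (𝓝 ‖y z * YY' (z, a, l) - y' z * YY (z, a, l)‖) := by
    refine tendsto_const_nhds.congr' ?_
    filter_upwards [eventually_gt_atTop (2 * mm (0, a, l))] with t ht
    rw [hconst t ht]
  exact norm_eq_zero.1 (tendsto_nhds_unique hlim2 hlim)

lemma eig_derivs {a l : ℂ} {y : ℂ → ℂ} (h : IsEvenQuarticEigenfunction a l y) :
    (∀ z, HasDerivAt y (deriv y z) z) ∧
    ∀ z, HasDerivAt (deriv y) ((1 * z ^ 4 + a * z ^ 2 - l) * y z) z := by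
  obtain ⟨hd, -, ho, -⟩ := h
  refine ⟨fun z => (hd z).hasDerivAt, fun z => ?_⟩
  have : DifferentiableAt ℂ (deriv y) z :=
    (hd.differentiableOn.deriv isOpen_univ).differentiableAt univ_mem
  refine this.hasDerivAt.congr_deriv ?_
  linear_combination -ho z

lemma G_eig {κ : ℕ} (hκ : κ = 0 ∨ κ = 1) {a l : ℂ} (hF : F κ a l = 0) :
    IsEvenQuarticEigenfunction a l (G κ 1 a l) := by
  obtain ⟨c, hc, hG⟩ := G_eq_of_F hκ hF
  have hp : Tendsto (fun t : ℝ => G κ 1 a l t) atTop (𝓝 0) := by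
    rw [tendsto_zero_iff_norm_tendsto_zero]
    have l1 := ((YY_decay a l one_ray one_ray3 0).1).const_mul ‖c‖
    rw [mul_zero] at l1
    refine l1.congr' ?_
    filter_upwards [ray_mem a l one_ray] with t ht
    have := (hG _ ht).1
    rw [one_mul] at *
    rw [this, norm_mul]; simp
  refine ⟨fun z => (G_hasDerivAt κ 1 a l z).differentiableAt, ?_, ?_, hp, ?_⟩
  · intro h
    have hz : ∀ z, G κ 1 a l z = 0 := fun z => by rw [h]; rfl
    refine G_G'_ne κ hκ 1 a l 0 (hz 0) ?_
    have h1 := G_hasDerivAt κ 1 a l 0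
    rw [h] at h1
    exact h1.unique (hasDerivAt_const _ _)
  · intro z
    have e : deriv (G κ 1 a l) = G' κ 1 a l := funext fun z => (G_hasDerivAt κ 1 a l z).deriv
    rw [e, (G'_hasDerivAt κ hκ 1 a l z).deriv]; ring
  · have h1 : Tendsto (fun t : ℝ => (-1) ^ κ * G κ 1 a l ((-t : ℝ) : ℂ)) atBot (𝓝 0) := by
      simpa using (hp.comp tendsto_neg_atBot_atTop).const_mul ((-1 : ℂ) ^ κ)
    refine h1.congr fun t => ?_
    push_cast
    rw [G_neg, ← mul_assoc, ← mul_pow]; simp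

lemma F_of_combo {κ : ℕ} (hκ : κ = 0 ∨ κ = 1) {a l c : ℂ} (hc : c ≠ 0)
    (hdec : Tendsto (fun t : ℝ => c * G κ 1 a l t) atTop (𝓝 0)) : F κ a l = 0 := by
  have hdec' : Tendsto (fun t : ℝ => G κ 1 a l t) atTop (𝓝 0) := by
    have := hdec.const_mul c⁻¹
    simpa [← mul_assoc, inv_mul_cancel₀ hc] using this
  exact wronsk_zero_of_decay (G_hasDerivAt κ 1 a l) (G'_hasDerivAt κ hκ 1 a l) hdec' (real_mem_Sl (by linarith))

lemma even_iff (a l : ℂ) : (a, l) ∈ evenQuarticLocusEven ↔ F 0 a l = 0 := by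
  constructor
  · rintro ⟨y, hy, hev⟩
    obtain ⟨h1, h2⟩ := eig_derivs hy
    have hs := entire_sol h1 h2
    have h0 : deriv y 0 = 0 := by
      have : deriv (fun z => y (-z)) 0 = - deriv y 0 := by rw [deriv_comp_neg]; simp
      rw [funext hev] at this
      linear_combination (1/2 : ℂ) * this
    rw [h0] at hs
    have hy0 : y 0 ≠ 0 := by
      intro h; apply hy.2.1; funext z; rw [hs z, h]; simp
    refine F_of_combo (Or.inl rfl) hy0 (hy.2.2.2.1.congr fun t => ?_)
    rw [hs t]; simp
  · intro h
    refine ⟨G 0 1 a l, G_eig (Or.inl rfl) h, fun z => ?_⟩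
    rw [G_neg]; simp

lemma odd_iff (a l : ℂ) : (a, l) ∈ evenQuarticLocusOdd ↔ F 1 a l = 0 := by
  constructor
  · rintro ⟨y, hy, hev⟩
    obtain ⟨h1, h2⟩ := eig_derivs hy
    have hs := entire_sol h1 h2
    have h0 : y 0 = 0 := by
      have := hev 0
      rw [neg_zero] at this
      linear_combination (1/2 : ℂ) * this
    rw [h0] at hs
    have hy0 : deriv y 0 ≠ 0 := by
      intro h; apply hy.2.1; funext z; rw [hs z, h]; simp
    refine F_of_combo (Or.inr rfl) hy0 (hy.2.2.2.1.congr fun t => ?_)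
    rw [hs t]; simp
  · intro h
    refine ⟨G 1 1 a l, G_eig (Or.inr rfl) h, fun z => ?_⟩
    rw [G_neg]; simp

lemma locus_union : evenQuarticLocus = evenQuarticLocusEven ∪ evenQuarticLocusOdd := by
  ext ⟨a, l⟩
  constructor
  · rintro ⟨y, hy⟩
    obtain ⟨h1, h2⟩ := eig_derivs hy
    have hs := entire_sol h1 h2
    have hp := hy.2.2.2.1
    have hm : Tendsto (fun t : ℝ => y (-t)) atTop (𝓝 0) := by
      have := hy.2.2.2.2.comp tendsto_neg_atTop_atBot
      refine this.congr fun t => ?_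
      simp
    simp only at hs
    by_cases h0 : y 0 = 0
    · right
      rw [odd_iff]
      have hy0 : deriv y 0 ≠ 0 := by
        intro h; apply hy.2.1; funext z; rw [hs z, h, h0]; simp
      refine F_of_combo (Or.inr rfl) hy0 (hp.congr fun t => ?_)
      rw [hs t, h0]; simp
    · left
      rw [even_iff]
      have := (hp.add hm).const_mul (1/2 : ℂ)
      rw [add_zero, mul_zero] at this
      refine F_of_combo (Or.inl rfl) h0 (this.congr fun t => ?_)
      rw [hs t, hs (-t), G_neg, G_neg]; ring
  · rintro (⟨y, hy, -⟩ | ⟨y, hy, -⟩) <;> exact ⟨y, hy⟩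

lemma F_not_both (a l : ℂ) : ¬ (F 0 a l = 0 ∧ F 1 a l = 0) := by
  rintro ⟨h0, h1⟩
  have hm : (((2 * mm (0, a, l) + 1 : ℝ) : ℂ), a, l) ∈ Om := real_mem_Sl (by linarith)
  rw [F_eq (Or.inl rfl) hm] at h0
  rw [F_eq (Or.inr rfl) hm] at h1
  apply YY_ne hm
  linear_combination (-YY (((2 * mm (0, a, l) + 1 : ℝ) : ℂ), a, l)) * wronsk_EO 1 a l ((2 * mm (0, a, l) + 1 : ℝ) : ℂ)
    - G 0 1 a l ((2 * mm (0, a, l) + 1 : ℝ) : ℂ) * h1 + G 1 1 a l ((2 * mm (0, a, l) + 1 : ℝ) : ℂ) * h0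

lemma locus_disjoint : Disjoint evenQuarticLocusEven evenQuarticLocusOdd := by
  rw [Set.disjoint_left]
  rintro ⟨a, l⟩ h0 h1
  exact F_not_both a l ⟨(even_iff a l).1 h0, (odd_iff a l).1 h1⟩

end EQ

namespace EQ
open Metric Set MeasureTheory Topology

lemma G'_scale (κ : ℕ) (e a l c z : ℂ) :
    c * G' κ e a l (c * z) = c ^ κ * G' κ (c ^ 6 * e) (c ^ 4 * a) (c ^ 2 * l) z := by
  have h1 : HasDerivAt (fun z => G κ e a l (c * z)) (G' κ e a l (c * z) * c) z := by
    have h0 : HasDerivAt (fun z : ℂ => c * z) c z := by simpa using (hasDerivAt_id z).const_mul c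
    exact (G_hasDerivAt κ e a l (c * z)).comp z h0
  have h2 := (G_hasDerivAt κ (c ^ 6 * e) (c ^ 4 * a) (c ^ 2 * l) z).const_mul (c ^ κ)
  have h3 : (fun z => G κ e a l (c * z)) = fun z => c ^ κ * G κ (c ^ 6 * e) (c ^ 4 * a) (c ^ 2 * l) z := by
    funext z; exact G_scale ..
  rw [h3] at h1
  rw [mul_comm]; exact h1.unique h2

lemma gg_tendsto (a l : ℂ) {ζ : ℂ} (hζ : |ζ.im| < 0.6 * ζ.re) :
    Tendsto (fun x : ℝ => gg (ζ * x, a, l)) atTop (𝓝 1) ∧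
    Tendsto (fun x : ℝ => hh (ζ * x, a, l)) atTop (𝓝 0) ∧
    Tendsto (fun x : ℝ => th (ζ * x, a, l) / (x:ℂ) ^ 2) atTop (𝓝 (ζ ^ 2)) := by
  have hre : 0 < ζ.re := by have := abs_nonneg ζ.im; linarith
  have hmem := ray_mem a l hζ
  have hx : Tendsto (fun x : ℝ => ζ.re * x) atTop atTop := tendsto_id.const_mul_atTop hre
  have h1 : Tendsto (fun x : ℝ => 2 * mm (0, a, l) / (ζ.re * x)) atTop (𝓝 0) := hx.const_div_atTop _
  have hrx : ∀ x : ℝ, (ζ * (x:ℂ)).re = ζ.re * x := by intro x; simp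
  refine ⟨?_, ?_, ?_⟩
  · rw [tendsto_iff_norm_sub_tendsto_zero]
    refine squeeze_zero' (Eventually.of_forall fun _ => norm_nonneg _) ?_ h1
    filter_upwards [hmem] with x hx
    have := gg_bound hx
    simpa [mm_indep (ζ * x) 0, hrx] using this
  · rw [tendsto_zero_iff_norm_tendsto_zero]
    refine squeeze_zero' (Eventually.of_forall fun _ => norm_nonneg _) ?_ h1
    filter_upwards [hmem, hx.eventually_ge_atTop 1] with x hx hx1
    have := hh_bound hx
    rw [mm_indep (ζ * x) 0] at this
    simp only [hrx] at this
    refine this.trans ?_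
    have := mm_pos (0, a, l)
    gcongr
    nlinarith
  · have hxC : Tendsto (fun x : ℝ => ((x⁻¹ : ℝ) : ℂ)) atTop (𝓝 ((0:ℝ):ℂ)) :=
      (Complex.continuous_ofReal.tendsto 0).comp tendsto_inv_atTop_zero
    rw [Complex.ofReal_zero] at hxC
    have h2 : Tendsto (fun x : ℝ => ζ ^ 2 + a / 2 * ((x⁻¹ : ℝ) : ℂ) ^ 2 + ζ⁻¹ * ((x⁻¹ : ℝ) : ℂ) ^ 3) atTop
        (𝓝 (ζ ^ 2 + a / 2 * 0 ^ 2 + ζ⁻¹ * 0 ^ 3)) :=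
      (tendsto_const_nhds.add ((hxC.pow 2).const_mul _)).add ((hxC.pow 3).const_mul _)
    have e0 : ζ ^ 2 + a / 2 * 0 ^ 2 + ζ⁻¹ * 0 ^ 3 = ζ ^ 2 := by ring
    rw [e0] at h2
    refine h2.congr' ?_
    filter_upwards [eventually_gt_atTop 0] with x hx
    have hxne : (x:ℂ) ≠ 0 := by exact_mod_cast hx.ne'
    have hζ0 : ζ ≠ 0 := by rintro rfl; simp at hre
    unfold th
    push_cast
    field_simp

/-- The connection identity. -/
lemma conn_id {κ : ℕ} (hκ : κ = 0 ∨ κ = 1) {a l c ζ : ℂ}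
    (hc : ∀ z, (z, a, l) ∈ Om → G κ 1 a l z = c * YY (z, a, l) ∧ G' κ 1 a l z = c * YY' (z, a, l))
    (hζ : |ζ.im| < 0.6 * ζ.re) (hζ' : |ζ⁻¹.im| < 0.6 * ζ⁻¹.re) (h6 : ζ ^ 6 = -1) :
    ζ ^ (2 * κ) * F κ (ζ ^ 8 * a) (ζ ^ 4 * l) = 2 * c * ζ ^ 4 := by
  have hζ0 : ζ ≠ 0 := by rintro rfl; simp at h6
  set a' := ζ ^ 8 * a with ha'
  set l' := ζ ^ 4 * l with hl'
  obtain ⟨g1, k1, t1⟩ := gg_tendsto a l hζ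
  obtain ⟨g2, k2, t2⟩ := gg_tendsto a' l' hζ'
  have hxC : Tendsto (fun x : ℝ => ((x⁻¹ : ℝ) : ℂ) ^ 2) atTop (𝓝 0) := by
    have : Tendsto (fun x : ℝ => ((x⁻¹ : ℝ) : ℂ)) atTop (𝓝 ((0:ℝ):ℂ)) :=
      (Complex.continuous_ofReal.tendsto 0).comp tendsto_inv_atTop_zero
    simpa using this.pow 2
  have hlim : Tendsto (fun x : ℝ => c * (gg (ζ * x, a, l) * (hh (ζ⁻¹ * x, a', l') * ((x⁻¹ : ℝ) : ℂ) ^ 2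
      - th (ζ⁻¹ * x, a', l') / (x:ℂ) ^ 2 * gg (ζ⁻¹ * x, a', l'))
      - ζ ^ 2 * ((hh (ζ * x, a, l) * ((x⁻¹ : ℝ) : ℂ) ^ 2 - th (ζ * x, a, l) / (x:ℂ) ^ 2 * gg (ζ * x, a, l))
        * gg (ζ⁻¹ * x, a', l')))) atTop (𝓝 (c * (1 * (0 * 0 - ζ⁻¹ ^ 2 * 1) - ζ ^ 2 * ((0 * 0 - ζ ^ 2 * 1) * 1)))) :=
    (((g1.mul ((k2.mul hxC).sub (t2.mul g2))).sub ((((k1.mul hxC).sub (t1.mul g1)).mul g2).const_mul _))).const_mul c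
  have hval : c * (1 * (0 * 0 - ζ⁻¹ ^ 2 * 1) - ζ ^ 2 * ((0 * 0 - ζ ^ 2 * 1) * 1)) = 2 * c * ζ ^ 4 := by
    field_simp
    linear_combination -c * (1) * h6
  rw [hval] at hlim
  refine tendsto_nhds_unique (tendsto_const_nhds (x := ζ ^ (2 * κ) * F κ a' l') (f := atTop (α := ℝ))) (hlim.congr' ?_)
  filter_upwards [ray_mem a l hζ, ray_mem a' l' hζ', eventually_gt_atTop 0] with x h1 h2 hx
  have hxne : (x:ℂ) ≠ 0 := by exact_mod_cast hx.ne'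
  obtain ⟨e1, e2⟩ := hc _ h1
  have s1 := G_scale κ (ζ ^ 2) 1 a l (ζ⁻¹ * x)
  have s2 := G'_scale κ 1 a l (ζ ^ 2) (ζ⁻¹ * x)
  have hz : ζ ^ 2 * (ζ⁻¹ * x) = ζ * x := by field_simp
  have p1 : (ζ ^ 2) ^ 6 * 1 = (1:ℂ) := by linear_combination (ζ ^ 6 - 1) * h6
  have p2 : (ζ ^ 2) ^ 4 * a = a' := by rw [ha']; ring
  have p3 : (ζ ^ 2) ^ 2 * l = l' := by rw [hl']; ring
  rw [hz, p1, p2, p3, ← pow_mul] at s1 s2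
  have hR : ζ ^ (2 * κ) * F κ a' l' = c * YY (ζ * x, a, l) * YY' (ζ⁻¹ * x, a', l') -
      ζ ^ 2 * (c * YY' (ζ * x, a, l)) * YY (ζ⁻¹ * x, a', l') := by
    rw [F_eq hκ h2, ← e1, ← e2, s1, s2]; ring
  rw [hR]
  have hph : ph (ζ * x, a, l) * ph (ζ⁻¹ * x, a', l') = ((x⁻¹ : ℝ) : ℂ) ^ 2 := by
    unfold ph
    simp only
    have : exp (-((ζ * x) ^ 3 / 3 + a * (ζ * x) / 2)) * exp (-((ζ⁻¹ * x) ^ 3 / 3 + a' * (ζ⁻¹ * x) / 2)) = 1 := by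
      rw [← Complex.exp_add, ← Complex.exp_zero]
      congr 1
      rw [ha']
      have h3 : (ζ⁻¹) ^ 3 = - ζ ^ 3 := by
        field_simp; linear_combination h6
      have h7 : ζ ^ 8 * a * (ζ⁻¹ * x) = - (a * ζ * x) := by
        field_simp; linear_combination a * h6
      rw [h7, mul_pow, mul_pow, h3]; ring
    have hh' : (ζ * (x:ℂ))⁻¹ * exp (-((ζ * x) ^ 3 / 3 + a * (ζ * x) / 2)) * ((ζ⁻¹ * x)⁻¹ * exp (-((ζ⁻¹ * x) ^ 3 / 3 + a' * (ζ⁻¹ * x) / 2)))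
      = (ζ * (x:ℂ))⁻¹ * (ζ⁻¹ * x)⁻¹ * (exp (-((ζ * x) ^ 3 / 3 + a * (ζ * x) / 2)) * exp (-((ζ⁻¹ * x) ^ 3 / 3 + a' * (ζ⁻¹ * x) / 2))) := by ring
    rw [hh', this]
    push_cast
    field_simp
  unfold YY YY'
  have hx2 : ((x⁻¹ : ℝ) : ℂ) ^ 2 = 1 / (x:ℂ) ^ 2 := by push_cast; field_simp
  have hfin : c * (ph (ζ * x, a, l) * gg (ζ * x, a, l)) * (ph (ζ⁻¹ * x, a', l') * (hh (ζ⁻¹ * x, a', l') - th (ζ⁻¹ * x, a', l') * gg (ζ⁻¹ * x, a', l'))) -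
    ζ ^ 2 * (c * (ph (ζ * x, a, l) * (hh (ζ * x, a, l) - th (ζ * x, a, l) * gg (ζ * x, a, l)))) * (ph (ζ⁻¹ * x, a', l') * gg (ζ⁻¹ * x, a', l'))
    = c * (ph (ζ * x, a, l) * ph (ζ⁻¹ * x, a', l')) * (gg (ζ * x, a, l) * (hh (ζ⁻¹ * x, a', l') - th (ζ⁻¹ * x, a', l') * gg (ζ⁻¹ * x, a', l')) -
    ζ ^ 2 * ((hh (ζ * x, a, l) - th (ζ * x, a, l) * gg (ζ * x, a, l)) * gg (ζ⁻¹ * x, a', l'))) := by ring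
  rw [hfin, hph, hx2]
  ring

noncomputable def z6 : ℂ := exp (Real.pi * I / 6)

lemma z6_eq : z6 = ((Real.sqrt 3 / 2 : ℝ) : ℂ) + ((1/2 : ℝ) : ℂ) * I := by
  unfold z6
  rw [show (Real.pi : ℂ) * I / 6 = ((Real.pi / 6 : ℝ) : ℂ) * I by push_cast; ring, Complex.exp_mul_I,
    ← Complex.ofReal_cos, ← Complex.ofReal_sin, Real.cos_pi_div_six, Real.sin_pi_div_six]

lemma z6_pow : z6 ^ 6 = -1 := by
  unfold z6
  rw [← Complex.exp_nat_mul, ← Complex.exp_pi_mul_I]; congr 1; push_cast; ring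

lemma z6_ray : |z6.im| < 0.6 * z6.re ∧ |z6⁻¹.im| < 0.6 * z6⁻¹.re := by
  have h3 : (1.7:ℝ) < Real.sqrt 3 := by rw [Real.lt_sqrt] <;> norm_num
  have hn : normSq z6 = 1 := by
    rw [z6_eq, Complex.normSq_add_mul_I]
    have := Real.sq_sqrt (show (0:ℝ) ≤ 3 by norm_num)
    nlinarith
  have hr : z6.re = Real.sqrt 3 / 2 := by rw [z6_eq]; simp
  have hi : z6.im = 1 / 2 := by rw [z6_eq]; simp
  rw [Complex.inv_im, Complex.inv_re, hn, hr, hi]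
  constructor
  · rw [abs_of_pos (by norm_num)]; linarith
  · rw [abs_div, abs_neg, abs_of_pos (by norm_num)]; norm_num; linarith

/-- On the locus the two rotated values of `F` are related. -/
lemma conn_ratio {κ : ℕ} (hκ : κ = 0 ∨ κ = 1) {a l : ℂ} (hF : F κ a l = 0) :
    F κ (z6 ^ 8 * a) (z6 ^ 4 * l) ≠ 0 ∧
    z6 ^ (4 * κ) * F κ (z6 ^ 8 * a) (z6 ^ 4 * l) = z6 ^ 8 * F κ (z6⁻¹ ^ 8 * a) (z6⁻¹ ^ 4 * l) := by
  obtain ⟨c, hc0, hc⟩ := G_eq_of_F hκ hF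
  have h6 := z6_pow
  have h0 : z6 ≠ 0 := exp_ne_zero _
  have h6' : z6⁻¹ ^ 6 = -1 := by rw [inv_pow, h6]; norm_num
  have A := conn_id hκ hc z6_ray.1 z6_ray.2 h6
  have B := conn_id hκ hc z6_ray.2 (by rw [inv_inv]; exact z6_ray.1) h6'
  constructor
  · intro h; rw [h, mul_zero] at A
    exact mul_ne_zero (mul_ne_zero two_ne_zero hc0) (pow_ne_zero 4 h0) A.symm
  · have e : z6 ^ (4 * κ) * F κ (z6 ^ 8 * a) (z6 ^ 4 * l) = z6 ^ (2 * κ) * (2 * c * z6 ^ 4) := by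
      rw [← A]; ring
    rw [e]
    have hB : F κ (z6⁻¹ ^ 8 * a) (z6⁻¹ ^ 4 * l) = z6 ^ (2 * κ) * (2 * c * z6⁻¹ ^ 4) := by
      rw [← B, ← mul_assoc, ← mul_pow, mul_inv_cancel₀ h0, one_pow, one_mul]
    rw [hB]
    field_simp

end EQ

namespace EQ
open Metric Set MeasureTheory Topology

/-- Numerical range argument along the ray `ζ · [0,∞)`. -/
lemma num_range {κ : ℕ} (hκ : κ = 0 ∨ κ = 1) {a l ζ : ℂ} (hF : F κ a l = 0)
    (hζ : |ζ.im| < 0.6 * ζ.re) (h3 : 0 < (ζ ^ 3).re) (e : ℂ) (γ : ℝ)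
    (hform : ∀ x : ℝ, 0 < x → ∀ Y Y' : ℂ, Y ≠ 0 →
      0 < e.re * normSq Y' + (e * (ζ ^ 2 * (ζ ^ 4 * x ^ 4 + a * ζ ^ 2 * x ^ 2 - l))).re * normSq Y
        + γ * normSq Y + 2 * γ * x * (Y.re * Y'.re + Y.im * Y'.im))
    (hform' : ∀ x : ℝ, 0 < x → ∀ Y' : ℂ, 0 ≤ e.re * normSq Y') : False := by
  obtain ⟨c, hc0, hc⟩ := G_eq_of_F hκ hF
  have hre : 0 < ζ.re := by have := abs_nonneg ζ.im; linarith
  set y : ℝ → ℂ := fun x => G κ 1 a l (ζ * x) with hy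
  set y' : ℝ → ℂ := fun x => ζ * G' κ 1 a l (ζ * x) with hy'
  have hz : ∀ x : ℝ, HasDerivAt (fun x : ℝ => ζ * (x:ℂ)) ζ x := by
    intro x
    simpa using ((hasDerivAt_id (x:ℂ)).const_mul ζ).comp_ofReal
  have dy : ∀ x, HasDerivAt y (y' x) x := by
    intro x
    have := (G_hasDerivAt κ 1 a l (ζ * x)).comp x (hz x)
    refine this.congr_deriv ?_
    simp only [hy']; ring
  have dy' : ∀ x : ℝ, HasDerivAt y' (ζ ^ 2 * (ζ ^ 4 * x ^ 4 + a * ζ ^ 2 * x ^ 2 - l) * y x) x := by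
    intro x
    have := ((G'_hasDerivAt κ hκ 1 a l (ζ * x)).comp x (hz x)).const_mul ζ
    refine this.congr_deriv ?_
    simp only [hy]; ring
  have reD : ∀ {f : ℝ → ℂ} {f' : ℂ} {x : ℝ}, HasDerivAt f f' x → HasDerivAt (fun x => (f x).re) f'.re x :=
    fun h => (Complex.reCLM.hasFDerivAt.comp_hasDerivAt _ h)
  have imD : ∀ {f : ℝ → ℂ} {f' : ℂ} {x : ℝ}, HasDerivAt f f' x → HasDerivAt (fun x => (f x).im) f'.im x :=
    fun h => (Complex.imCLM.hasFDerivAt.comp_hasDerivAt _ h)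
  set Q : ℝ → ℝ := fun x => e.re * ((y x).re * (y' x).re + (y x).im * (y' x).im)
      - e.im * ((y x).re * (y' x).im - (y x).im * (y' x).re)
      + γ * x * ((y x).re * (y x).re + (y x).im * (y x).im) with hQ
  have dQ : ∀ x : ℝ, HasDerivAt Q (e.re * normSq (y' x) + (e * (ζ ^ 2 * (ζ ^ 4 * x ^ 4 + a * ζ ^ 2 * x ^ 2 - l))).re * normSq (y x)
        + γ * normSq (y x) + 2 * γ * x * ((y x).re * (y' x).re + (y x).im * (y' x).im)) x := by
    intro x
    have r := reD (dy x)
    have i := imD (dy x)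
    have r' := reD (dy' x)
    have i' := imD (dy' x)
    have key := (((r.mul r').add (i.mul i')).const_mul e.re).sub (((r.mul i').sub (i.mul r')).const_mul e.im)
    have key2 := (((hasDerivAt_id x).const_mul γ).mul ((r.mul r).add (i.mul i)))
    refine (key.add key2).congr_deriv ?_
    set W := ζ ^ 2 * (ζ ^ 4 * (x:ℂ) ^ 4 + a * ζ ^ 2 * (x:ℂ) ^ 2 - l)
    simp only [Complex.mul_re, Complex.mul_im, normSq_apply, Pi.mul_apply, Pi.add_apply, id]
    ring
  have hQ0 : Q 0 = 0 := by
    rcases hκ with rfl | rfl <;> simp [hQ, hy, hy', G, G']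
  have hpos : ∀ x : ℝ, 0 < x → 0 ≤ deriv Q x := by
    intro x hx
    rw [(dQ x).deriv]
    by_cases h : y x = 0
    · rw [h]; simpa using hform' x hx (y' x)
    · exact (hform x hx _ _ h).le
  have hcont : Continuous Q := continuous_iff_continuousAt.2 fun x => (dQ x).continuousAt
  have hmono : MonotoneOn Q (Ici 0) := by
    refine monotoneOn_of_deriv_nonneg (convex_Ici 0) hcont.continuousOn
      (fun x _ => (dQ x).differentiableAt.differentiableWithinAt) ?_
    intro x hx
    rw [interior_Ici] at hx
    exact hpos x hx
  obtain ⟨X, hX⟩ := (ray_mem a l hζ).exists_forall_of_atTop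
  set X0 := max X 1
  have hX0 : 0 < X0 := lt_of_lt_of_le one_pos (le_max_right _ _)
  have hyne : ∀ x, X0 ≤ x → y x ≠ 0 := by
    intro x hx
    have hm := hX x ((le_max_left _ _).trans hx)
    simp only [hy]
    rw [(hc _ hm).1]
    exact mul_ne_zero hc0 (YY_ne hm)
  have hstrict : StrictMonoOn Q (Ici X0) := by
    refine strictMonoOn_of_deriv_pos (convex_Ici X0) hcont.continuousOn ?_
    intro x hx
    rw [interior_Ici] at hx
    rw [(dQ x).deriv]
    exact hform x (hX0.trans hx) _ _ (hyne x (le_of_lt hx))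
  have hlim : Tendsto Q atTop (𝓝 0) := by
    have a0 := (YY_decay a l hζ h3 0).1
    have a1 := (YY_decay a l hζ h3 1).1
    have b0 := (YY_decay a l hζ h3 0).2
    have L : Tendsto (fun x : ℝ => 2 * ‖e‖ * ‖c‖ ^ 2 * ‖ζ‖ * ((x ^ 0 * ‖YY (ζ * x, a, l)‖) * (x ^ 0 * ‖YY' (ζ * x, a, l)‖))
        + |γ| * ‖c‖ ^ 2 * ((x ^ 1 * ‖YY (ζ * x, a, l)‖) * (x ^ 0 * ‖YY (ζ * x, a, l)‖))) atTop (𝓝 0) := by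
      have := ((a0.mul b0).const_mul (2 * ‖e‖ * ‖c‖ ^ 2 * ‖ζ‖)).add ((a1.mul a0).const_mul (|γ| * ‖c‖ ^ 2))
      simpa using this
    refine squeeze_zero_norm' ?_ L
    filter_upwards [ray_mem a l hζ, eventually_gt_atTop 0] with x hm hx
    have e1 : ‖y x‖ = ‖c‖ * ‖YY (ζ * x, a, l)‖ := by
      simp only [hy]; rw [(hc _ hm).1, norm_mul]
    have e2 : ‖y' x‖ = ‖ζ‖ * ‖c‖ * ‖YY' (ζ * x, a, l)‖ := by
      simp only [hy']; rw [(hc _ hm).2, norm_mul, norm_mul]; ring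
    have hA : |(y x).re * (y' x).re + (y x).im * (y' x).im| ≤ ‖y x‖ * ‖y' x‖ := by
      have h := Complex.abs_re_le_norm ((starRingEnd ℂ) (y x) * y' x)
      rw [norm_mul, Complex.norm_conj] at h
      refine le_trans (le_of_eq ?_) h
      congr 1; simp
    have hB : |(y x).re * (y' x).im - (y x).im * (y' x).re| ≤ ‖y x‖ * ‖y' x‖ := by
      have h := Complex.abs_im_le_norm ((starRingEnd ℂ) (y x) * y' x)
      rw [norm_mul, Complex.norm_conj] at h
      refine le_trans (le_of_eq ?_) h
      congr 1; simp; ring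
    have hC : (y x).re * (y x).re + (y x).im * (y x).im = ‖y x‖ ^ 2 := by
      rw [← Complex.normSq_eq_norm_sq, normSq_apply]
    have hn : ‖Q x‖ ≤ 2 * ‖e‖ * (‖y x‖ * ‖y' x‖) + |γ| * x * ‖y x‖ ^ 2 := by
      simp only [hQ]
      rw [hC]
      refine (norm_add_le _ _).trans ?_
      refine add_le_add ((norm_sub_le _ _).trans ?_) ?_
      · rw [norm_mul, norm_mul, Real.norm_eq_abs, Real.norm_eq_abs, Real.norm_eq_abs, Real.norm_eq_abs]
        have := mul_le_mul (Complex.abs_re_le_norm e) hA (abs_nonneg _) (norm_nonneg _)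
        have := mul_le_mul (Complex.abs_im_le_norm e) hB (abs_nonneg _) (norm_nonneg _)
        linarith
      · rw [norm_mul, norm_mul, Real.norm_eq_abs, Real.norm_eq_abs, abs_of_pos hx]
        simp
    refine hn.trans (le_of_eq ?_)
    rw [e1, e2]; ring
  have h1 : Q X0 < Q (X0 + 1) := hstrict (mem_Ici.2 le_rfl) (mem_Ici.2 (by linarith)) (by linarith)
  have h2 : Q 0 ≤ Q X0 := hmono (mem_Ici.2 le_rfl) (mem_Ici.2 hX0.le) hX0.le
  have h4 : Q (X0 + 1) ≤ 0 := by
    refine ge_of_tendsto hlim ?_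
    filter_upwards [eventually_ge_atTop (X0 + 1)] with x hx
    exact hmono (mem_Ici.2 (by linarith)) (mem_Ici.2 (by linarith)) hx
  linarith

lemma nr_pos {κ : ℕ} (hκ : κ = 0 ∨ κ = 1) {a l : ℂ} (hF : F κ a l = 0) (hl : 0 < l.im) : 0 < a.im := by
  by_contra h
  push Not at h
  refine num_range hκ hF one_ray one_ray3 I 0 ?_ ?_
  · intro x hx Y Y' hY
    have h1 : (I * ((1:ℂ) ^ 2 * (1 ^ 4 * (x:ℂ) ^ 4 + a * 1 ^ 2 * (x:ℂ) ^ 2 - l))).re = -a.im * x ^ 2 + l.im := by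
      rw [show (I * ((1:ℂ) ^ 2 * (1 ^ 4 * (x:ℂ) ^ 4 + a * 1 ^ 2 * (x:ℂ) ^ 2 - l))) =
        I * (((x ^ 4 : ℝ) : ℂ) + ((x ^ 2 : ℝ) : ℂ) * a - l) by push_cast; ring, Complex.I_mul_re,
        Complex.sub_im, Complex.add_im, Complex.im_ofReal_mul, Complex.ofReal_im]; ring
    rw [h1]
    have := normSq_pos.2 hY
    have : 0 < (-a.im * x ^ 2 + l.im) * normSq Y := by
      refine mul_pos ?_ this
      nlinarith [sq_nonneg x]
    simpa using this
  · intros; simp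

lemma nr_neg {κ : ℕ} (hκ : κ = 0 ∨ κ = 1) {a l : ℂ} (hF : F κ a l = 0) (hl : l.im < 0) : a.im < 0 := by
  by_contra h
  push Not at h
  refine num_range hκ hF one_ray one_ray3 (-I) 0 ?_ ?_
  · intro x hx Y Y' hY
    have h1 : (-I * ((1:ℂ) ^ 2 * (1 ^ 4 * (x:ℂ) ^ 4 + a * 1 ^ 2 * (x:ℂ) ^ 2 - l))).re = a.im * x ^ 2 - l.im := by
      rw [show (-I * ((1:ℂ) ^ 2 * (1 ^ 4 * (x:ℂ) ^ 4 + a * 1 ^ 2 * (x:ℂ) ^ 2 - l))) =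
        -(I * (((x ^ 4 : ℝ) : ℂ) + ((x ^ 2 : ℝ) : ℂ) * a - l)) by push_cast; ring, Complex.neg_re, Complex.I_mul_re,
        Complex.sub_im, Complex.add_im, Complex.im_ofReal_mul, Complex.ofReal_im]; ring
    rw [h1]
    have := normSq_pos.2 hY
    have : 0 < (a.im * x ^ 2 - l.im) * normSq Y := by
      refine mul_pos ?_ this
      nlinarith [sq_nonneg x]
    simpa using this
  · intros; simp

lemma nr_real {κ : ℕ} (hκ : κ = 0 ∨ κ = 1) {a l : ℂ} (hF : F κ a l = 0) (hl : l.im = 0) : a.im = 0 := by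
  rcases lt_trichotomy a.im 0 with h | h | h
  · exfalso
    refine num_range hκ hF one_ray one_ray3 I 0 ?_ ?_
    · intro x hx Y Y' hY
      have h1 : (I * ((1:ℂ) ^ 2 * (1 ^ 4 * (x:ℂ) ^ 4 + a * 1 ^ 2 * (x:ℂ) ^ 2 - l))).re = -a.im * x ^ 2 + l.im := by
        rw [show (I * ((1:ℂ) ^ 2 * (1 ^ 4 * (x:ℂ) ^ 4 + a * 1 ^ 2 * (x:ℂ) ^ 2 - l))) =
          I * (((x ^ 4 : ℝ) : ℂ) + ((x ^ 2 : ℝ) : ℂ) * a - l) by push_cast; ring, Complex.I_mul_re,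
          Complex.sub_im, Complex.add_im, Complex.im_ofReal_mul, Complex.ofReal_im]; ring
      rw [h1]
      have := normSq_pos.2 hY
      have : 0 < (-a.im * x ^ 2 + l.im) * normSq Y := by
        refine mul_pos ?_ this
        have := pow_pos hx 2
        nlinarith
      simpa using this
    · intros; simp
  · exact h
  · exfalso
    refine num_range hκ hF one_ray one_ray3 (-I) 0 ?_ ?_
    · intro x hx Y Y' hY
      have h1 : (-I * ((1:ℂ) ^ 2 * (1 ^ 4 * (x:ℂ) ^ 4 + a * 1 ^ 2 * (x:ℂ) ^ 2 - l))).re = a.im * x ^ 2 - l.im := by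
        rw [show (-I * ((1:ℂ) ^ 2 * (1 ^ 4 * (x:ℂ) ^ 4 + a * 1 ^ 2 * (x:ℂ) ^ 2 - l))) =
          -(I * (((x ^ 4 : ℝ) : ℂ) + ((x ^ 2 : ℝ) : ℂ) * a - l)) by push_cast; ring, Complex.neg_re, Complex.I_mul_re,
          Complex.sub_im, Complex.add_im, Complex.im_ofReal_mul, Complex.ofReal_im]; ring
      rw [h1]
      have := normSq_pos.2 hY
      have : 0 < (a.im * x ^ 2 - l.im) * normSq Y := by
        refine mul_pos ?_ this
        have := pow_pos hx 2
        nlinarith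
      simpa using this
    · intros; simp

lemma nr_it {κ : ℕ} (hκ : κ = 0 ∨ κ = 1) {a : ℂ} {t : ℝ} (ht : 0 < t) (hF : F κ a (t * I) = 0) :
    24 * a.re + 7 * a.im < 0 := by
  by_contra h
  push Not at h
  have z3 : ((2:ℂ) - I) ^ 3 = 2 - 11 * I := by
    linear_combination (6 - I) * I_sq
  refine num_range hκ hF (ζ := 2 - I) (by norm_num) (by rw [z3]; norm_num) I 0 ?_ ?_
  · intro x hx Y Y' hY
    have h1 : (I * (((2:ℂ) - I) ^ 2 * ((2 - I) ^ 4 * (x:ℂ) ^ 4 + a * (2 - I) ^ 2 * (x:ℂ) ^ 2 - t * I))).re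
        = 44 * x ^ 4 + (24 * a.re + 7 * a.im) * x ^ 2 + 3 * t := by
      have hz2 : ((2:ℂ) - I) ^ 2 = 3 - 4 * I := by linear_combination I_sq
      have hz4 : ((2:ℂ) - I) ^ 4 = -7 - 24 * I := by
        rw [show (4:ℕ) = 2 * 2 from rfl, pow_mul, hz2]; linear_combination 16 * I_sq
      rw [hz2, hz4]
      have : (I * ((3 - 4 * I) * ((-7 - 24 * I) * (x:ℂ) ^ 4 + a * (3 - 4 * I) * (x:ℂ) ^ 2 - t * I))) =
        ((x ^ 4 : ℝ) : ℂ) * (44 - 117 * I) + ((x ^ 2 : ℝ) : ℂ) * ((24 - 7 * I) * a) + ((t : ℝ) : ℂ) * (3 - 4 * I) := by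
        push_cast
        linear_combination ((x:ℂ) ^ 4 * (-44 + 96 * I) + (x:ℂ)^2 * a * (-24 + 16 * I) - t * (3 - 4 * I)) * I_sq
      rw [this, Complex.add_re, Complex.add_re, Complex.re_ofReal_mul, Complex.re_ofReal_mul, Complex.re_ofReal_mul]
      simp [Complex.mul_re]; ring
    rw [h1]
    have hn := normSq_pos.2 hY
    have : 0 < (44 * x ^ 4 + (24 * a.re + 7 * a.im) * x ^ 2 + 3 * t) * normSq Y := by
      refine mul_pos ?_ hn
      positivity
    simpa using this
  · intros; simp

lemma nr_par {κ : ℕ} (hκ : κ = 0 ∨ κ = 1) {a l : ℂ} (hF : F κ a l = 0) : ‖a‖ + a.re ≤ 2 * ‖l‖ ^ 2 := by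
  obtain ⟨r, hr, hr0⟩ : ∃ r : ℂ, r ^ 2 = a ∧ 0 ≤ r.re := by
    obtain ⟨r, hr⟩ := IsAlgClosed.exists_pow_nat_eq a (n := 2) (by norm_num)
    rcases le_total 0 r.re with h | h
    · exact ⟨r, hr, h⟩
    · exact ⟨-r, by rw [neg_sq, hr], by simpa using h⟩
  have hna : ‖a‖ + a.re = 2 * r.re ^ 2 := by
    have hh : r.re ^ 2 + r.im ^ 2 = ‖r‖ ^ 2 := by
      rw [← Complex.normSq_eq_norm_sq, normSq_apply]; ring
    rw [← hr, norm_pow, ← hh, sq r, Complex.mul_re]; ring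
  rw [hna]
  by_contra hcon
  push Not at hcon
  have hlt : ‖l‖ < r.re := lt_of_pow_lt_pow_left₀ 2 hr0 (by linarith)
  have hrp : 0 < r.re := lt_of_le_of_lt (norm_nonneg _) hlt
  have hrn : 0 < ‖r‖ := lt_of_lt_of_le hrp (Complex.re_le_norm r)
  have hsq : r.re ^ 2 + r.im ^ 2 = ‖r‖ ^ 2 := by
    rw [← Complex.normSq_eq_norm_sq, normSq_apply]; ring
  -- use the unnormalised weight
  refine num_range hκ hF one_ray one_ray3 ((starRingEnd ℂ) r) (r.re * ‖r‖) ?_ ?_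
  · intro x hx Y Y' hY
    have h1 : ((starRingEnd ℂ) r * ((1:ℂ) ^ 2 * (1 ^ 4 * (x:ℂ) ^ 4 + a * 1 ^ 2 * (x:ℂ) ^ 2 - l))).re
        = r.re * x ^ 4 + ‖r‖ ^ 2 * r.re * x ^ 2 - ((starRingEnd ℂ) r * l).re := by
      rw [show ((starRingEnd ℂ) r * ((1:ℂ) ^ 2 * (1 ^ 4 * (x:ℂ) ^ 4 + a * 1 ^ 2 * (x:ℂ) ^ 2 - l))) =
        ((x ^ 4 : ℝ) : ℂ) * (starRingEnd ℂ) r + ((x ^ 2 : ℝ) : ℂ) * ((starRingEnd ℂ) r * r * r) - (starRingEnd ℂ) r * l by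
          rw [← hr]; push_cast; ring, Complex.sub_re, Complex.add_re, Complex.re_ofReal_mul, Complex.re_ofReal_mul,
        mul_comm ((starRingEnd ℂ) r) r, Complex.mul_conj, Complex.re_ofReal_mul, Complex.conj_re,
        Complex.normSq_eq_norm_sq]
      ring
    rw [h1]
    have h2 : ((starRingEnd ℂ) r * l).re ≤ ‖r‖ * ‖l‖ := by
      refine (Complex.re_le_norm _).trans ?_
      rw [norm_mul, Complex.norm_conj]
    have hn := normSq_pos.2 hY
    have h3 : 0 < (r.re * x ^ 4 + r.re * ‖r‖ - ‖r‖ * ‖l‖) * normSq Y := by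
      refine mul_pos ?_ hn
      have := mul_lt_mul_of_pos_left hlt hrn
      have : 0 < r.re * x ^ 4 := by positivity
      nlinarith
    have h4 : ((starRingEnd ℂ) r * l).re * normSq Y ≤ ‖r‖ * ‖l‖ * normSq Y := mul_le_mul_of_nonneg_right h2 hn.le
    have h5 : 0 ≤ r.re * ((Y'.re + ‖r‖ * x * Y.re) ^ 2 + (Y'.im + ‖r‖ * x * Y.im) ^ 2) := by positivity
    rw [normSq_apply Y] at h3 h4
    rw [normSq_apply Y, normSq_apply Y', Complex.conj_re]
    nlinarith
  · intro x hx Y'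
    rw [Complex.conj_re]; exact mul_nonneg hr0 (normSq_nonneg _)

end EQ

namespace EQ
open Metric Set MeasureTheory Topology

lemma ff''_differentiable (κ : ℕ) :
    Differentiable ℂ (fun q : ℂ × ℂ × ℂ × ℂ => deriv (ff' κ q.1 q.2.1 q.2.2.1) q.2.2.2) := by
  have h := differentiableOn_fderiv_apply isOpen_univ (ff'_differentiable κ).differentiableOn
    ((0, 0, 0, 1) : ℂ × ℂ × ℂ × ℂ)
  rw [differentiableOn_univ] at h
  suffices heq : (fun q : ℂ × ℂ × ℂ × ℂ => deriv (ff' κ q.1 q.2.1 q.2.2.1) q.2.2.2) = fun x =>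
      (fderiv ℂ (fun q : ℂ × ℂ × ℂ × ℂ => ff' κ q.1 q.2.1 q.2.2.1 q.2.2.2) x) (0, 0, 0, 1) by
    rw [heq]; exact h
  funext q
  have h1 : HasFDerivAt (fun q : ℂ × ℂ × ℂ × ℂ => ff' κ q.1 q.2.1 q.2.2.1 q.2.2.2) _ q :=
    (ff'_differentiable κ q).hasFDerivAt
  have h2 : HasDerivAt (fun w : ℂ => ((q.1, q.2.1, q.2.2.1, w) : ℂ × ℂ × ℂ × ℂ)) (0, 0, 0, 1) q.2.2.2 :=
    (hasDerivAt_const _ _).prodMk ((hasDerivAt_const _ _).prodMk ((hasDerivAt_const _ _).prodMk (hasDerivAt_id _)))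
  have h3 := HasFDerivAt.comp_hasDerivAt q.2.2.2 h1 h2
  exact h3.deriv

/-- Admissible directions for `ε`. -/
def Eg : Set ℂ := {ε | |ε.re| ≤ 0.1 * ‖ε‖}

noncomputable def dd (κ : ℕ) : ℝ := 1 + 2 * κ
noncomputable def RR (ε : ℂ) (u : ℝ) : ℂ := exp (log (1 + ε * u) / 2)
noncomputable def f0 (κ : ℕ) (ε b : ℂ) (u : ℝ) : ℂ := ff κ ε 1 (dd κ - b) u
noncomputable def f1 (κ : ℕ) (ε b : ℂ) (u : ℝ) : ℂ := ff' κ ε 1 (dd κ - b) u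
noncomputable def f2 (κ : ℕ) (ε b : ℂ) (u : ℝ) : ℂ := deriv (ff' κ ε 1 (dd κ - b)) u
noncomputable def NN (κ : ℕ) (ε b : ℂ) (u : ℝ) : ℂ := 2 * f1 κ ε b u + RR ε u * f0 κ ε b u
noncomputable def NN' (κ : ℕ) (ε b : ℂ) (u : ℝ) : ℂ :=
  2 * f2 κ ε b u + ε / (2 * RR ε u) * f0 κ ε b u + RR ε u * f1 κ ε b u
noncomputable def mu (κ : ℕ) (ε b : ℂ) (u : ℝ) : ℂ :=
  (dd κ + 1) * RR ε u - 1 / RR ε u - (dd κ - b)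

lemma RR_ne (ε : ℂ) (u : ℝ) : RR ε u ≠ 0 := exp_ne_zero _

lemma dd_cases {κ : ℕ} (hκ : κ = 0 ∨ κ = 1) : dd κ = 1 ∨ dd κ = 3 := by
  unfold dd; rcases hκ with rfl | rfl <;> norm_num

lemma dd_pos (κ : ℕ) : 1 ≤ dd κ := by
  unfold dd; linarith [Nat.cast_nonneg (α := ℝ) κ]

lemma dd_C (κ : ℕ) : (dd κ : ℂ) = 1 + 2 * κ := by unfold dd; push_cast; ring

lemma f0_cont (κ : ℕ) : Continuous fun q : ℂ × ℂ × ℝ => f0 κ q.1 q.2.1 q.2.2 :=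
  (ff_differentiable κ).continuous.comp
    (by fun_prop : Continuous fun q : ℂ × ℂ × ℝ => ((q.1, 1, (dd κ : ℂ) - q.2.1, (q.2.2 : ℂ)) : ℂ × ℂ × ℂ × ℂ))
lemma f1_cont (κ : ℕ) : Continuous fun q : ℂ × ℂ × ℝ => f1 κ q.1 q.2.1 q.2.2 :=
  (ff'_differentiable κ).continuous.comp
    (by fun_prop : Continuous fun q : ℂ × ℂ × ℝ => ((q.1, 1, (dd κ : ℂ) - q.2.1, (q.2.2 : ℂ)) : ℂ × ℂ × ℂ × ℂ))
lemma f2_cont (κ : ℕ) : Continuous fun q : ℂ × ℂ × ℝ => f2 κ q.1 q.2.1 q.2.2 :=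
  (ff''_differentiable κ).continuous.comp
    (by fun_prop : Continuous fun q : ℂ × ℂ × ℝ => ((q.1, 1, (dd κ : ℂ) - q.2.1, (q.2.2 : ℂ)) : ℂ × ℂ × ℂ × ℂ))

lemma Eg_slit {ε : ℂ} (hε : ε ∈ Eg) {u : ℝ} (_hu : 0 ≤ u) : 1 + ε * u ∈ slitPlane := by
  rw [mem_slitPlane_iff]
  by_contra h
  push Not at h
  obtain ⟨h1, h2⟩ := h
  simp only [add_re, one_re, re_mul_ofReal, add_im, one_im, im_mul_ofReal, zero_add] at h1 h2
  rcases mul_eq_zero.1 h2 with h3 | h3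
  · have hε' : |ε.re| ≤ 0.1 * ‖ε‖ := hε
    have : ‖ε‖ = |ε.re| := by
      rw [← Complex.re_add_im ε, h3]; simp
    rw [this] at hε'
    have h0 : |ε.re| = 0 := by linarith [abs_nonneg ε.re]
    rw [abs_eq_zero] at h0
    rw [h0] at h1; linarith
  · rw [h3] at h1; linarith

lemma RR_sq {ε : ℂ} (hε : ε ∈ Eg) {u : ℝ} (hu : 0 ≤ u) : RR ε u ^ 2 = 1 + ε * u := by
  unfold RR
  rw [← Complex.exp_nat_mul]
  rw [show ((2:ℕ):ℂ) * (log (1 + ε * u) / 2) = log (1 + ε * u) by push_cast; ring,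
    Complex.exp_log (slitPlane_ne_zero (Eg_slit hε hu))]

lemma RR_re_nonneg (ε : ℂ) (u : ℝ) : 0 ≤ (RR ε u).re := by
  unfold RR
  rw [Complex.exp_re]
  refine mul_nonneg (Real.exp_pos _).le (Real.cos_nonneg_of_mem_Icc ?_)
  have h : (log (1 + ε * u) / 2).im = arg (1 + ε * u) / 2 := by
    rw [show log (1 + ε * u) / 2 = ((1/2 : ℝ) : ℂ) * log (1 + ε * u) by push_cast; ring, Complex.im_ofReal_mul, log_im]; ring
  rw [h]
  constructor <;> linarith [arg_le_pi (1 + ε * u), neg_pi_lt_arg (1 + ε * u)]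

lemma RR_norm {ε : ℂ} (hε : ε ∈ Eg) {u : ℝ} (hu : 0 ≤ u) : ‖RR ε u‖ ≤ Real.sqrt (1 + ‖ε‖ * u) := by
  apply Real.le_sqrt_of_sq_le
  rw [← norm_pow, RR_sq hε hu]
  refine (norm_add_le _ _).trans ?_
  rw [norm_one, norm_mul, Complex.norm_real, Real.norm_of_nonneg hu]

lemma RR_re {ε : ℂ} (hε : ε ∈ Eg) {u : ℝ} (hu : 0 ≤ u) : Real.sqrt (1 + ‖ε‖ * u) / 2 ≤ (RR ε u).re := by
  have h0 := RR_re_nonneg ε u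
  have hsq := RR_sq hε hu
  set R := RR ε u
  have hx : |ε.re| ≤ 0.1 * ‖ε‖ := hε
  obtain ⟨hx1, hx2⟩ := abs_le.1 hx
  have hw1 : R.re ^ 2 - R.im ^ 2 = 1 + ε.re * u := by
    have := congrArg Complex.re hsq
    simp [sq] at this; nlinarith
  have hw2 : R.re ^ 2 + R.im ^ 2 = ‖1 + ε * u‖ := by
    rw [← hsq, norm_pow, ← Complex.normSq_eq_norm_sq, normSq_apply]; ring
  have hn : ‖1 + ε * u‖ ^ 2 = 1 + 2 * (ε.re * u) + (‖ε‖ * u) ^ 2 := by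
    rw [← Complex.normSq_eq_norm_sq, normSq_apply, mul_pow, ← Complex.normSq_eq_norm_sq, normSq_apply]
    simp; ring
  have hτ : 0 ≤ ‖ε‖ * u := mul_nonneg (norm_nonneg _) hu
  have hy1 : -0.1 * (‖ε‖ * u) ≤ ε.re * u := by nlinarith
  have hy2 : ε.re * u ≤ 0.1 * (‖ε‖ * u) := by nlinarith
  set τ := ‖ε‖ * u
  set y := ε.re * u
  set W := ‖1 + ε * u‖
  have hW : (1 + τ) / 2 - (1 + y) ≤ W := by
    refine abs_le_of_sq_le_sq' ?_ (norm_nonneg _) |>.2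
    rw [hn]
    nlinarith [sq_nonneg (τ - 0.2)]
  have : Real.sqrt (1 + τ) ≤ 2 * R.re := by
    rw [Real.sqrt_le_left (by linarith)]
    nlinarith
  linarith

lemma RR_contAt {ε : ℂ} (hε : ε ∈ Eg) {u : ℝ} (hu : 0 ≤ u) :
    ContinuousAt (fun q : ℂ × ℝ => RR q.1 q.2) (ε, u) := by
  unfold RR
  have h : ContinuousAt (fun q : ℂ × ℝ => log (1 + q.1 * (q.2:ℂ))) (ε, u) :=
    ContinuousAt.clog (by fun_prop) (Eg_slit hε hu)
  exact (h.div_const 2).cexp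

lemma RR_deriv {ε : ℂ} (hε : ε ∈ Eg) {u : ℝ} (hu : 0 ≤ u) :
    HasDerivAt (fun u : ℝ => RR ε u) (ε / (2 * RR ε u)) u := by
  have h1 : HasDerivAt (fun z : ℂ => exp (log (1 + ε * z) / 2)) (RR ε u * (ε / (1 + ε * u) / 2)) (u:ℂ) := by
    have h2 : HasDerivAt (fun z : ℂ => 1 + ε * z) ε (u:ℂ) := by
      simpa using ((hasDerivAt_id (u:ℂ)).const_mul ε).const_add 1
    exact ((h2.clog (Eg_slit hε hu)).div_const 2).cexp
  refine h1.comp_ofReal.congr_deriv ?_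
  rw [← RR_sq hε hu]
  have := RR_ne ε u
  field_simp

lemma f0_deriv (κ : ℕ) (ε b : ℂ) (u : ℝ) : HasDerivAt (f0 κ ε b) (f1 κ ε b u) u :=
  (ff_hasDerivAt κ ε 1 (dd κ - b) u).comp_ofReal
lemma f1_deriv (κ : ℕ) (ε b : ℂ) (u : ℝ) : HasDerivAt (f1 κ ε b) (f2 κ ε b u) u :=
  ((ff'_differentiable_w κ ε 1 (dd κ - b) u).hasDerivAt).comp_ofReal

lemma NN_deriv (κ : ℕ) {ε b : ℂ} (hε : ε ∈ Eg) {u : ℝ} (hu : 0 ≤ u) :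
    HasDerivAt (NN κ ε b) (NN' κ ε b u) u := by
  have := ((f1_deriv κ ε b u).const_mul 2).add ((RR_deriv hε hu).mul (f0_deriv κ ε b u))
  refine this.congr_deriv ?_
  unfold NN'; ring

lemma NN'_eq (κ : ℕ) {ε b : ℂ} (hε : ε ∈ Eg) {u : ℝ} (hu : 0 ≤ u) :
    2 * u * NN' κ ε b u = (u * RR ε u - dd κ) * NN κ ε b u + mu κ ε b u * f0 κ ε b u := by
  have ho := ff_ode κ ε 1 (dd κ - b) u
  have hs := RR_sq hε hu
  have hR := RR_ne ε u
  rw [← dd_C] at ho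
  unfold NN' NN mu
  change 4 * (u:ℂ) * f2 κ ε b u + 2 * dd κ * f1 κ ε b u = _ * f0 κ ε b u at ho
  have e1 : 2 * (u:ℂ) * (2 * f2 κ ε b u + ε / (2 * RR ε u) * f0 κ ε b u + RR ε u * f1 κ ε b u)
     = (4 * u * f2 κ ε b u) + (ε * u) / RR ε u * f0 κ ε b u + 2 * u * RR ε u * f1 κ ε b u := by
    field_simp
    ring
  have e2 : 4 * (u:ℂ) * f2 κ ε b u = (ε * u ^ 2 + 1 * u - (dd κ - b)) * f0 κ ε b u - 2 * dd κ * f1 κ ε b u := by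
    linear_combination ho
  have e3 : ε * u = RR ε u ^ 2 - 1 := by rw [hs]; ring
  have e4 : ε * (u:ℂ) ^ 2 = u * (RR ε u ^ 2 - 1) := by rw [← e3]; ring
  rw [e1, e2, e3, e4]
  field_simp
  ring

lemma NN_zero (κ : ℕ) (ε b : ℂ) : NN κ ε b 0 = b / dd κ := by
  unfold NN f1 f0 RR
  have := dd_pos κ
  have hd : (dd κ : ℂ) ≠ 0 := by exact_mod_cast (by linarith : dd κ ≠ 0)
  simp only [ofReal_zero, mul_zero, add_zero, log_one, zero_div, exp_zero]
  rw [ff_zero, ff'_zero, ← dd_C]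
  field_simp; ring

lemma f0_zero (κ : ℕ) (ε b : ℂ) : f0 κ ε b 0 = 1 := by
  unfold f0; rw [ofReal_zero, ff_zero]

lemma NN_f0_ne {κ : ℕ} (hκ : κ = 0 ∨ κ = 1) (ε b : ℂ) (u : ℝ) (h : f0 κ ε b u = 0) : NN κ ε b u ≠ 0 := by
  intro h'
  unfold NN at h'
  rw [h, mul_zero, add_zero] at h'
  exact ff_ff'_ne κ hκ ε 1 (dd κ - b) u h ((mul_eq_zero.1 h').resolve_left two_ne_zero)

lemma normSq_hasDerivAt {f : ℝ → ℂ} {f' : ℂ} {x : ℝ} (h : HasDerivAt f f' x) :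
    HasDerivAt (fun x => normSq (f x)) (2 * ((f x).re * f'.re + (f x).im * f'.im)) x := by
  have r : HasDerivAt (fun x => (f x).re) f'.re x := Complex.reCLM.hasFDerivAt.comp_hasDerivAt _ h
  have i : HasDerivAt (fun x => (f x).im) f'.im x := Complex.imCLM.hasFDerivAt.comp_hasDerivAt _ h
  simp only [normSq_apply]
  refine ((r.mul r).add (i.mul i)).congr_deriv ?_
  ring

lemma dot_le (p q : ℂ) : |p.re * q.re + p.im * q.im| ≤ ‖p‖ * ‖q‖ := by
  have h := Complex.abs_re_le_norm ((starRingEnd ℂ) p * q)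
  rw [norm_mul, Complex.norm_conj] at h
  refine le_trans (le_of_eq ?_) h
  congr 1; simp

end EQ

namespace EQ
open Metric Set MeasureTheory Topology

lemma fence0 {n n' : ℝ → ℝ} {p q : ℝ} (hd : ∀ x ∈ Icc p q, HasDerivAt n (n' x) x) (hp : n p ≤ 0)
    (hb : ∀ x ∈ Ico p q, n x = 0 → n' x < 0) : ∀ x ∈ Icc p q, n x ≤ 0 := by
  intro x hx
  have := image_le_of_deriv_right_lt_deriv_boundary' (f := n) (f' := n') (a := p) (b := q)
    (fun x hx => (hd x hx).continuousAt.continuousWithinAt)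
    (fun x hx => (hd x (Ico_subset_Icc_self hx)).hasDerivWithinAt) (B := fun _ => 0) (B' := fun _ => 0) hp
    continuousOn_const (fun x _ => hasDerivWithinAt_const ..) hb
  exact this hx

lemma zero_mem_Eg : (0:ℂ) ∈ Eg := by simp [Eg]

lemma RR_zero (u : ℝ) : RR 0 u = 1 := by simp [RR]

lemma ric_step {u Γ Γ' d D : ℝ} {N N' P P' c : ℂ} (hu : 0 < u) (hΓ : 0 < Γ)
    (hN : 2 * u * N' = u * N + P) (hP : 2 * u * P' = u * (c * N) - (u + d) * P) (hc : ‖c‖ ≤ D)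
    (hne : N ≠ 0) (h0 : normSq P - Γ ^ 2 * normSq N = 0)
    (hI : u * (D - 2 * Γ) - d * Γ + Γ ^ 2 - 2 * u * Γ' < 0) :
    2 * (P.re * P'.re + P.im * P'.im) - (2 * Γ * Γ' * normSq N + Γ ^ 2 * (2 * (N.re * N'.re + N.im * N'.im))) < 0 := by
  have hn : 0 < ‖N‖ := norm_pos_iff.2 hne
  have hPn : ‖P‖ = Γ * ‖N‖ := by
    rw [Complex.normSq_eq_norm_sq, Complex.normSq_eq_norm_sq] at h0
    have : ‖P‖ ^ 2 = (Γ * ‖N‖) ^ 2 := by rw [mul_pow]; linarith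
    exact (pow_left_inj₀ (norm_nonneg _) (by positivity) (by norm_num)).1 this
  have d1 := (abs_le.1 (dot_le P (c * N))).2
  have d2 := (abs_le.1 (dot_le N P)).1
  have d3 : ‖P‖ * ‖c * N‖ ≤ D * (Γ * ‖N‖ ^ 2) := by
    rw [norm_mul, hPn]
    have : Γ * ‖N‖ * (‖c‖ * ‖N‖) ≤ Γ * ‖N‖ * (D * ‖N‖) := by gcongr
    linarith
  have d4 : ‖N‖ * ‖P‖ = Γ * ‖N‖ ^ 2 := by rw [hPn]; ring
  have n1 := congrArg Complex.re hN
  have n2 := congrArg Complex.im hN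
  have p1 := congrArg Complex.re hP
  have p2 := congrArg Complex.im hP
  have e2 : (2 * (u:ℂ)) = ((2 * u : ℝ) : ℂ) := by push_cast; ring
  have e3 : ((u:ℂ) + d) = ((u + d : ℝ) : ℂ) := by push_cast; ring
  rw [e2] at n1 n2 p1 p2
  rw [e3] at p1 p2
  simp only [re_ofReal_mul, im_ofReal_mul, add_re, add_im, sub_re, sub_im] at n1 n2 p1 p2
  set W := c * N
  have hNs : normSq N = ‖N‖ ^ 2 := Complex.normSq_eq_norm_sq N
  have hPs : P.re * P.re + P.im * P.im = Γ ^ 2 * ‖N‖ ^ 2 := by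
    rw [← normSq_apply, ← hNs]; linarith
  have hNs' : N.re * N.re + N.im * N.im = ‖N‖ ^ 2 := by rw [← normSq_apply, hNs]
  rw [hNs]
  have key : u * (2 * (P.re * P'.re + P.im * P'.im) - (2 * Γ * Γ' * ‖N‖ ^ 2 + Γ ^ 2 * (2 * (N.re * N'.re + N.im * N'.im))))
      = u * (P.re * W.re + P.im * W.im) - (u + d) * (Γ ^ 2 * ‖N‖ ^ 2) - 2 * u * Γ * Γ' * ‖N‖ ^ 2
        - Γ ^ 2 * (u * ‖N‖ ^ 2 + (N.re * P.re + N.im * P.im)) := by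
    rw [← hPs]
    rw [← hNs']
    linear_combination P.re * p1 + P.im * p2 - Γ ^ 2 * (N.re * n1 + N.im * n2)
  have b1 : u * (P.re * W.re + P.im * W.im) ≤ u * (D * (Γ * ‖N‖ ^ 2)) := by
    apply mul_le_mul_of_nonneg_left _ hu.le; linarith
  have b2 : -(Γ ^ 2 * (N.re * P.re + N.im * P.im)) ≤ Γ ^ 2 * (Γ * ‖N‖ ^ 2) := by
    have := mul_le_mul_of_nonneg_left d2 (sq_nonneg Γ)
    rw [d4] at this; linarith
  have b3 : Γ * ‖N‖ ^ 2 * (u * (D - 2 * Γ) - d * Γ + Γ ^ 2 - 2 * u * Γ') < 0 :=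
    mul_neg_of_pos_of_neg (by positivity) hI
  have : u * (2 * (P.re * P'.re + P.im * P'.im) - (2 * Γ * Γ' * ‖N‖ ^ 2 + Γ ^ 2 * (2 * (N.re * N'.re + N.im * N'.im)))) < 0 := by
    rw [key]; nlinarith
  by_contra hcon
  push Not at hcon
  nlinarith [mul_nonneg hu.le hcon]

lemma ric_fence {κ : ℕ} (hκ : κ = 0 ∨ κ = 1) {b : ℂ} (hb0 : b ≠ 0) {D : ℝ} (hD : ‖b - 2 * dd κ‖ ≤ D)
    {p q : ℝ} (hp : 0 ≤ p) {Γ Γ' : ℝ → ℝ} (hΓ : ∀ u ∈ Icc p q, 0 < Γ u)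
    (hΓd : ∀ u ∈ Icc p q, HasDerivAt Γ (Γ' u) u)
    (hI : ∀ u ∈ Icc p q, 0 < u → u * (D - 2 * Γ u) - dd κ * Γ u + Γ u ^ 2 - 2 * u * Γ' u < 0)
    (hst : ‖b * f0 κ 0 b p - dd κ * NN κ 0 b p‖ ≤ Γ p * ‖NN κ 0 b p‖) :
    ∀ u ∈ Icc p q, ‖b * f0 κ 0 b u - dd κ * NN κ 0 b u‖ ≤ Γ u * ‖NN κ 0 b u‖ := by
  have hNN0 : ∀ u, b * f0 κ 0 b u - dd κ * NN κ 0 b u = 0 → NN κ 0 b u ≠ 0 := by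
    intro u h h'
    rw [h', mul_zero, sub_zero] at h
    exact NN_f0_ne hκ 0 b u ((mul_eq_zero.1 h).resolve_left hb0) h'
  have hsq : ∀ u ∈ Icc p q, (normSq (b * f0 κ 0 b u - dd κ * NN κ 0 b u) - Γ u ^ 2 * normSq (NN κ 0 b u) ≤ 0 ↔
      ‖b * f0 κ 0 b u - dd κ * NN κ 0 b u‖ ≤ Γ u * ‖NN κ 0 b u‖) := by
    intro u hu
    rw [Complex.normSq_eq_norm_sq, Complex.normSq_eq_norm_sq, ← mul_pow, sub_nonpos]
    have := hΓ u hu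
    exact pow_le_pow_iff_left₀ (norm_nonneg _) (by positivity) (by norm_num)
  intro u hu
  rw [← hsq u hu]
  refine fence0 (p := p) (q := q) (n := fun u => normSq (b * f0 κ 0 b u - dd κ * NN κ 0 b u) - Γ u ^ 2 * normSq (NN κ 0 b u)) (n' := fun u =>
      2 * ((b * f0 κ 0 b u - dd κ * NN κ 0 b u).re * (b * f1 κ 0 b u - dd κ * NN' κ 0 b u).re +
        (b * f0 κ 0 b u - dd κ * NN κ 0 b u).im * (b * f1 κ 0 b u - dd κ * NN' κ 0 b u).im) -
      (2 * Γ u * Γ' u * normSq (NN κ 0 b u) + Γ u ^ 2 * (2 * ((NN κ 0 b u).re * (NN' κ 0 b u).re + (NN κ 0 b u).im * (NN' κ 0 b u).im))))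
      ?_ ((hsq p (left_mem_Icc.2 (hu.1.trans hu.2))).2 hst) ?_ u hu
  · intro x hx
    have hx0 : 0 ≤ x := hp.trans hx.1
    have dN := NN_deriv κ (b := b) zero_mem_Eg hx0
    have dP := ((f0_deriv κ 0 b x).const_mul b).sub (dN.const_mul (dd κ : ℂ))
    refine ((normSq_hasDerivAt dP).sub (((hΓd x hx).pow 2).mul (normSq_hasDerivAt dN))).congr_deriv ?_
    simp
  · intro x hx h0
    have hx' := Ico_subset_Icc_self hx
    have hx0 : 0 ≤ x := hp.trans hx.1
    have hne : NN κ 0 b x ≠ 0 := by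
      intro h
      simp only [h, normSq_zero, mul_zero, sub_zero, normSq_eq_zero] at h0
      exact hNN0 x (by rw [h, mul_zero, sub_zero]; exact h0) h
    have hxp : 0 < x := by
      rcases hx0.eq_or_lt with h | h
      · exfalso
        rw [← h, NN_zero, f0_zero] at h0
        rw [← h, NN_zero] at hne
        have hd : (dd κ : ℂ) ≠ 0 := by exact_mod_cast (by linarith [dd_pos κ] : dd κ ≠ 0)
        have e : b * 1 - dd κ * (b / dd κ) = 0 := by field_simp; ring
        rw [e, normSq_zero] at h0
        have := hΓ 0 (by rw [h]; exact hx')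
        have h3 : 0 < Γ 0 ^ 2 * normSq (b / dd κ) := mul_pos (by positivity) (normSq_pos.2 hne)
        linarith
      · exact h
    have eq1 := NN'_eq κ (b := b) zero_mem_Eg hx0
    rw [RR_zero] at eq1
    have eqm : mu κ 0 b x = b := by unfold mu; rw [RR_zero]; ring
    rw [eqm] at eq1
    have eqN : NN κ 0 b x = 2 * f1 κ 0 b x + f0 κ 0 b x := by unfold NN; rw [RR_zero, one_mul]
    refine ric_step (d := dd κ) (c := b - 2 * dd κ) hxp (hΓ x hx') ?_ ?_ hD hne h0 (hI x hx' hxp)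
    · linear_combination eq1
    · linear_combination (-(dd κ : ℂ)) * eq1 - b * x * eqN

/-- Barrier for the Riccati variable at `ε = 0`. -/
lemma ric0 {κ : ℕ} (hκ : κ = 0 ∨ κ = 1) {b : ℂ} (hb0 : b ≠ 0) (hD : ‖b - 2 * dd κ‖ ≤ 2 * dd κ + 1 / 1000)
    {u : ℝ} (hu : 0 ≤ u) :
    ‖b * f0 κ 0 b u - dd κ * NN κ 0 b u‖ ≤ (dd κ + 1) * ‖NN κ 0 b u‖ := by
  have hd1 := dd_pos κ
  set us := (dd κ + 1.5) / 2 with hus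
  have h1 : ∀ u ∈ Icc 0 us, ‖b * f0 κ 0 b u - dd κ * NN κ 0 b u‖ ≤
      (dd κ - dd κ * 0.15 * (u + 0.2)⁻¹) * ‖NN κ 0 b u‖ := by
    refine ric_fence hκ hb0 hD le_rfl (Γ := fun u => dd κ - dd κ * 0.15 * (u + 0.2)⁻¹)
      (Γ' := fun u => dd κ * 0.15 * ((u + 0.2) ^ 2)⁻¹) ?_ ?_ ?_ ?_
    · intro u hu
      have hu0 := hu.1
      have : (u + 0.2)⁻¹ ≤ 5 := by
        rw [inv_le_comm₀ (by linarith) (by norm_num)]; linarith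
      nlinarith
    · intro u hu
      have hu0 := hu.1
      have h : HasDerivAt (fun u : ℝ => u + 0.2) 1 u := (hasDerivAt_id u).add_const _
      have hne : u + 0.2 ≠ 0 := by linarith
      refine (((h.inv hne).const_mul (dd κ * 0.15)).const_sub (dd κ)).congr_deriv ?_
      field_simp
    · intro u hu hu0
      have hne : u + 0.2 ≠ 0 := by linarith
      have hu2 : u ≤ (dd κ + 1.5) / 2 := hu.2
      set i := (u + 0.2)⁻¹ with hi
      have hi0 : 0 < i := inv_pos.2 (by linarith)
      have hi1 : i * (u + 0.2) = 1 := inv_mul_cancel₀ hne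
      have hui : u = (1 - 0.2 * i) / i := by field_simp; linarith
      rw [show ((u + 0.2) ^ 2)⁻¹ = i ^ 2 by rw [hi, inv_pow]]
      have main : u * (2 * dd κ + 1 / 1000 - 2 * (dd κ - dd κ * 0.15 * i)) - dd κ * (dd κ - dd κ * 0.15 * i)
          + (dd κ - dd κ * 0.15 * i) ^ 2 - 2 * u * (dd κ * 0.15 * i ^ 2)
          = i ^ 2 * (dd κ * 0.15) * (u * (u + 0.2) ^ 2 / (1000 * (dd κ * 0.15)) + 2 * u * (u + 0.2) - dd κ * (u + 0.2) + dd κ * 0.15 - 2 * u) := by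
        have hdne : dd κ ≠ 0 := by linarith
        rw [show i = 1 / (u + 0.2) by rw [hi, one_div]]
        field_simp
        ring
      rw [main]
      refine mul_neg_of_pos_of_neg (by positivity) ?_
      have hsmall : u * (u + 0.2) ^ 2 / (1000 * (dd κ * 0.15)) ≤ 0.1 * u := by
        rw [div_le_iff₀ (by positivity)]
        rcases dd_cases hκ with h | h <;> rw [h] at hu2 ⊢ <;> nlinarith [mul_nonneg hu0.le (sub_nonneg.2 hu2), mul_nonneg hu0.le hu0.le]
      nlinarith
    · rw [NN_zero, f0_zero]
      have hd : (dd κ : ℂ) ≠ 0 := by exact_mod_cast (by linarith [dd_pos κ] : dd κ ≠ 0)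
      have e : b * 1 - dd κ * (b / dd κ) = 0 := by field_simp; ring
      rw [e, norm_zero]
      refine mul_nonneg ?_ (norm_nonneg _)
      norm_num; linarith
  have hΓle : ∀ u : ℝ, 0 ≤ u → dd κ - dd κ * 0.15 * (u + 0.2)⁻¹ ≤ dd κ + 1 := by
    intro u hu
    have : 0 ≤ dd κ * 0.15 * (u + 0.2)⁻¹ := by positivity
    linarith
  have hus0 : 0 ≤ us := by rw [hus]; linarith
  rcases le_total u us with h | h
  · exact (h1 u ⟨hu, h⟩).trans (mul_le_mul_of_nonneg_right (hΓle u hu) (norm_nonneg _))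
  · refine ric_fence hκ hb0 hD hus0 (q := u) (Γ := fun _ => dd κ + 1) (Γ' := fun _ => 0) ?_ ?_ ?_ ?_ u ⟨h, le_rfl⟩
    · intro u hu; linarith
    · intro u hu; exact hasDerivAt_const _ _
    · intro v hv hv0
      have := hv.1
      rw [hus] at this
      rcases dd_cases hκ with h | h <;> rw [h] at this ⊢ <;> linarith
    · exact (h1 us ⟨hus0, le_rfl⟩).trans (mul_le_mul_of_nonneg_right (hΓle us hus0) (norm_nonneg _))

end EQ

namespace EQ
open Metric Set MeasureTheory Topology

def Nb (κ : ℕ) (β : ℝ) : Set ℂ := {b | ‖b - 2 * dd κ‖ ≤ 2 * dd κ + 1 / 1000 ∧ β ≤ ‖b‖ ∧ ‖b‖ ≤ 2 * dd κ + 1}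

lemma Nb_compact (κ : ℕ) (β : ℝ) : IsCompact (Nb κ β) := by
  refine (isCompact_closedBall (0:ℂ) (2 * dd κ + 1)).of_isClosed_subset ?_ ?_
  · unfold Nb
    simp only [ofPred_and]
    refine IsClosed.inter ?_ (IsClosed.inter ?_ ?_) <;> exact isClosed_le (by fun_prop) (by fun_prop)
  · rintro b ⟨_, _, h⟩
    simpa using h

lemma Eg_closed : IsClosed Eg := by
  unfold Eg
  exact isClosed_le (by fun_prop) (by fun_prop)

lemma NN_contAt (κ : ℕ) {ε : ℂ} (hε : ε ∈ Eg) (b : ℂ) {u : ℝ} (hu : 0 ≤ u) :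
    ContinuousAt (fun q : ℂ × ℂ × ℝ => NN κ q.1 q.2.1 q.2.2) (ε, b, u) := by
  unfold NN
  have hR : ContinuousAt (fun q : ℂ × ℂ × ℝ => RR q.1 q.2.2) (ε, b, u) :=
    ContinuousAt.comp (f := fun q : ℂ × ℂ × ℝ => (q.1, q.2.2)) (g := fun q : ℂ × ℝ => RR q.1 q.2) (RR_contAt hε hu) (by fun_prop)
  exact (((f1_cont κ).continuousAt).const_mul 2).add (hR.mul (f0_cont κ).continuousAt)

lemma RR_contAt3 {ε : ℂ} (hε : ε ∈ Eg) (b : ℂ) {u : ℝ} (hu : 0 ≤ u) :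
    ContinuousAt (fun q : ℂ × ℂ × ℝ => RR q.1 q.2.2) (ε, b, u) :=
    ContinuousAt.comp (f := fun q : ℂ × ℂ × ℝ => (q.1, q.2.2)) (g := fun q : ℂ × ℝ => RR q.1 q.2) (RR_contAt hε hu) (by fun_prop)

lemma NN'_contAt (κ : ℕ) {ε : ℂ} (hε : ε ∈ Eg) (b : ℂ) {u : ℝ} (hu : 0 ≤ u) :
    ContinuousAt (fun q : ℂ × ℂ × ℝ => NN' κ q.1 q.2.1 q.2.2) (ε, b, u) := by
  unfold NN'
  have hR := RR_contAt3 hε b hu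
  refine (((f2_cont κ).continuousAt.const_mul 2).add ((ContinuousAt.div continuousAt_fst (hR.const_mul 2) ?_).mul (f0_cont κ).continuousAt)).add (hR.mul (f1_cont κ).continuousAt)
  exact mul_ne_zero two_ne_zero (RR_ne _ _)

/-- near `ε = 0`, on compact `u`-ranges. -/
lemma tube1 {κ : ℕ} (hκ : κ = 0 ∨ κ = 1) {β : ℝ} (hβ : 0 < β) (U : ℝ) :
    ∃ ε0 > 0, ∀ ε ∈ Eg, ‖ε‖ ≤ ε0 → ∀ b ∈ Nb κ β, ∀ u ∈ Icc 0 U,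
      ‖b * f0 κ ε b u - dd κ * NN κ ε b u‖ < (dd κ + 1.5) * ‖NN κ ε b u‖ := by
  have hK : IsCompact (Nb κ β ×ˢ Icc (0:ℝ) U) := (Nb_compact κ β).prod isCompact_Icc
  have key : ∀ᶠ ε in 𝓝 (0:ℂ), ∀ x ∈ Nb κ β ×ˢ Icc (0:ℝ) U,
      ‖x.1 * f0 κ ε x.1 x.2 - dd κ * NN κ ε x.1 x.2‖ < (dd κ + 1.5) * ‖NN κ ε x.1 x.2‖ := by
    refine hK.eventually_forall_of_forall_eventually ?_
    rintro ⟨b, u⟩ ⟨⟨hb1, hb2, hb3⟩, hu⟩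
    have hb0 : b ≠ 0 := by rintro rfl; simp at hb2; linarith
    have h := ric0 hκ hb0 hb1 hu.1
    have hN : NN κ 0 b u ≠ 0 := by
      intro h'
      rw [h', norm_zero, mul_zero, mul_zero, sub_zero] at h
      have := norm_le_zero_iff.1 h
      exact NN_f0_ne hκ 0 b u ((mul_eq_zero.1 this).resolve_left hb0) h'
    have hn : 0 < ‖NN κ 0 b u‖ := norm_pos_iff.2 hN
    have c1 := NN_contAt κ zero_mem_Eg b hu.1
    have c2 : ContinuousAt (fun q : ℂ × ℂ × ℝ => ‖q.2.1 * f0 κ q.1 q.2.1 q.2.2 - dd κ * NN κ q.1 q.2.1 q.2.2‖) (0, b, u) := by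
      refine ContinuousAt.norm (ContinuousAt.sub (ContinuousAt.mul (by fun_prop) (f0_cont κ).continuousAt) (c1.const_mul _))
    have c3 := (c1.norm.const_mul (dd κ + 1.5))
    exact c2.eventually_lt c3 (by simp only; linarith)
  obtain ⟨r, hr, h⟩ := Metric.eventually_nhds_iff.1 key
  refine ⟨r / 2, by positivity, fun ε _ hε' b hb u hu => h (y := ε) ?_ (b, u) ⟨hb, hu⟩⟩
  rw [dist_zero_right]; linarith

lemma mu_bound {κ : ℕ} (hκ : κ = 0 ∨ κ = 1) {β : ℝ} {ε b : ℂ} (hε : ε ∈ Eg) (hb : b ∈ Nb κ β) {u : ℝ} (hu : 0 ≤ u) :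
    ‖mu κ ε b u‖ ≤ 19 * Real.sqrt (1 + ‖ε‖ * u) := by
  set t := Real.sqrt (1 + ‖ε‖ * u) with ht
  have ht1 : 1 ≤ t := by
    rw [ht, Real.one_le_sqrt]; have : 0 ≤ ‖ε‖ * u := by positivity
    linarith
  have h1 := RR_norm hε hu
  have h2 := RR_re hε hu
  have h3 : 1 / 2 ≤ ‖RR ε u‖ := by
    have := (Complex.re_le_norm (RR ε u)); linarith
  have h4 : ‖1 / RR ε u‖ ≤ 2 := by
    rw [norm_div, norm_one, div_le_iff₀ (by linarith)]; linarith
  have hd : dd κ ≤ 3 := by rcases dd_cases hκ with h | h <;> rw [h] <;> norm_num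
  have hd1 := dd_pos κ
  have h5 : ‖((dd κ : ℂ) + 1) * RR ε u‖ ≤ 4 * t := by
    rw [norm_mul]
    have : ‖(dd κ : ℂ) + 1‖ = dd κ + 1 := by
      rw [show (dd κ : ℂ) + 1 = ((dd κ + 1 : ℝ) : ℂ) by push_cast; ring, Complex.norm_real, Real.norm_of_nonneg (by linarith)]
    rw [this]
    exact mul_le_mul (by linarith) h1 (norm_nonneg _) (by norm_num)
  have h6 : ‖(dd κ : ℂ) - b‖ ≤ 10 := by
    refine (norm_sub_le _ _).trans ?_
    rw [Complex.norm_real, Real.norm_of_nonneg (by linarith)]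
    linarith [hb.2.2]
  unfold mu
  have := norm_sub_le (((dd κ : ℂ) + 1) * RR ε u - 1 / RR ε u) (dd κ - b)
  have := norm_sub_le (((dd κ : ℂ) + 1) * RR ε u) (1 / RR ε u)
  linarith

lemma bar_step {u t e d C β : ℝ} {N N' P P' R m b : ℂ} (hu : 0 < u) (ht1 : 1 ≤ t) (ht : t ^ 2 = 1 + e * u) (he : 0 ≤ e)
    (hd : 0 ≤ d) (hC : 1 ≤ C) (hβ : 0 < β) (hR : t / 2 ≤ R.re)
    (hN : 2 * u * N' = (u * R - d) * N + m * P) (hP : 2 * u * P' = u * (b * N - R * P))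
    (hm : ‖m‖ ≤ 19 * t / β) (hb : ‖b‖ ≤ C - 1) (hne : N ≠ 0)
    (h0 : (1 + e * u) * normSq P - C ^ 2 * normSq N = 0) (hU : C * (1 + d) + 19 * C ^ 2 / β < u) :
    e * normSq P + (1 + e * u) * (2 * (P.re * P'.re + P.im * P'.im)) - C ^ 2 * (2 * (N.re * N'.re + N.im * N'.im)) < 0 := by
  have hn : 0 < ‖N‖ := norm_pos_iff.2 hne
  have hPn : t * ‖P‖ = C * ‖N‖ := by
    rw [Complex.normSq_eq_norm_sq, Complex.normSq_eq_norm_sq, ← ht] at h0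
    have : (t * ‖P‖) ^ 2 = (C * ‖N‖) ^ 2 := by rw [mul_pow, mul_pow]; linarith
    exact (pow_left_inj₀ (by positivity) (by positivity) (by norm_num)).1 this
  have d1 := (abs_le.1 (dot_le P (b * N))).2
  have d2 := (abs_le.1 (dot_le N (m * P))).1
  rw [norm_mul] at d1 d2
  have n1 := congrArg Complex.re hN
  have n2 := congrArg Complex.im hN
  have p1 := congrArg Complex.re hP
  have p2 := congrArg Complex.im hP
  have e2 : (2 * (u:ℂ)) = ((2 * u : ℝ) : ℂ) := by push_cast; ring
  rw [e2] at n1 n2 p1 p2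
  set W := b * N
  set V := m * P
  rw [sub_mul, mul_assoc] at n1 n2
  simp only [re_ofReal_mul, im_ofReal_mul, add_re, add_im, sub_re, sub_im, mul_re R, mul_im R] at n1 n2 p1 p2
  have hNs : normSq N = ‖N‖ ^ 2 := Complex.normSq_eq_norm_sq N
  have hPs : normSq P = ‖P‖ ^ 2 := Complex.normSq_eq_norm_sq P
  have hNs' : N.re * N.re + N.im * N.im = ‖N‖ ^ 2 := by rw [← normSq_apply, hNs]
  have hPs' : P.re * P.re + P.im * P.im = ‖P‖ ^ 2 := by rw [← normSq_apply, hPs]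
  rw [hPs, ← ht]
  have key : u * (e * ‖P‖ ^ 2 + t ^ 2 * (2 * (P.re * P'.re + P.im * P'.im)) - C ^ 2 * (2 * (N.re * N'.re + N.im * N'.im)))
      = (t ^ 2 - 1) * ‖P‖ ^ 2 + t ^ 2 * (u * (P.re * W.re + P.im * W.im) - u * R.re * ‖P‖ ^ 2)
        - C ^ 2 * ((u * R.re - d) * ‖N‖ ^ 2 + (N.re * V.re + N.im * V.im)) := by
    rw [← hPs', ← hNs']
    linear_combination t ^ 2 * (P.re * p1 + P.im * p2) - C ^ 2 * (N.re * n1 + N.im * n2) - (P.re * P.re + P.im * P.im) * ht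
  have tP : t ^ 2 * ‖P‖ ^ 2 = C ^ 2 * ‖N‖ ^ 2 := by rw [← mul_pow, ← mul_pow, hPn]
  have b1 : t ^ 2 * (u * (P.re * W.re + P.im * W.im)) ≤ t * u * C * (C - 1) * ‖N‖ ^ 2 := by
    have : t ^ 2 * (u * (P.re * W.re + P.im * W.im)) ≤ t ^ 2 * (u * (‖P‖ * (‖b‖ * ‖N‖))) := by gcongr
    refine this.trans ?_
    have e : t ^ 2 * (u * (‖P‖ * (‖b‖ * ‖N‖))) = t * u * C * ‖N‖ ^ 2 * ‖b‖ := by linear_combination t * u * ‖b‖ * ‖N‖ * hPn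
    rw [e]
    have : t * u * C * ‖N‖ ^ 2 * ‖b‖ ≤ t * u * C * ‖N‖ ^ 2 * (C - 1) := by gcongr
    linarith
  have b2 : u * (t / 2) * (C ^ 2 * ‖N‖ ^ 2) ≤ u * R.re * (C ^ 2 * ‖N‖ ^ 2) := by gcongr
  have b3 : -(N.re * V.re + N.im * V.im) ≤ 19 * C / β * ‖N‖ ^ 2 := by
    have : ‖N‖ * (‖m‖ * ‖P‖) ≤ ‖N‖ * (19 * t / β * ‖P‖) := by gcongr
    have e : ‖N‖ * (19 * t / β * ‖P‖) = 19 * C / β * ‖N‖ ^ 2 := by linear_combination ‖N‖ * 19 / β * hPn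
    linarith
  have b4 := mul_le_mul_of_nonneg_left b3 (sq_nonneg C)
  have b5 : 0 ≤ ‖P‖ ^ 2 := by positivity
  have b6 : C ^ 2 * (1 + d) + 19 * C ^ 3 / β - u * C < 0 := by
    have := mul_lt_mul_of_pos_left hU (by linarith : 0 < C)
    have e : C * (C * (1 + d) + 19 * C ^ 2 / β) = C ^ 2 * (1 + d) + 19 * C ^ 3 / β := by ring
    linarith
  have b7 : u * C ≤ t * u * C := by
    have h : 0 < u * C := by positivity
    have := mul_le_mul_of_nonneg_right ht1 h.le
    linarith only [this]
  have b8 : ‖N‖ ^ 2 * (C ^ 2 * (1 + d) + 19 * C ^ 3 / β - t * u * C) < 0 :=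
    mul_neg_of_pos_of_neg (by positivity) (by linarith only [b6, b7])
  have b9 : u * (e * ‖P‖ ^ 2 + t ^ 2 * (2 * (P.re * P'.re + P.im * P'.im)) - C ^ 2 * (2 * (N.re * N'.re + N.im * N'.im))) < 0 := by
    rw [key]
    have e1 : t ^ 2 * (u * R.re * ‖P‖ ^ 2) = u * R.re * (C ^ 2 * ‖N‖ ^ 2) := by linear_combination u * R.re * tP
    have e2 : C ^ 2 * (19 * C / β * ‖N‖ ^ 2) = ‖N‖ ^ 2 * (19 * C ^ 3 / β) := by ring
    rw [e2] at b4
    have e3 : (t ^ 2 - 1) * ‖P‖ ^ 2 + t ^ 2 * (u * (P.re * W.re + P.im * W.im) - u * R.re * ‖P‖ ^ 2)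
        - C ^ 2 * ((u * R.re - d) * ‖N‖ ^ 2 + (N.re * V.re + N.im * V.im)) =
        C ^ 2 * ‖N‖ ^ 2 - ‖P‖ ^ 2 + t ^ 2 * (u * (P.re * W.re + P.im * W.im)) - 2 * (u * R.re * (C ^ 2 * ‖N‖ ^ 2))
         + d * (C ^ 2 * ‖N‖ ^ 2) + C ^ 2 * -(N.re * V.re + N.im * V.im) := by
      linear_combination tP - e1
    have e4 : ‖N‖ ^ 2 * (C ^ 2 * (1 + d) + 19 * C ^ 3 / β - t * u * C) = C ^ 2 * ‖N‖ ^ 2 + d * (C ^ 2 * ‖N‖ ^ 2)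
       + ‖N‖ ^ 2 * (19 * C ^ 3 / β) + t * u * C * (C - 1) * ‖N‖ ^ 2 - 2 * (u * (t / 2) * (C ^ 2 * ‖N‖ ^ 2)) := by ring
    rw [e3]
    rw [e4] at b8
    clear_value W V
    generalize t ^ 2 * (u * (P.re * W.re + P.im * W.im)) = x1 at *
    generalize C ^ 2 * -(N.re * V.re + N.im * V.im) = x2 at *
    generalize u * R.re * (C ^ 2 * ‖N‖ ^ 2) = x3 at *
    generalize u * (t / 2) * (C ^ 2 * ‖N‖ ^ 2) = x4 at *
    generalize t * u * C * (C - 1) * ‖N‖ ^ 2 = x5 at *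
    generalize ‖N‖ ^ 2 * (19 * C ^ 3 / β) = x6 at *
    linarith only [b1, b2, b4, b5, b8]
  by_contra hcon
  push Not at hcon
  exact absurd b9 (not_lt.2 (mul_nonneg hu.le hcon))

lemma bar {κ : ℕ} (hκ : κ = 0 ∨ κ = 1) {β : ℝ} (hβ : 0 < β) (hβ1 : β ≤ 1 / 1000) {ε b : ℂ} (hε : ε ∈ Eg) (hb : b ∈ Nb κ β)
    (he : ‖ε‖ * (2000 / β) ≤ 0.1)
    (hst : ‖b * f0 κ ε b (2000 / β)‖ ≤ (2 * dd κ + 1.5) * ‖NN κ ε b (2000 / β)‖) {u : ℝ} (hu : 2000 / β ≤ u) :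
    (1 + ‖ε‖ * u) * ‖b * f0 κ ε b u‖ ^ 2 ≤ (2 * dd κ + 2) ^ 2 * ‖NN κ ε b u‖ ^ 2 := by
  have hb0 : b ≠ 0 := by rintro rfl; have := hb.2.1; simp at this; linarith
  have hd1 := dd_pos κ
  have hd : dd κ ≤ 3 := by rcases dd_cases hκ with h | h <;> rw [h] <;> norm_num
  have hp0 : 0 < 2000 / β := by positivity
  have := fence0 (p := 2000 / β) (q := u) (n := fun u => (1 + ‖ε‖ * u) * normSq (b * f0 κ ε b u) - (2 * dd κ + 2) ^ 2 * normSq (NN κ ε b u))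
    (n' := fun u => ‖ε‖ * normSq (b * f0 κ ε b u) + (1 + ‖ε‖ * u) * (2 * ((b * f0 κ ε b u).re * (b * f1 κ ε b u).re + (b * f0 κ ε b u).im * (b * f1 κ ε b u).im))
      - (2 * dd κ + 2) ^ 2 * (2 * ((NN κ ε b u).re * (NN' κ ε b u).re + (NN κ ε b u).im * (NN' κ ε b u).im)))
    ?_ ?_ ?_ u ⟨hu, le_rfl⟩
  · simp only [Complex.normSq_eq_norm_sq] at this
    linarith
  · intro x hx
    have hx0 : 0 ≤ x := hp0.le.trans hx.1
    have h1 : HasDerivAt (fun u : ℝ => 1 + ‖ε‖ * u) ‖ε‖ x := by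
      simpa using ((hasDerivAt_id x).const_mul ‖ε‖).const_add 1
    exact ((h1.mul (normSq_hasDerivAt ((f0_deriv κ ε b x).const_mul b))).sub
      ((normSq_hasDerivAt (NN_deriv κ (b := b) hε hx0)).const_mul _))
  · simp only [Complex.normSq_eq_norm_sq]
    have h2 : ‖b * f0 κ ε b (2000 / β)‖ ^ 2 ≤ ((2 * dd κ + 1.5) * ‖NN κ ε b (2000 / β)‖) ^ 2 := by gcongr
    have h3 : (1 + ‖ε‖ * (2000 / β)) * ‖b * f0 κ ε b (2000 / β)‖ ^ 2 ≤ 1.1 * ((2 * dd κ + 1.5) * ‖NN κ ε b (2000 / β)‖) ^ 2 := by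
      apply mul_le_mul (by linarith) h2 (by positivity) (by norm_num)
    have h4 : 1.1 * (2 * dd κ + 1.5) ^ 2 ≤ (2 * dd κ + 2) ^ 2 := by
      rcases dd_cases hκ with h | h <;> rw [h] <;> norm_num
    have := mul_le_mul_of_nonneg_right h4 (sq_nonneg ‖NN κ ε b (2000 / β)‖)
    nlinarith
  · intro x hx h0
    have hx0 : 0 < x := hp0.trans_le hx.1
    have hne : NN κ ε b x ≠ 0 := by
      intro h
      simp only [h, normSq_zero, mul_zero, sub_zero] at h0
      have h1 : 0 < 1 + ‖ε‖ * x := by positivity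
      have h2 := normSq_eq_zero.1 ((mul_eq_zero.1 h0).resolve_left h1.ne')
      exact NN_f0_ne hκ ε b x ((mul_eq_zero.1 h2).resolve_left hb0) h
    have ht : Real.sqrt (1 + ‖ε‖ * x) ^ 2 = 1 + ‖ε‖ * x := Real.sq_sqrt (by positivity)
    have ht1 : 1 ≤ Real.sqrt (1 + ‖ε‖ * x) := by
      rw [Real.one_le_sqrt]; have : 0 ≤ ‖ε‖ * x := by positivity
      linarith
    refine bar_step (d := dd κ) (β := β) (R := RR ε x) (m := mu κ ε b x / b) (b := b) hx0 ht1 ht (norm_nonneg _)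
      (by linarith) (by linarith) hβ (RR_re hε hx0.le) ?_ ?_ ?_ (by linarith [hb.2.2]) hne h0 ?_
    · rw [NN'_eq κ hε hx0.le]; field_simp
    · unfold NN; ring
    · rw [norm_div]
      have := mu_bound hκ hε hb hx0.le
      gcongr
      exact hb.2.1
    · refine lt_of_lt_of_le ?_ hx.1
      have e : 2000 / β = 1900 / β + 100 / β := by ring
      have e3 : 100 ≤ 100 / β := by rw [le_div_iff₀ hβ]; linarith
      have e4 : 19 * (2 * dd κ + 2) ^ 2 / β ≤ 1900 / β := by
        gcongr; nlinarith
      nlinarith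

/-- main uniform estimate -/
lemma tube {κ : ℕ} (hκ : κ = 0 ∨ κ = 1) {β : ℝ} (hβ : 0 < β) (hβ1 : β ≤ 1 / 1000) :
    ∃ ε0 > 0, ∃ M > 0, ∀ ε ∈ Eg, ‖ε‖ ≤ ε0 → ∀ b ∈ Nb κ β, ∀ u : ℝ, 0 ≤ u →
      NN κ ε b u ≠ 0 ∧ ‖f0 κ ε b u‖ ≤ M * ‖NN κ ε b u‖ ∧
      ‖NN' κ ε b u / NN κ ε b u - RR ε u / 2‖ ≤ M / (1 + u) := by
  obtain ⟨ε1, hε1, h1⟩ := tube1 hκ hβ (2000 / β)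
  have hp0 : 0 < 2000 / β := by positivity
  have hd1 := dd_pos κ
  have hd : dd κ ≤ 3 := by rcases dd_cases hκ with h | h <;> rw [h] <;> norm_num
  set ε0 := min ε1 (0.1 / (2000 / β)) with hε0
  have hsm : ∀ ε ∈ Eg, ‖ε‖ ≤ ε0 → ∀ b ∈ Nb κ β, ∀ u ∈ Icc 0 (2000 / β), ‖b * f0 κ ε b u‖ ≤ (2 * dd κ + 1.5) * ‖NN κ ε b u‖ ∧ NN κ ε b u ≠ 0 := by
    intro ε hε hεs b hb u hu
    have h := h1 ε hε (hεs.trans (min_le_left _ _)) b hb u hu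
    constructor
    · have := norm_add_le (b * f0 κ ε b u - dd κ * NN κ ε b u) (dd κ * NN κ ε b u)
      rw [sub_add_cancel, norm_mul (dd κ : ℂ), Complex.norm_real, Real.norm_of_nonneg (by linarith)] at this
      nlinarith
    · intro h'
      simp only [h', norm_zero, mul_zero] at h
      exact not_lt.2 (norm_nonneg _) h
  have hbig : ∀ ε ∈ Eg, ‖ε‖ ≤ ε0 → ∀ b ∈ Nb κ β, ∀ u, 2000 / β ≤ u → (1 + ‖ε‖ * u) * ‖b * f0 κ ε b u‖ ^ 2 ≤ (2 * dd κ + 2) ^ 2 * ‖NN κ ε b u‖ ^ 2 := by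
    intro ε hε hεs b hb u hu
    refine bar hκ hβ hβ1 hε hb ?_ (hsm ε hε hεs b hb _ ⟨hp0.le, le_rfl⟩).1 hu
    have : ‖ε‖ ≤ 0.1 / (2000 / β) := hεs.trans (min_le_right _ _)
    rwa [le_div_iff₀ hp0] at this
  have hKc : IsCompact ((Eg ∩ closedBall 0 ε0) ×ˢ Nb κ β ×ˢ Icc (0:ℝ) (2000 / β)) :=
    (((isCompact_closedBall _ _).inter_left Eg_closed)).prod ((Nb_compact κ β).prod isCompact_Icc)
  obtain ⟨M0, hM0⟩ := hKc.exists_bound_of_continuousOn (f := fun q : ℂ × ℂ × ℝ => NN' κ q.1 q.2.1 q.2.2 / NN κ q.1 q.2.1 q.2.2 - RR q.1 q.2.2 / 2) (by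
    rintro ⟨ε, b, u⟩ ⟨⟨hε, hεs⟩, hb, hu⟩
    refine ContinuousAt.continuousWithinAt ?_
    exact ((NN'_contAt κ hε b hu.1).div (NN_contAt κ hε b hu.1) (hsm ε hε (by simpa using hεs) b hb u hu).2).sub ((RR_contAt3 hε b hu.1).div_const 2))
  have hT : ∀ ε ∈ Eg, ‖ε‖ ≤ ε0 → ∀ b ∈ Nb κ β, ∀ u : ℝ, 0 ≤ u → ‖b * f0 κ ε b u‖ ≤ 8 * ‖NN κ ε b u‖ := by
    intro ε hε hεs b hb u hu
    rcases le_total u (2000 / β) with h | h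
    · refine (hsm ε hε hεs b hb u ⟨hu, h⟩).1.trans ?_
      gcongr; linarith
    · have h2 := hbig ε hε hεs b hb u h
      have h3 : 1 * ‖b * f0 κ ε b u‖ ^ 2 ≤ (1 + ‖ε‖ * u) * ‖b * f0 κ ε b u‖ ^ 2 := by
        gcongr; have : 0 ≤ ‖ε‖ * u := by positivity
        linarith
      have h4 : (2 * dd κ + 2) ^ 2 * ‖NN κ ε b u‖ ^ 2 ≤ 8 ^ 2 * ‖NN κ ε b u‖ ^ 2 := by
        gcongr; linarith
      refine le_of_sq_le_sq ?_ (by positivity)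
      rw [mul_pow]; linarith
  have hNe : ∀ ε ∈ Eg, ‖ε‖ ≤ ε0 → ∀ b ∈ Nb κ β, ∀ u : ℝ, 0 ≤ u → NN κ ε b u ≠ 0 := by
    intro ε hε hεs b hb u hu h'
    have hb0 : b ≠ 0 := by rintro rfl; have := hb.2.1; simp at this; linarith
    have h := hT ε hε hεs b hb u hu
    rw [h', norm_zero, mul_zero] at h
    exact NN_f0_ne hκ ε b u ((mul_eq_zero.1 (norm_le_zero_iff.1 h)).resolve_left hb0) h'
  set M := |M0| * (1 + 2000 / β) + 8 / β + (3 + 19 * 8 / β) with hM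
  have hMp : 0 < 8 / β := by positivity
  have hMp' : 0 < 19 * 8 / β := by positivity
  refine ⟨ε0, by positivity, M, by positivity, ?_⟩
  intro ε hε hεs b hb u hu
  have hN := hNe ε hε hεs b hb u hu
  have hNp : 0 < ‖NN κ ε b u‖ := norm_pos_iff.2 hN
  refine ⟨hN, ?_, ?_⟩
  · have h := hT ε hε hεs b hb u hu
    rw [norm_mul] at h
    have h2 : β * ‖f0 κ ε b u‖ ≤ ‖b‖ * ‖f0 κ ε b u‖ := by gcongr; exact hb.2.1
    have h3 : ‖f0 κ ε b u‖ ≤ 8 / β * ‖NN κ ε b u‖ := by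
      rw [div_mul_eq_mul_div, le_div_iff₀ hβ]; linarith
    refine h3.trans ?_
    gcongr
    have : 0 ≤ |M0| * (1 + 2000 / β) := by positivity
    rw [hM]; linarith
  · rw [le_div_iff₀ (by linarith)]
    rcases le_total u (2000 / β) with h | h
    · have h3 := hM0 (ε, b, u) ⟨⟨hε, by simpa using hεs⟩, hb, ⟨hu, h⟩⟩
      simp only at h3
      have := mul_le_mul (h3.trans (le_abs_self M0)) (by linarith : 1 + u ≤ 1 + 2000 / β) (by linarith) (abs_nonneg _)
      rw [hM]; linarith
    · have hu0 : 0 < u := hp0.trans_le h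
      have hbr := hbig ε hε hεs b hb u h
      set t := Real.sqrt (1 + ‖ε‖ * u) with ht
      have ht2 : t ^ 2 = 1 + ‖ε‖ * u := Real.sq_sqrt (by positivity)
      have ht0 : 0 ≤ t := Real.sqrt_nonneg _
      have h4 : t * ‖b * f0 κ ε b u‖ ≤ 8 * ‖NN κ ε b u‖ := by
        refine le_of_sq_le_sq ?_ (by positivity)
        rw [mul_pow, mul_pow, ht2]
        refine hbr.trans ?_
        gcongr; linarith
      have h5 : t * ‖f0 κ ε b u‖ ≤ 8 / β * ‖NN κ ε b u‖ := by
        rw [norm_mul] at h4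
        have h2 : t * (β * ‖f0 κ ε b u‖) ≤ t * (‖b‖ * ‖f0 κ ε b u‖) := by gcongr; exact hb.2.1
        rw [div_mul_eq_mul_div, le_div_iff₀ hβ]; linarith
      have huC : (u:ℂ) ≠ 0 := by exact_mod_cast hu0.ne'
      have e : NN' κ ε b u / NN κ ε b u - RR ε u / 2 = (mu κ ε b u * f0 κ ε b u / NN κ ε b u - dd κ) / (2 * u) := by
        have := NN'_eq κ (b := b) hε hu0.le
        field_simp
        linear_combination this
      have hmu := mu_bound hκ hε hb hu0.le
      have h6 : ‖mu κ ε b u * f0 κ ε b u / NN κ ε b u‖ ≤ 19 * 8 / β := by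
        rw [norm_div, norm_mul, div_le_iff₀ hNp]
        have := mul_le_mul_of_nonneg_right hmu (norm_nonneg (f0 κ ε b u))
        calc _ ≤ _ := this
          _ = 19 * (t * ‖f0 κ ε b u‖) := by rw [ht]; ring
          _ ≤ 19 * (8 / β * ‖NN κ ε b u‖) := by gcongr
          _ = _ := by ring
      have h7 : ‖(mu κ ε b u * f0 κ ε b u / NN κ ε b u - dd κ)‖ ≤ 3 + 19 * 8 / β := by
        refine (norm_sub_le _ _).trans ?_
        rw [Complex.norm_real, Real.norm_of_nonneg (by linarith)]; linarith
      rw [e, norm_div, norm_mul, Complex.norm_real, Real.norm_of_nonneg hu0.le, div_mul_eq_mul_div]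
      have h1u : 1 ≤ u := by
        refine le_trans ?_ h
        rw [le_div_iff₀ hβ]; linarith
      rw [div_le_iff₀ (by simp; linarith)]
      have hMM : 3 + 19 * 8 / β ≤ M := by
        have : 0 ≤ |M0| * (1 + 2000 / β) := by positivity
        rw [hM]; linarith
      have h2n : ‖(2:ℂ)‖ = 2 := by simp
      rw [h2n]
      have := mul_le_mul (h7.trans hMM) (by linarith : 1 + u ≤ 2 * u) (by linarith) (by linarith)
      exact this

end EQ

namespace EQ
open Metric Set MeasureTheory Topology

lemma logint {κ : ℕ} (hκ : κ = 0 ∨ κ = 1) {β : ℝ} (hβ : 0 < β) (hβ1 : β ≤ 1 / 1000) :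
    ∃ ε0 > 0, ∃ M > 0, ∃ L : ℂ × ℂ × ℝ → ℂ,
      ContinuousOn L {q | (q.1 ∈ Eg ∧ ‖q.1‖ ≤ ε0) ∧ q.2.1 ∈ Nb κ β ∧ 0 ≤ q.2.2} ∧
      ∀ ε ∈ Eg, ε ≠ 0 → ‖ε‖ ≤ ε0 → ∀ b ∈ Nb κ β, ∀ u : ℝ, 0 ≤ u →
      NN κ ε b u ≠ 0 ∧ ‖f0 κ ε b u‖ ≤ M * ‖NN κ ε b u‖ ∧
      NN κ ε b u = b / dd κ * exp ((RR ε u ^ 3 - 1) / (3 * ε) + L (ε, b, u)) ∧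
      ‖L (ε, b, u)‖ ≤ M * Real.log (1 + u) := by
  obtain ⟨ε0, hε0, M, hM, H⟩ := tube hκ hβ hβ1
  obtain ⟨g, hg⟩ : ∃ g : ℂ → ℂ → ℝ → ℂ, g = fun ε b u => NN' κ ε b u / NN κ ε b u - RR ε u / 2 := ⟨_, rfl⟩
  set S : Set (ℂ × ℂ) := {q | (q.1 ∈ Eg ∧ ‖q.1‖ ≤ ε0) ∧ q.2 ∈ Nb κ β} with hS
  have hgc : Continuous (Function.uncurry fun (q : S) (u : ℝ) => g q.1.1 q.1.2 (max u 0)) := by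
    rw [continuous_iff_continuousAt]
    rintro ⟨⟨⟨ε, b⟩, hεb, hb⟩, u⟩
    have hu : 0 ≤ max u 0 := le_max_right _ _
    have c0 : ContinuousAt (fun q : ℂ × ℂ × ℝ => g q.1 q.2.1 q.2.2) (ε, b, max u 0) := by
      rw [hg]
      exact ((NN'_contAt κ hεb.1 b hu).div (NN_contAt κ hεb.1 b hu) (H ε hεb.1 hεb.2 b hb _ hu).1).sub ((RR_contAt3 hεb.1 b hu).div_const 2)
    exact ContinuousAt.comp (g := fun q : ℂ × ℂ × ℝ => g q.1 q.2.1 q.2.2)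
      (f := fun p : S × ℝ => ((p.1.1.1, p.1.1.2, max p.2 0) : ℂ × ℂ × ℝ)) (x := (⟨(ε, b), hεb, hb⟩, u)) c0 (by fun_prop)
  have hLc := intervalIntegral.continuous_parametric_primitive_of_continuous (μ := volume) (a₀ := 0) hgc
  refine ⟨ε0, hε0, M, hM, fun q => ∫ t in (0:ℝ)..q.2.2, g q.1 q.2.1 (max t 0), ?_, ?_⟩
  · rw [continuousOn_iff_continuous_domRestrict]
    have hm : Continuous fun x : {q : ℂ × ℂ × ℝ | (q.1 ∈ Eg ∧ ‖q.1‖ ≤ ε0) ∧ q.2.1 ∈ Nb κ β ∧ 0 ≤ q.2.2} =>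
        (((⟨(x.1.1, x.1.2.1), x.2.1, x.2.2.1⟩ : S), x.1.2.2) : S × ℝ) := by
      refine Continuous.prodMk (Continuous.subtype_mk (by fun_prop) _) (by fun_prop)
    exact hLc.comp hm
  · intro ε hε hε1 hεs b hb u hu
    have hh := H ε hε hεs b hb
    have hc1 : Continuous fun u => g ε b (max u 0) := by
      have : Continuous fun u : ℝ => (((⟨(ε, b), ⟨hε, hεs⟩, hb⟩ : S), u) : S × ℝ) := by fun_prop
      exact hgc.comp this
    have hd : ∀ x : ℝ, HasDerivAt (fun u => ∫ t in (0:ℝ)..u, g ε b (max t 0)) (g ε b (max x 0)) x := fun x =>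
      (hc1.integral_hasStrictDerivAt 0 x).hasDerivAt
    refine ⟨(hh u hu).1, (hh u hu).2.1, ?_, ?_⟩
    · have hdd : (dd κ : ℂ) ≠ 0 := by exact_mod_cast (by linarith [dd_pos κ] : dd κ ≠ 0)
      set E : ℝ → ℂ := fun u => (RR ε u ^ 3 - 1) / (3 * ε) + ∫ t in (0:ℝ)..u, g ε b (max t 0) with hE
      have hEd : ∀ x, 0 ≤ x → HasDerivAt E (NN' κ ε b x / NN κ ε b x) x := by
        intro x hx
        have := ((((RR_deriv hε hx).pow 3).sub_const 1).div_const (3 * ε)).add (hd x)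
        refine this.congr_deriv ?_
        have h1 := RR_ne ε x
        have h2 := (hh x hx).1
        rw [max_eq_left hx, hg]
        simp only
        field_simp
        push_cast
        ring
      have hΦ : ∀ x, 0 ≤ x → HasDerivAt (fun x => NN κ ε b x * exp (-E x)) 0 x := by
        intro x hx
        refine ((NN_deriv κ hε hx).mul (hEd x hx).neg.cexp).congr_deriv ?_
        have h2 := (hh x hx).1
        field_simp
        ring
      have := constant_of_has_deriv_right_zero (a := 0) (b := u) (fun x hx => (hΦ x hx.1).continuousAt.continuousWithinAt)
        (fun x hx => (hΦ x hx.1).hasDerivWithinAt) u ⟨hu, le_rfl⟩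
      have hE0 : E 0 = 0 := by simp [hE, RR]
      rw [hE0, NN_zero, neg_zero, exp_zero, mul_one, exp_neg] at this
      rw [← this, mul_assoc]
      rw [inv_mul_cancel₀ (exp_ne_zero _), mul_one]
    · have := image_norm_le_of_norm_deriv_right_le_deriv_boundary' (a := 0) (b := u)
        (f := fun u => ∫ t in (0:ℝ)..u, g ε b (max t 0)) (f' := fun x => g ε b (max x 0))
        (B := fun x => M * Real.log (1 + x)) (B' := fun x => M / (1 + x))
        (fun x _ => (hd x).continuousAt.continuousWithinAt) (fun x _ => (hd x).hasDerivWithinAt) (by simp) ?_ ?_ ?_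
      · exact this ⟨hu, le_rfl⟩
      · intro x hx
        have : 1 + x ≠ 0 := by linarith [hx.1]
        exact (ContinuousAt.mul continuousAt_const (ContinuousAt.log (by fun_prop) this)).continuousWithinAt
      · intro x hx
        have h0 : 1 + x ≠ 0 := by linarith [hx.1]
        have h1 : HasDerivAt (fun x : ℝ => 1 + x) 1 x := (hasDerivAt_id x).const_add 1
        refine ((h1.log h0).const_mul M).hasDerivWithinAt.congr_deriv ?_
        ring
      · intro x hx
        rw [max_eq_left hx.1, hg]
        exact (hh x hx.1).2.2

end EQ

namespace EQ
open Metric Set MeasureTheory Topology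

/-- the point of matching -/
noncomputable def zq (κ : ℕ) (c b : ℂ) : ℂ × ℂ × ℂ := (((‖c‖ ^ 12 : ℝ) : ℂ) / c, c ^ 4, (dd κ - b) * c ^ 2)
noncomputable def dl (c : ℂ) : ℂ := RR ((c ^ 6)⁻¹) ((‖c‖ ^ 12) ^ 2) - ((‖c‖ ^ 12 : ℝ) : ℂ) / c ^ 3
noncomputable def De (κ : ℕ) (c b : ℂ) : ℂ :=
  c ^ 3 * dl c ^ 2 / 2 + (1 + κ) / ((‖c‖ ^ 12 : ℝ) : ℂ) - hh (zq κ c b) / (c * gg (zq κ c b))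
noncomputable def et (κ : ℕ) (c b : ℂ) : ℂ :=
  De κ c b * (f0 κ ((c ^ 6)⁻¹) b ((‖c‖ ^ 12) ^ 2) / NN κ ((c ^ 6)⁻¹) b ((‖c‖ ^ 12) ^ 2)) / ((‖c‖ ^ 12 : ℝ) : ℂ)
noncomputable def R0 (κ : ℕ) (c b : ℂ) : ℂ :=
  gg (zq κ c b) * (1 + et κ c b) * exp (c ^ 6 * (dl c / 4 + dl c ^ 3 / 12))

lemma F_match {κ : ℕ} (hκ : κ = 0 ∨ κ = 1) {c b : ℂ} (hc : c ≠ 0) (hO : zq κ c b ∈ Om) (hε : (c ^ 6)⁻¹ ∈ Eg)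
    (hN : NN κ ((c ^ 6)⁻¹) b ((‖c‖ ^ 12) ^ 2) ≠ 0) {L : ℂ}
    (hL : NN κ ((c ^ 6)⁻¹) b ((‖c‖ ^ 12) ^ 2) = b / dd κ * exp ((RR ((c ^ 6)⁻¹) ((‖c‖ ^ 12) ^ 2) ^ 3 - 1) / (3 * (c ^ 6)⁻¹) + L)) :
    F κ (c ^ 4) ((dd κ - b) * c ^ 2) = exp (-c ^ 6 / 3) * b *
      (-1 / dd κ * (c ^ 2 / c ^ κ) * ((‖c‖ ^ 12 : ℝ) : ℂ) ^ κ * exp L * R0 κ c b) := by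
  have hdd : (dd κ : ℂ) ≠ 0 := by exact_mod_cast (by linarith [dd_pos κ] : dd κ ≠ 0)
  have hcn : 0 < ‖c‖ := norm_pos_iff.2 hc
  have hFe := F_eq hκ hO
  have hgg := gg_ne hO
  have s1 := G_scale κ c⁻¹ 1 (c ^ 4) ((dd κ - b) * c ^ 2) ((‖c‖ ^ 12 : ℝ) : ℂ)
  have s2 := G'_scale κ 1 (c ^ 4) ((dd κ - b) * c ^ 2) c⁻¹ ((‖c‖ ^ 12 : ℝ) : ℂ)
  have hX : ((‖c‖ ^ 12 : ℝ) : ℂ) ≠ 0 := by exact_mod_cast (by positivity : (‖c‖ ^ 12 : ℝ) ≠ 0)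
  have q1 : c⁻¹ ^ 6 * 1 = (c ^ 6)⁻¹ := by rw [mul_one, inv_pow]
  have q2 : c⁻¹ ^ 4 * c ^ 4 = 1 := by field_simp
  have q3 : c⁻¹ ^ 2 * ((dd κ - b) * c ^ 2) = dd κ - b := by field_simp
  rw [q1, q2, q3] at s1 s2
  have q4 : c⁻¹ * ((‖c‖ ^ 12 : ℝ) : ℂ) = (zq κ c b).1 := by unfold zq; simp only; field_simp
  rw [q4] at s1 s2
  have hRsq := RR_sq hε (u := (‖c‖ ^ 12) ^ 2) (by positivity)
  have hf0 : ff κ (c ^ 6)⁻¹ 1 (dd κ - b) (((‖c‖ ^ 12 : ℝ) : ℂ) ^ 2) = f0 κ ((c ^ 6)⁻¹) b ((‖c‖ ^ 12) ^ 2) := by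
    unfold f0; rw [ofReal_pow (‖c‖ ^ 12) 2]
  have hf1 : ff' κ (c ^ 6)⁻¹ 1 (dd κ - b) (((‖c‖ ^ 12 : ℝ) : ℂ) ^ 2) = f1 κ ((c ^ 6)⁻¹) b ((‖c‖ ^ 12) ^ 2) := by
    unfold f1; rw [ofReal_pow (‖c‖ ^ 12) 2]
  have hfG : G κ (c ^ 6)⁻¹ 1 (dd κ - b) ((‖c‖ ^ 12 : ℝ) : ℂ) = ((‖c‖ ^ 12 : ℝ) : ℂ) ^ κ * f0 κ ((c ^ 6)⁻¹) b ((‖c‖ ^ 12) ^ 2) := by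
    rw [G, hf0]
  have hfG' : G' κ (c ^ 6)⁻¹ 1 (dd κ - b) ((‖c‖ ^ 12 : ℝ) : ℂ) = κ * ((‖c‖ ^ 12 : ℝ) : ℂ) ^ (κ - 1) * f0 κ ((c ^ 6)⁻¹) b ((‖c‖ ^ 12) ^ 2)
      + ((‖c‖ ^ 12 : ℝ) : ℂ) ^ κ * (2 * ((‖c‖ ^ 12 : ℝ) : ℂ) * f1 κ ((c ^ 6)⁻¹) b ((‖c‖ ^ 12) ^ 2)) := by
    rw [G', hf0, hf1]
  rw [hfG] at s1
  rw [hfG'] at s2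
  have hNd : NN κ ((c ^ 6)⁻¹) b ((‖c‖ ^ 12) ^ 2) = 2 * f1 κ ((c ^ 6)⁻¹) b ((‖c‖ ^ 12) ^ 2) + RR ((c ^ 6)⁻¹) ((‖c‖ ^ 12) ^ 2) * f0 κ ((c ^ 6)⁻¹) b ((‖c‖ ^ 12) ^ 2) := rfl
  have e1 : (RR ((c ^ 6)⁻¹) ((‖c‖ ^ 12) ^ 2) ^ 3 - 1) / (3 * (c ^ 6)⁻¹) = -((zq κ c b).1 ^ 3 / 3 + (zq κ c b).2.1 * (zq κ c b).1 / 2) * (-1) +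
     -c ^ 6 / 3 + c ^ 6 * (dl c / 4 + dl c ^ 3 / 12) := by
    rw [dl]
    unfold zq
    simp only
    rw [ofReal_pow (‖c‖ ^ 12) 2] at hRsq
    generalize RR ((c ^ 6)⁻¹) ((‖c‖ ^ 12) ^ 2) = R at *
    generalize ((‖c‖ ^ 12 : ℝ) : ℂ) = X at *
    obtain ⟨σ, hσ⟩ : ∃ σ, X = σ * c ^ 3 := ⟨X / c ^ 3, by field_simp⟩
    rw [hσ] at hRsq ⊢
    have h2 : R ^ 2 = 1 + σ ^ 2 := by rw [hRsq]; field_simp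
    have g1 : σ * c ^ 3 / c ^ 3 = σ := by field_simp
    have g2 : σ * c ^ 3 / c = σ * c ^ 2 := by field_simp
    rw [g1, g2]
    rw [div_mul_eq_div_div_swap, div_inv_eq_mul]
    linear_combination c ^ 6 * (R + σ) / 4 * h2
  have hph : ph (zq κ c b) = c / ((‖c‖ ^ 12 : ℝ) : ℂ) * exp (-((zq κ c b).1 ^ 3 / 3 + (zq κ c b).2.1 * (zq κ c b).1 / 2)) := by
    unfold ph
    congr 1
    unfold zq; simp
  have key : G κ 1 (c ^ 4) ((dd κ - b) * c ^ 2) (zq κ c b).1 * (hh (zq κ c b) - th (zq κ c b) * gg (zq κ c b)) - G' κ 1 (c ^ 4) ((dd κ - b) * c ^ 2) (zq κ c b).1 * gg (zq κ c b)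
     = -(c / c ^ κ) * ((‖c‖ ^ 12 : ℝ) : ℂ) ^ κ * ((‖c‖ ^ 12 : ℝ) : ℂ) * gg (zq κ c b) * NN κ ((c ^ 6)⁻¹) b ((‖c‖ ^ 12) ^ 2) * (1 + et κ c b) := by
    have hDe : De κ c b * (c * gg (zq κ c b)) = c ^ 4 * dl c ^ 2 / 2 * gg (zq κ c b) + (1 + κ) * c * gg (zq κ c b) / ((‖c‖ ^ 12 : ℝ) : ℂ) - hh (zq κ c b) := by
      unfold De; field_simp
    have het : NN κ ((c ^ 6)⁻¹) b ((‖c‖ ^ 12) ^ 2) * ((‖c‖ ^ 12 : ℝ) : ℂ) * (1 + et κ c b) = NN κ ((c ^ 6)⁻¹) b ((‖c‖ ^ 12) ^ 2) * ((‖c‖ ^ 12 : ℝ) : ℂ) + De κ c b * f0 κ ((c ^ 6)⁻¹) b ((‖c‖ ^ 12) ^ 2) := by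
      unfold et
      generalize NN κ ((c ^ 6)⁻¹) b ((‖c‖ ^ 12) ^ 2) = n at *
      field_simp
    have hth : th (zq κ c b) = (((‖c‖ ^ 12 : ℝ) : ℂ) / c) ^ 2 + c ^ 4 / 2 + c / ((‖c‖ ^ 12 : ℝ) : ℂ) := by
      unfold th zq; simp
    have hdl : (dl c + 2 * (((‖c‖ ^ 12 : ℝ) : ℂ) / c ^ 3)) * dl c = 1 := by
      rw [dl]
      rw [ofReal_pow (‖c‖ ^ 12) 2] at hRsq
      have : (((‖c‖ ^ 12 : ℝ) : ℂ) / c ^ 3) ^ 2 = (c ^ 6)⁻¹ * ((‖c‖ ^ 12 : ℝ) : ℂ) ^ 2 := by field_simp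
      linear_combination hRsq - this
    have hR : RR ((c ^ 6)⁻¹) ((‖c‖ ^ 12) ^ 2) = dl c + ((‖c‖ ^ 12 : ℝ) : ℂ) / c ^ 3 := by rw [dl]; ring
    rw [hR] at hNd
    have s2' : G' κ 1 (c ^ 4) ((dd κ - b) * c ^ 2) (zq κ c b).1 = c * (c⁻¹ ^ κ * (κ * ((‖c‖ ^ 12 : ℝ) : ℂ) ^ (κ - 1) * f0 κ ((c ^ 6)⁻¹) b ((‖c‖ ^ 12) ^ 2)
      + ((‖c‖ ^ 12 : ℝ) : ℂ) ^ κ * (2 * ((‖c‖ ^ 12 : ℝ) : ℂ) * f1 κ ((c ^ 6)⁻¹) b ((‖c‖ ^ 12) ^ 2)))) := by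
      rw [← s2]; field_simp
    have hr : -(c / c ^ κ) * ((‖c‖ ^ 12 : ℝ) : ℂ) ^ κ * ((‖c‖ ^ 12 : ℝ) : ℂ) * gg (zq κ c b) * NN κ ((c ^ 6)⁻¹) b ((‖c‖ ^ 12) ^ 2) * (1 + et κ c b)
        = -(1 / c ^ κ) * ((‖c‖ ^ 12 : ℝ) : ℂ) ^ κ * (c * gg (zq κ c b) * (NN κ ((c ^ 6)⁻¹) b ((‖c‖ ^ 12) ^ 2) * ((‖c‖ ^ 12 : ℝ) : ℂ)) + (De κ c b * (c * gg (zq κ c b))) * f0 κ ((c ^ 6)⁻¹) b ((‖c‖ ^ 12) ^ 2)) := by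
      linear_combination -(c / c ^ κ) * ((‖c‖ ^ 12 : ℝ) : ℂ) ^ κ * gg (zq κ c b) * het
    rw [hr, hDe, s1, s2', hth, hNd]
    clear hr hDe het hL hFe s1 s2 hNd hN hth s2' hfG hfG' hf0 hf1 hRsq e1 hph
    generalize f0 κ ((c ^ 6)⁻¹) b ((‖c‖ ^ 12) ^ 2) = f at *
    generalize f1 κ ((c ^ 6)⁻¹) b ((‖c‖ ^ 12) ^ 2) = g at *
    generalize gg (zq κ c b) = w at *
    generalize hh (zq κ c b) = v at *
    generalize dl c = δ at *
    generalize ((‖c‖ ^ 12 : ℝ) : ℂ) = X at *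
    rcases hκ with rfl | rfl
    · simp only [pow_zero, Nat.cast_zero]
      field_simp at hdl ⊢
      linear_combination c ^ 3 * f * w * X * hdl
    · simp only [pow_one, Nat.cast_one]
      norm_num
      field_simp at hdl ⊢
      linear_combination c ^ 3 * f * w * X * hdl
  have hF2 : F κ (c ^ 4) ((dd κ - b) * c ^ 2) = ph (zq κ c b) * (G κ 1 (c ^ 4) ((dd κ - b) * c ^ 2) (zq κ c b).1 * (hh (zq κ c b) - th (zq κ c b) * gg (zq κ c b)) - G' κ 1 (c ^ 4) ((dd κ - b) * c ^ 2) (zq κ c b).1 * gg (zq κ c b)) := by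
    rw [hFe]
    change G κ 1 (c ^ 4) ((dd κ - b) * c ^ 2) (zq κ c b).1 * YY' (zq κ c b) - G' κ 1 (c ^ 4) ((dd κ - b) * c ^ 2) (zq κ c b).1 * YY (zq κ c b) = _
    unfold YY' YY; ring
  rw [hF2, key, hph, hL, e1, R0, Complex.exp_add, Complex.exp_add, Complex.exp_add, mul_neg_one, exp_neg (-_)]
  have hE := exp_ne_zero (-((zq κ c b).1 ^ 3 / 3 + (zq κ c b).2.1 * (zq κ c b).1 / 2))
  field_simp

end EQ

namespace EQ
open Metric Set MeasureTheory Topology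

def Dc (c0 : ℝ) : Set ℂ := {c | c0 < ‖c‖ ∧ |(c ^ 6).re| ≤ 0.1 * ‖c‖ ^ 6 ∧ |c.im| < 0.6 * c.re ∧ 0 < (c ^ 3).re}

lemma Dc_re {c0 : ℝ} {c : ℂ} (hc : c ∈ Dc c0) : 0.8 * ‖c‖ ≤ c.re := by
  have h := hc.2.2.1
  have h0 : 0 ≤ c.re := by have := abs_nonneg c.im; linarith
  have h1 : c.im ^ 2 ≤ (0.6 * c.re) ^ 2 := sq_le_sq.2 (by rw [abs_of_nonneg (by linarith : 0 ≤ 0.6 * c.re)]; exact h.le)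
  have h2 : ‖c‖ ^ 2 = c.re ^ 2 + c.im ^ 2 := by rw [← Complex.normSq_eq_norm_sq, normSq_apply]; ring
  refine le_of_sq_le_sq ?_ h0
  nlinarith

lemma Dc_Eg {c0 : ℝ} {c : ℂ} (hc : c ∈ Dc c0) : (c ^ 6)⁻¹ ∈ Eg := by
  have h := hc.2.1
  unfold Eg
  simp only [mem_setOf_eq, Complex.inv_re, norm_inv, Complex.normSq_eq_norm_sq, norm_pow, abs_div, abs_pow, abs_norm]
  rcases eq_or_ne c 0 with rfl | h0
  · simp
  have hp : 0 < ‖c‖ := norm_pos_iff.2 h0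
  rw [div_le_iff₀ (by positivity)]
  refine h.trans (le_of_eq ?_)
  field_simp

lemma d_sub_b {κ : ℕ} (hκ : κ = 0 ∨ κ = 1) {β : ℝ} {b : ℂ} (hb : b ∈ Nb κ β) : ‖(dd κ : ℂ) - b‖ ≤ 10 := by
  have hd1 := dd_pos κ
  have hd : dd κ ≤ 3 := by rcases dd_cases hκ with h | h <;> rw [h] <;> norm_num
  refine (norm_sub_le _ _).trans ?_
  rw [Complex.norm_real, Real.norm_of_nonneg (by linarith)]
  linarith [hb.2.2]

lemma zq_facts {κ : ℕ} (hκ : κ = 0 ∨ κ = 1) {β : ℝ} {c b : ℂ} {c0 : ℝ} (h10 : 10 ≤ c0) (hc : c ∈ Dc c0) (hb : b ∈ Nb κ β) :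
    zq κ c b ∈ Om ∧ ‖gg (zq κ c b) - 1‖ ≤ 0.1 ∧ ‖hh (zq κ c b)‖ ≤ 1 := by
  have hr : 10 ≤ ‖c‖ := h10.trans hc.1.le
  have hre := Dc_re hc
  have h0 : c ≠ 0 := norm_pos_iff.1 (by linarith)
  have e1 : (zq κ c b).1.re = ‖c‖ ^ 10 * c.re := by
    unfold zq
    simp only [Complex.div_re, ofReal_re, ofReal_im, Complex.normSq_eq_norm_sq]
    field_simp
    ring
  have e2 : (zq κ c b).1.im = -(‖c‖ ^ 10 * c.im) := by
    unfold zq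
    simp only [Complex.div_im, ofReal_re, ofReal_im, Complex.normSq_eq_norm_sq]
    field_simp
    ring
  have hmm : mm (zq κ c b) ≤ ‖c‖ ^ 8 := by
    unfold mm zq
    simp only [norm_mul, norm_pow]
    have := d_sub_b hκ hb
    have h1 : ‖(dd κ : ℂ) - b‖ * ‖c‖ ^ 2 ≤ 10 * ‖c‖ ^ 2 := by gcongr
    have h2 : (10:ℝ) ^ 4 * ‖c‖ ^ 4 ≤ ‖c‖ ^ 4 * ‖c‖ ^ 4 := by gcongr
    have h3 : (10:ℝ) ^ 2 * ‖c‖ ^ 2 ≤ ‖c‖ ^ 2 * ‖c‖ ^ 2 := by gcongr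
    have h4 : (10:ℝ) ^ 2 ≤ ‖c‖ ^ 2 := by gcongr
    ring_nf at *
    linarith
  have hmp := mm_pos (zq κ c b)
  have hbig : 2 * mm (zq κ c b) ≤ 0.1 * (zq κ c b).1.re := by
    rw [e1]
    have h1 : ‖c‖ ^ 10 * (0.8 * ‖c‖) ≤ ‖c‖ ^ 10 * c.re := by gcongr
    have h2 : (10:ℝ) ^ 3 * ‖c‖ ^ 8 ≤ ‖c‖ ^ 3 * ‖c‖ ^ 8 := by gcongr
    ring_nf at *
    linarith
  have hO : zq κ c b ∈ Om := by
    refine ⟨by linarith, ?_⟩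
    rw [e1, e2, abs_neg, abs_mul, abs_of_nonneg (by positivity : (0:ℝ) ≤ ‖c‖ ^ 10)]
    have := hc.2.2.1
    have : ‖c‖ ^ 10 * |c.im| < ‖c‖ ^ 10 * (0.6 * c.re) := by gcongr
    linarith
  have h4 := Om_re hO
  refine ⟨hO, (gg_bound hO).trans ?_, (hh_bound hO).trans ?_⟩
  · rw [div_le_iff₀ (by linarith)]; exact hbig
  · rw [div_le_one (by positivity)]; nlinarith

lemma dl_facts {c : ℂ} {c0 : ℝ} (h10 : 10 ≤ c0) (hc : c ∈ Dc c0) : ‖dl c‖ * ‖c‖ ^ 9 ≤ 2 := by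
  have hr : 10 ≤ ‖c‖ := h10.trans hc.1.le
  have h0 : c ≠ 0 := norm_pos_iff.1 (by linarith)
  have hp : 0 < ‖c‖ := by linarith
  have hε := Dc_Eg hc
  have hu : (0:ℝ) ≤ (‖c‖ ^ 12) ^ 2 := by positivity
  have hR := RR_re hε hu
  have hs := RR_sq hε hu
  have ht : ‖c‖ ^ 9 ≤ Real.sqrt (1 + ‖(c ^ 6)⁻¹‖ * (‖c‖ ^ 12) ^ 2) := by
    apply Real.le_sqrt_of_sq_le
    rw [norm_inv, norm_pow]
    have : (‖c‖ ^ 6)⁻¹ * (‖c‖ ^ 12) ^ 2 = ‖c‖ ^ 18 := by field_simp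
    rw [this]; ring_nf; linarith
  have hσ : 0 ≤ (((‖c‖ ^ 12 : ℝ) : ℂ) / c ^ 3).re := by
    rw [Complex.div_re]
    have := hc.2.2.2
    simp only [ofReal_re, ofReal_im, zero_mul, zero_div, add_zero]
    have := normSq_nonneg (c ^ 3)
    positivity
  have hprod : (RR ((c ^ 6)⁻¹) ((‖c‖ ^ 12) ^ 2) + ((‖c‖ ^ 12 : ℝ) : ℂ) / c ^ 3) * dl c = 1 := by
    rw [dl]
    rw [ofReal_pow (‖c‖ ^ 12) 2] at hs
    have : (((‖c‖ ^ 12 : ℝ) : ℂ) / c ^ 3) ^ 2 = (c ^ 6)⁻¹ * ((‖c‖ ^ 12 : ℝ) : ℂ) ^ 2 := by field_simp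
    linear_combination hs - this
  have h3 : ‖c‖ ^ 9 / 2 ≤ ‖RR ((c ^ 6)⁻¹) ((‖c‖ ^ 12) ^ 2) + ((‖c‖ ^ 12 : ℝ) : ℂ) / c ^ 3‖ := by
    refine le_trans ?_ (Complex.re_le_norm _)
    rw [add_re]; linarith
  have h4 := congrArg norm hprod
  rw [norm_mul, norm_one] at h4
  have := mul_le_mul_of_nonneg_right h3 (norm_nonneg (dl c))
  linarith

lemma prod3 {x y z : ℂ} (hx : ‖x - 1‖ ≤ 0.1) (hy : ‖y‖ ≤ 0.1) (hz : ‖z - 1‖ ≤ 0.1) : ‖x * (1 + y) * z - 1‖ ≤ 1 / 2 := by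
  have e : x * (1 + y) * z - 1 = (x - 1) * (1 + y) * z + (1 + y) * (z - 1) + y := by ring
  have hz' : ‖z‖ ≤ 1.1 := by have := norm_add_le (z - 1) 1; simp at this; linarith
  have hy' : ‖1 + y‖ ≤ 1.1 := by have := norm_add_le 1 y; simp at this; linarith
  rw [e]
  refine (norm_add₃_le).trans ?_
  rw [norm_mul, norm_mul, norm_mul]
  have h1 : ‖x - 1‖ * ‖1 + y‖ * ‖z‖ ≤ 0.1 * 1.1 * 1.1 := by gcongr
  have h2 : ‖1 + y‖ * ‖z - 1‖ ≤ 1.1 * 0.1 := by gcongr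
  norm_num at *
  linarith

lemma R0_bound {κ : ℕ} (hκ : κ = 0 ∨ κ = 1) {β : ℝ} {c b : ℂ} {c0 M : ℝ} (h10 : 10 ≤ c0) (hM : 30 * M ≤ c0) (hc : c ∈ Dc c0) (hb : b ∈ Nb κ β)
    (hf : ‖f0 κ ((c ^ 6)⁻¹) b ((‖c‖ ^ 12) ^ 2)‖ ≤ M * ‖NN κ ((c ^ 6)⁻¹) b ((‖c‖ ^ 12) ^ 2)‖)
    (hN : NN κ ((c ^ 6)⁻¹) b ((‖c‖ ^ 12) ^ 2) ≠ 0) : ‖R0 κ c b - 1‖ ≤ 1 / 2 := by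
  obtain ⟨hO, hg, hh1⟩ := zq_facts hκ h10 hc hb
  have hd := dl_facts h10 hc
  have hr : 10 ≤ ‖c‖ := h10.trans hc.1.le
  have h0 : c ≠ 0 := norm_pos_iff.1 (by linarith)
  have hp : 0 < ‖c‖ := by linarith
  have hd9 : ‖dl c‖ * ‖c‖ ^ 6 ≤ 0.002 := by
    have h1 : ‖dl c‖ * ‖c‖ ^ 6 * 10 ^ 3 ≤ ‖dl c‖ * ‖c‖ ^ 6 * ‖c‖ ^ 3 := by gcongr
    have e : ‖dl c‖ * ‖c‖ ^ 6 * ‖c‖ ^ 3 = ‖dl c‖ * ‖c‖ ^ 9 := by ring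
    linarith
  have h6 : (10:ℝ) ^ 6 ≤ ‖c‖ ^ 6 := by gcongr
  have hd1 : ‖dl c‖ ≤ 0.1 := by nlinarith [norm_nonneg (dl c)]
  have hDe : ‖De κ c b‖ ≤ 3 := by
    unfold De
    have b1 : ‖c ^ 3 * dl c ^ 2 / 2‖ ≤ 1 := by
      rw [norm_div, norm_mul, norm_pow, norm_pow]
      have : ‖c‖ ^ 3 * ‖dl c‖ ^ 2 ≤ 1 := by
        have h1 : ‖c‖ ^ 3 ≤ ‖c‖ ^ 6 := by gcongr <;> linarith
        have h2 : ‖c‖ ^ 3 * ‖dl c‖ ^ 2 ≤ ‖c‖ ^ 6 * ‖dl c‖ ^ 2 := by gcongr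
        nlinarith [norm_nonneg (dl c)]
      simp only [Complex.norm_ofNat]; linarith
    have b2 : ‖(1 + (κ:ℂ)) / ((‖c‖ ^ 12 : ℝ) : ℂ)‖ ≤ 1 := by
      rw [norm_div, Complex.norm_real, Real.norm_of_nonneg (by positivity), div_le_one (by positivity)]
      have h1 : ‖(1 + (κ:ℂ))‖ ≤ 2 := by rcases hκ with rfl | rfl <;> norm_num
      have h2 : (10:ℝ) ^ 12 ≤ ‖c‖ ^ 12 := by gcongr
      linarith
    have b3 : ‖hh (zq κ c b) / (c * gg (zq κ c b))‖ ≤ 1 := by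
      have hg2 : 0.9 ≤ ‖gg (zq κ c b)‖ := by
        have := norm_sub_norm_le (1:ℂ) (gg (zq κ c b))
        rw [norm_sub_rev, norm_one] at this; linarith
      rw [norm_div, norm_mul, div_le_one (by positivity)]
      nlinarith
    have := norm_sub_le (c ^ 3 * dl c ^ 2 / 2 + (1 + (κ:ℂ)) / ((‖c‖ ^ 12 : ℝ) : ℂ)) (hh (zq κ c b) / (c * gg (zq κ c b)))
    have := norm_add_le (c ^ 3 * dl c ^ 2 / 2) ((1 + (κ:ℂ)) / ((‖c‖ ^ 12 : ℝ) : ℂ))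
    linarith
  have het : ‖et κ c b‖ ≤ 0.1 := by
    unfold et
    rw [norm_div, norm_mul, norm_div, Complex.norm_real, Real.norm_of_nonneg (by positivity), div_le_iff₀ (by positivity)]
    have h1 : ‖f0 κ ((c ^ 6)⁻¹) b ((‖c‖ ^ 12) ^ 2)‖ / ‖NN κ ((c ^ 6)⁻¹) b ((‖c‖ ^ 12) ^ 2)‖ ≤ M := by
      rw [div_le_iff₀ (norm_pos_iff.2 hN)]; exact hf
    have h2 := mul_le_mul hDe h1 (by positivity) (by norm_num)
    have h3 : ‖c‖ ≤ ‖c‖ ^ 12 := le_self_pow₀ (by linarith) (by norm_num)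
    have := hc.1
    linarith
  unfold R0
  refine prod3 hg het ?_
  have hx : ‖c ^ 6 * (dl c / 4 + dl c ^ 3 / 12)‖ ≤ 0.01 := by
    rw [norm_mul, norm_pow]
    have h1 : ‖dl c / 4 + dl c ^ 3 / 12‖ ≤ ‖dl c‖ := by
      refine (norm_add_le _ _).trans ?_
      rw [norm_div, norm_div, norm_pow, Complex.norm_ofNat, Complex.norm_ofNat]
      have : ‖dl c‖ ^ 3 ≤ ‖dl c‖ := pow_le_of_le_one (norm_nonneg _) (by linarith) (by norm_num)
      linarith [norm_nonneg (dl c)]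
    have : ‖c‖ ^ 6 * ‖dl c / 4 + dl c ^ 3 / 12‖ ≤ ‖c‖ ^ 6 * ‖dl c‖ := by gcongr
    linarith
  have := Complex.norm_exp_sub_one_le (hx.trans (by norm_num))
  linarith

/-- The asymptotic formula. -/
theorem asymp {κ : ℕ} (hκ : κ = 0 ∨ κ = 1) {β : ℝ} (hβ : 0 < β) (hβ1 : β ≤ 1 / 1000) :
    ∃ c0 ≥ 10, ∃ C > 0, ∃ h : ℂ × ℂ → ℂ, ContinuousOn h (Dc c0 ×ˢ Nb κ β) ∧
      ∀ c ∈ Dc c0, ∀ b ∈ Nb κ β, F κ (c ^ 4) ((dd κ - b) * c ^ 2) = exp (-c ^ 6 / 3) * b * exp (h (c, b)) ∧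
        ‖h (c, b)‖ ≤ C * Real.log ‖c‖ := by
  obtain ⟨ε0, hε0, M, hM, L, hLc, H⟩ := logint hκ hβ hβ1
  set c0 : ℝ := 10 + 30 * M + 1 / ε0 with hc0
  have h1ε : 0 < 1 / ε0 := by positivity
  have h10 : 10 ≤ c0 := by linarith
  have hM30 : 30 * M ≤ c0 := by linarith
  have hdd : (dd κ : ℂ) ≠ 0 := by exact_mod_cast (by linarith [dd_pos κ] : dd κ ≠ 0)
  have hd3 : dd κ ≤ 3 := by rcases dd_cases hκ with h | h <;> rw [h] <;> norm_num
  have hd1 := dd_pos κ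
  have hεs : ∀ c ∈ Dc c0, ‖(c ^ 6)⁻¹‖ ≤ ε0 := by
    intro c hc
    have hr : 10 ≤ ‖c‖ := h10.trans hc.1.le
    rw [norm_inv, norm_pow, inv_le_comm₀ (by positivity) hε0, ← one_div]
    have h3 : ‖c‖ ≤ ‖c‖ ^ 6 := le_self_pow₀ (by linarith) (by norm_num)
    have := hc.1
    linarith
  have hne : ∀ c ∈ Dc c0, c ≠ 0 := fun c hc => norm_pos_iff.1 (by linarith [hc.1])
  have hR : ∀ c ∈ Dc c0, ∀ b ∈ Nb κ β, ‖R0 κ c b - 1‖ ≤ 1 / 2 := by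
    intro c hc b hb
    obtain ⟨a1, a2, a3, a4⟩ := H _ (Dc_Eg hc) (inv_ne_zero (pow_ne_zero _ (hne c hc))) (hεs c hc) b hb ((‖c‖ ^ 12) ^ 2) (by positivity)
    exact R0_bound hκ h10 hM30 hc hb a2 a1
  have hRs : ∀ c ∈ Dc c0, ∀ b ∈ Nb κ β, R0 κ c b ∈ slitPlane := by
    intro c hc b hb
    have := hR c hc b hb
    left
    have h2 := abs_le.1 ((Complex.abs_re_le_norm (R0 κ c b - 1)).trans this)
    rw [sub_re, one_re] at h2
    linarith
  refine ⟨c0, h10, 25 * M + 100, by positivity, fun q => Real.pi * I - Real.log (dd κ) + (2 - κ) * log q.1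
    + κ * (12 * Real.log ‖q.1‖ : ℝ) + L ((q.1 ^ 6)⁻¹, q.2, (‖q.1‖ ^ 12) ^ 2) + log (R0 κ q.1 q.2), ?_, ?_⟩
  · rintro ⟨c, b⟩ ⟨hc, hb⟩
    have hc' : c ≠ 0 := hne c hc
    have hcn : ‖c‖ ≠ 0 := norm_ne_zero_iff.2 hc'
    have hε := Dc_Eg hc
    have hX : ((‖c‖ ^ 12 : ℝ) : ℂ) ≠ 0 := by exact_mod_cast (by positivity : (‖c‖ ^ 12 : ℝ) ≠ 0)
    have hu : (0:ℝ) ≤ (‖c‖ ^ 12) ^ 2 := by positivity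
    have hO := (zq_facts hκ h10 hc hb).1
    have hcs : c ∈ slitPlane := by
      left; have := Dc_re hc; have := hc.1; linarith
    have hci : ContinuousAt (fun q : ℂ × ℂ => (q.1 ^ 6)⁻¹) (c, b) := by
      refine ContinuousAt.inv₀ (by fun_prop) (pow_ne_zero 6 hc')
    have hc3 : ContinuousAt (fun q : ℂ × ℂ => (((q.1 ^ 6)⁻¹, q.2, (‖q.1‖ ^ 12) ^ 2) : ℂ × ℂ × ℝ)) (c, b) :=
      hci.prodMk (by fun_prop)
    have cL : ContinuousWithinAt (fun q : ℂ × ℂ => L ((q.1 ^ 6)⁻¹, q.2, (‖q.1‖ ^ 12) ^ 2)) (Dc c0 ×ˢ Nb κ β) (c, b) := by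
      refine ContinuousWithinAt.comp (t := {q | (q.1 ∈ Eg ∧ ‖q.1‖ ≤ ε0) ∧ q.2.1 ∈ Nb κ β ∧ 0 ≤ q.2.2})
        (f := fun q : ℂ × ℂ => (((q.1 ^ 6)⁻¹, q.2, (‖q.1‖ ^ 12) ^ 2) : ℂ × ℂ × ℝ)) (g := L) (x := (c, b)) ?_ hc3.continuousWithinAt ?_
      · exact hLc _ ⟨⟨hε, hεs c hc⟩, hb, hu⟩
      · rintro ⟨c, b⟩ ⟨hc, hb⟩
        exact ⟨⟨Dc_Eg hc, hεs c hc⟩, hb, by positivity⟩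
    have cz : ContinuousAt (fun q : ℂ × ℂ => zq κ q.1 q.2) (c, b) := by
      unfold zq
      refine ContinuousAt.prodMk (ContinuousAt.div (by fun_prop) (by fun_prop) hc') (by fun_prop)
    have cg : ContinuousAt (fun q : ℂ × ℂ => gg (zq κ q.1 q.2)) (c, b) :=
      ContinuousAt.comp (f := fun q : ℂ × ℂ => zq κ q.1 q.2) (g := gg) (gg_diff hO).continuousAt cz
    have ch : ContinuousAt (fun q : ℂ × ℂ => hh (zq κ q.1 q.2)) (c, b) :=
      ContinuousAt.comp (f := fun q : ℂ × ℂ => zq κ q.1 q.2) (g := hh) (hh_diff hO).continuousAt cz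
    have cd : ContinuousAt (fun q : ℂ × ℂ => dl q.1) (c, b) := by
      unfold dl
      refine ContinuousAt.sub (ContinuousAt.comp (f := fun q : ℂ × ℂ => (((q.1 ^ 6)⁻¹, (‖q.1‖ ^ 12) ^ 2) : ℂ × ℝ)) (g := fun q : ℂ × ℝ => RR q.1 q.2) (RR_contAt hε hu) ?_) ?_
      · exact hci.prodMk (by fun_prop)
      · exact ContinuousAt.div (by fun_prop) (by fun_prop) (pow_ne_zero 3 hc')
    have cf : ContinuousAt (fun q : ℂ × ℂ => f0 κ ((q.1 ^ 6)⁻¹) q.2 ((‖q.1‖ ^ 12) ^ 2)) (c, b) :=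
      ContinuousAt.comp (g := fun q : ℂ × ℂ × ℝ => f0 κ q.1 q.2.1 q.2.2) (f0_cont κ).continuousAt hc3
    have cN : ContinuousAt (fun q : ℂ × ℂ => NN κ ((q.1 ^ 6)⁻¹) q.2 ((‖q.1‖ ^ 12) ^ 2)) (c, b) :=
      ContinuousAt.comp (f := fun q : ℂ × ℂ => (((q.1 ^ 6)⁻¹, q.2, (‖q.1‖ ^ 12) ^ 2) : ℂ × ℂ × ℝ)) (g := fun q : ℂ × ℂ × ℝ => NN κ q.1 q.2.1 q.2.2) (NN_contAt κ hε b hu) hc3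
    have hN := (H _ hε (inv_ne_zero (pow_ne_zero _ hc')) (hεs c hc) b hb _ hu).1
    have cX : ContinuousAt (fun q : ℂ × ℂ => ((‖q.1‖ ^ 12 : ℝ) : ℂ)) (c, b) := by fun_prop
    have cDe : ContinuousAt (fun q : ℂ × ℂ => De κ q.1 q.2) (c, b) := by
      unfold De
      exact ((ContinuousAt.div_const (ContinuousAt.mul (by fun_prop) (cd.pow 2)) 2).add (continuousAt_const.div cX hX)).sub
        (ch.div (continuousAt_fst.mul cg) (mul_ne_zero hc' (gg_ne hO)))
    have cR : ContinuousAt (fun q : ℂ × ℂ => R0 κ q.1 q.2) (c, b) := by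
      unfold R0 et
      refine (cg.mul (continuousAt_const.add ((cDe.mul (cf.div cN hN)).div cX hX))).mul (ContinuousAt.cexp ?_)
      exact ContinuousAt.mul (by fun_prop) ((cd.div_const 4).add ((cd.pow 3).div_const 12))
    have clogc : ContinuousAt (fun q : ℂ × ℂ => log q.1) (c, b) := ContinuousAt.clog continuousAt_fst hcs
    have clogr : ContinuousAt (fun q : ℂ × ℂ => ((12 * Real.log ‖q.1‖ : ℝ) : ℂ)) (c, b) := by
      refine Complex.continuous_ofReal.continuousAt.comp ?_
      exact continuousAt_const.mul (ContinuousAt.log (by fun_prop) hcn)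
    exact (((((continuousAt_const.add (clogc.const_mul _)).add (clogr.const_mul _)).continuousWithinAt).add cL)).add
      (cR.clog (hRs c hc b hb)).continuousWithinAt
  · intro c hc b hb
    have hc' : c ≠ 0 := hne c hc
    have hr : 10 ≤ ‖c‖ := h10.trans hc.1.le
    have hu : (0:ℝ) ≤ (‖c‖ ^ 12) ^ 2 := by positivity
    obtain ⟨a1, a2, a3, a4⟩ := H _ (Dc_Eg hc) (inv_ne_zero (pow_ne_zero _ hc')) (hεs c hc) b hb ((‖c‖ ^ 12) ^ 2) hu
    have hlr : 1 ≤ Real.log ‖c‖ := by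
      rw [Real.le_log_iff_exp_le (by linarith)]
      have := Real.exp_one_lt_d9; linarith
    constructor
    · rw [F_match hκ hc' (zq_facts hκ h10 hc hb).1 (Dc_Eg hc) a1 a3]
      congr 1
      simp only
      have e0 : exp (Real.pi * I - Real.log (dd κ)) = -1 / dd κ := by
        rw [Complex.exp_sub, exp_pi_mul_I, ← ofReal_exp, Real.exp_log (by linarith)]
      have e1 : exp ((2 - κ) * log c) = c ^ 2 / c ^ κ := by
        rw [sub_mul, Complex.exp_sub, Complex.exp_nat_mul, Complex.exp_log hc', show (2:ℂ) = ((2:ℕ):ℂ) by norm_num, Complex.exp_nat_mul, Complex.exp_log hc']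
      have e2 : exp (κ * ((12 * Real.log ‖c‖ : ℝ) : ℂ)) = ((‖c‖ ^ 12 : ℝ) : ℂ) ^ κ := by
        rw [Complex.exp_nat_mul]
        congr 1
        rw [← ofReal_exp, show (12:ℝ) = ((12:ℕ):ℝ) by norm_num, Real.exp_nat_mul, Real.exp_log (by linarith)]
      rw [Complex.exp_add, Complex.exp_add, Complex.exp_add, Complex.exp_add, e0, e1, e2,
        Complex.exp_log (slitPlane_ne_zero (hRs c hc b hb))]
    · simp only
      have b1 : ‖(Real.pi : ℂ) * I‖ ≤ 4 := by
        simp [abs_of_pos Real.pi_pos]; linarith [Real.pi_le_four]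
      have b2 : ‖(Real.log (dd κ) : ℂ)‖ ≤ 2 := by
        rw [Complex.norm_real, Real.norm_of_nonneg (Real.log_nonneg hd1)]
        have := Real.log_le_sub_one_of_pos (by linarith : 0 < dd κ)
        linarith
      have b3 : ‖log c‖ ≤ Real.log ‖c‖ + 4 := by
        rw [← re_add_im (log c), log_re, log_im]
        refine (norm_add_le _ _).trans ?_
        rw [norm_mul, norm_I, mul_one, Complex.norm_real, Complex.norm_real, Real.norm_of_nonneg (by linarith)]
        have := abs_arg_le_pi c
        rw [Real.norm_eq_abs]
        linarith [Real.pi_le_four]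
      have b4 : ‖(2 - (κ:ℂ)) * log c‖ ≤ 2 * (Real.log ‖c‖ + 4) := by
        rw [norm_mul]
        have : ‖(2 - (κ:ℂ))‖ ≤ 2 := by rcases hκ with rfl | rfl <;> norm_num
        gcongr
      have b5 : ‖(κ:ℂ) * ((12 * Real.log ‖c‖ : ℝ) : ℂ)‖ ≤ 1 * (12 * Real.log ‖c‖) := by
        rw [norm_mul, Complex.norm_real, Real.norm_of_nonneg (by linarith)]
        have : ‖(κ:ℂ)‖ ≤ 1 := by rcases hκ with rfl | rfl <;> norm_num
        gcongr
      have b6 : ‖L ((c ^ 6)⁻¹, b, (‖c‖ ^ 12) ^ 2)‖ ≤ M * (25 * Real.log ‖c‖) := by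
        refine a4.trans ?_
        gcongr
        rw [show (25:ℝ) = ((25:ℕ):ℝ) by norm_num, ← Real.log_pow]
        apply Real.log_le_log (by positivity)
        have : 1 ≤ ‖c‖ ^ 24 := one_le_pow₀ (by linarith)
        have h2 : ‖c‖ ^ 24 * 10 ≤ ‖c‖ ^ 24 * ‖c‖ := by gcongr
        ring_nf at *
        linarith
      have b7 : ‖log (R0 κ c b)‖ ≤ 1 := by
        have h := Complex.norm_log_one_add_half_le_self (hR c hc b hb)
        rw [add_sub_cancel] at h
        linarith [hR c hc b hb]
      have n1 := norm_add_le (Real.pi * I - Real.log (dd κ) + (2 - κ) * log c + κ * ((12 * Real.log ‖c‖ : ℝ) : ℂ) + L ((c ^ 6)⁻¹, b, (‖c‖ ^ 12) ^ 2)) (log (R0 κ c b))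
      have n2 := norm_add_le (Real.pi * I - Real.log (dd κ) + (2 - κ) * log c + κ * ((12 * Real.log ‖c‖ : ℝ) : ℂ)) (L ((c ^ 6)⁻¹, b, (‖c‖ ^ 12) ^ 2))
      have n3 := norm_add_le (Real.pi * I - Real.log (dd κ) + (2 - κ) * log c) (κ * ((12 * Real.log ‖c‖ : ℝ) : ℂ))
      have n4 := norm_add_le (Real.pi * I - Real.log (dd κ)) ((2 - κ) * log c)
      have n5 := norm_sub_le (Real.pi * I) (Real.log (dd κ) : ℂ)
      have hfin : 4 + 2 + 2 * (Real.log ‖c‖ + 4) + 1 * (12 * Real.log ‖c‖) + M * (25 * Real.log ‖c‖) + 1 ≤ (25 * M + 100) * Real.log ‖c‖ := by nlinarith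
      linarith

end EQ

namespace EQ
open Metric Set MeasureTheory Topology

def Ds (v1 : ℝ) : Set ℂ := {v | v1 < ‖v‖ ∧ |v.im| < 0.01 * v.re}

lemma Ds_open (v1 : ℝ) : IsOpen (Ds v1) :=
  (isOpen_lt continuous_const continuous_norm).inter
    (isOpen_lt (continuous_im.abs) (continuous_const.mul continuous_re))

noncomputable def w12 : ℂ := exp (Real.pi * I / 12)

lemma w12_sq : w12 ^ 2 = z6 := by
  unfold w12 z6; rw [← Complex.exp_nat_mul]; congr 1; push_cast; ring

lemma w12_six : w12 ^ 6 = I := by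
  unfold w12; rw [← Complex.exp_nat_mul]; refine Eq.trans ?_ Complex.exp_pi_div_two_mul_I; congr 1; push_cast; ring

lemma w12_ne : w12 ≠ 0 := exp_ne_zero _

lemma w12_eq : w12 = (Real.cos (Real.pi / 12) : ℂ) + (Real.sin (Real.pi / 12) : ℂ) * I := by
  unfold w12
  rw [show (Real.pi : ℂ) * I / 12 = ((Real.pi / 12 : ℝ) : ℂ) * I by push_cast; ring, Complex.exp_mul_I,
    ofReal_cos, ofReal_sin]

lemma w12_re : w12.re = Real.cos (Real.pi / 12) := by
  rw [w12_eq]; simp [-ofReal_cos, -ofReal_sin]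
lemma w12_im : w12.im = Real.sin (Real.pi / 12) := by
  rw [w12_eq]; simp [-ofReal_cos, -ofReal_sin]

lemma w12_norm : ‖w12‖ = 1 := by
  unfold w12
  rw [show (Real.pi : ℂ) * I / 12 = ((Real.pi / 12 : ℝ) : ℂ) * I by push_cast; ring, Complex.norm_exp_ofReal_mul_I]

lemma w12_inv : w12⁻¹ = (starRingEnd ℂ) w12 := by
  rw [Complex.inv_def, normSq_eq_norm_sq, w12_norm]; simp

lemma w12_cube : w12 ^ 3 = ((Real.sqrt 2 / 2 : ℝ) : ℂ) * (1 + I) := by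
  have : w12 ^ 3 = exp ((Real.pi / 4 : ℝ) * I) := by
    unfold w12; rw [← Complex.exp_nat_mul]; congr 1; push_cast; ring
  rw [this, Complex.exp_mul_I, ← ofReal_cos, ← ofReal_sin, Real.cos_pi_div_four, Real.sin_pi_div_four]; ring

lemma im_pow6 (v : ℂ) : (v ^ 6).im = v.im * (6 * v.re ^ 5 - 20 * v.re ^ 3 * v.im ^ 2 + 6 * v.re * v.im ^ 4) := by
  simp only [pow_succ, pow_zero, one_mul, mul_im, mul_re]; ring

lemma Ds_im6' {v : ℂ} (h : |v.im| ≤ 0.01 * v.re) : 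
    5 * |v.im| * v.re ^ 5 ≤ |(v ^ 6).im| ∧ |(v ^ 6).im| ≤ 7 * |v.im| * v.re ^ 5 := by
  have hx : 0 ≤ v.re := by have := abs_nonneg v.im; linarith
  have hy : v.im ^ 2 ≤ 0.0001 * v.re ^ 2 := by
    have : |v.im| ^ 2 ≤ (0.01 * v.re) ^ 2 := by gcongr
    rw [sq_abs] at this; linarith
  have hy4 : v.im ^ 4 ≤ v.re ^ 4 * 0.00000001 := by
    have : (v.im ^ 2) ^ 2 ≤ (0.0001 * v.re ^ 2) ^ 2 := by gcongr
    nlinarith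
  have e1 : v.re ^ 3 * v.im ^ 2 ≤ v.re ^ 3 * (0.0001 * v.re ^ 2) := by gcongr
  have e2 : v.re * v.im ^ 4 ≤ v.re * (v.re ^ 4 * 0.00000001) := by gcongr
  have e3 : 0 ≤ v.re ^ 3 * v.im ^ 2 := by positivity
  have e4 : 0 ≤ v.re * v.im ^ 4 := by positivity
  have e5 : 0 ≤ v.re ^ 5 := by positivity
  obtain ⟨q, hq⟩ : ∃ q, q = 6 * v.re ^ 5 - 20 * v.re ^ 3 * v.im ^ 2 + 6 * v.re * v.im ^ 4 := ⟨_, rfl⟩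
  have q1 : 5 * v.re ^ 5 ≤ q := by rw [hq]; ring_nf at *; linarith
  have q2 : q ≤ 7 * v.re ^ 5 := by rw [hq]; ring_nf at *; linarith
  rw [im_pow6, ← hq, abs_mul, abs_of_nonneg (by linarith : 0 ≤ q)]
  have := abs_nonneg v.im
  constructor <;> nlinarith

lemma w12_mem {v1 : ℝ} {v : ℂ} (hv : v ∈ Ds v1) : w12 * v ∈ Dc v1 := by
  have h := hv.2
  have hx : 0 < v.re := by have := abs_nonneg v.im; linarith
  have hn : v.re ≤ ‖v‖ := re_le_norm v
  have hnn : ‖w12 * v‖ = ‖v‖ := by rw [norm_mul, w12_norm, one_mul]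
  have hpi := Real.pi_lt_d2
  have hpi0 := Real.pi_pos
  have hs1 : w12.im ≤ 0.2625 := by
    rw [w12_im]; refine (Real.sin_le (by positivity)).trans (by linarith)
  have hs0 : 0 ≤ w12.im := by
    rw [w12_im]; exact Real.sin_nonneg_of_nonneg_of_le_pi (by positivity) (by linarith)
  have hc0 : 0.965 ≤ w12.re := by
    rw [w12_re]; refine le_trans ?_ (Real.one_sub_sq_div_two_le_cos)
    nlinarith
  have hc1 : w12.re ≤ 1 := by rw [w12_re]; exact Real.cos_le_one _
  obtain ⟨ha, hb⟩ := abs_lt.1 h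
  refine ⟨?_, ?_, ?_, ?_⟩
  · rw [hnn]; exact hv.1
  · rw [mul_pow, w12_six, hnn]
    simp only [mul_re, I_re, zero_mul, I_im, one_mul, zero_sub, abs_neg]
    refine (Ds_im6' h.le).2.trans ?_
    have h6 : v.re ^ 6 ≤ ‖v‖ ^ 6 := by gcongr
    have : 7 * |v.im| * v.re ^ 5 ≤ 7 * (0.01 * v.re) * v.re ^ 5 := by gcongr
    nlinarith
  · simp only [mul_re, mul_im]
    rw [abs_lt]
    constructor <;> nlinarith
  · rw [mul_pow, w12_cube, mul_assoc, Complex.re_ofReal_mul]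
    refine mul_pos (by positivity) ?_
    simp only [pow_succ, pow_zero, one_mul, mul_im, mul_re, add_re, add_im, one_re, one_im, I_re, I_im]
    have hy : v.im ^ 2 ≤ 0.0001 * v.re ^ 2 := by
      have : |v.im| ^ 2 ≤ (0.01 * v.re) ^ 2 := by gcongr
      rw [sq_abs] at this; linarith
    have q1 : v.re * v.im ^ 2 ≤ v.re * (0.0001 * v.re ^ 2) := by gcongr
    have q2 : v.re ^ 2 * v.im ≤ v.re ^ 2 * (0.01 * v.re) := by gcongr
    have q3 : v.im * v.im ^ 2 ≥ -(v.re * v.im ^ 2) := by nlinarith [sq_nonneg v.im]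
    have : 0 < v.re ^ 3 := by positivity
    ring_nf at *
    linarith

lemma Ds_conj {v1 : ℝ} {v : ℂ} (hv : v ∈ Ds v1) : (starRingEnd ℂ) v ∈ Ds v1 := by
  refine ⟨?_, ?_⟩
  · rw [RCLike.norm_conj]; exact hv.1
  · rw [conj_im, conj_re, abs_neg]; exact hv.2

lemma Dc_conj {v1 : ℝ} {v : ℂ} (hv : v ∈ Dc v1) : (starRingEnd ℂ) v ∈ Dc v1 := by
  refine ⟨?_, ?_, ?_, ?_⟩
  · rw [RCLike.norm_conj]; exact hv.1
  · rw [← map_pow, conj_re, RCLike.norm_conj]; exact hv.2.1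
  · rw [conj_im, conj_re, abs_neg]; exact hv.2.2.1
  · rw [← map_pow, conj_re]; exact hv.2.2.2

lemma w12_mem' {v1 : ℝ} {v : ℂ} (hv : v ∈ Ds v1) : w12⁻¹ * v ∈ Dc v1 := by
  have := Dc_conj (w12_mem (Ds_conj hv))
  rwa [map_mul, Complex.conj_conj, ← w12_inv] at this

def Bs (κ : ℕ) : Set ℂ := {b | b ∈ Nb κ (1 / 1000) ∧ 2 * dd κ - b ∈ Nb κ (1 / 1000) ∧ 0 < (2 * (dd κ : ℂ) - b).re}

def Ls (κ : ℕ) : Set ℂ := {l | |l.im| ≤ 7 ∧ exp l ∈ Bs κ}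

lemma log_bd {b : ℂ} (h1 : 1 / 1000 ≤ ‖b‖) (h2 : ‖b‖ ≤ 7) : |Real.log ‖b‖| ≤ 7 := by
  have e7 : (1000 : ℝ) ≤ Real.exp 7 := by
    have := Real.exp_one_gt_d9
    have h : Real.exp 7 = Real.exp 1 ^ 7 := by rw [← Real.exp_nat_mul]; norm_num
    rw [h]
    calc (1000:ℝ) ≤ 2.7 ^ 7 := by norm_num
      _ ≤ _ := by gcongr; linarith
  have hp : 0 < ‖b‖ := by linarith
  rw [abs_le]
  constructor
  · rw [Real.le_log_iff_exp_le hp, Real.exp_neg]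
    refine le_trans ?_ h1
    rw [one_div]; gcongr
  · rw [Real.log_le_iff_le_exp hp]; linarith

lemma cont_log {f : ℂ → ℂ} {x : ℂ} (hf : ContinuousAt f x) (he : DifferentiableAt ℂ (fun z => exp (f z)) x) :
    DifferentiableAt ℂ f x := by
  have hc : Tendsto (fun z => f z - f x) (𝓝 x) (𝓝 0) := by
    have := hf.tendsto.sub_const (f x); simpa using this
  have hev : ∀ᶠ z in 𝓝 x, f z = f x + log (exp (f z) * exp (-f x)) := by
    have := hc.eventually (ball_mem_nhds (0:ℂ) (by norm_num : (0:ℝ) < 1))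
    filter_upwards [this] with z hz
    rw [dist_zero_right] at hz
    have hi := (abs_im_le_norm (f z - f x)).trans_lt hz
    rw [abs_lt] at hi
    have hpi := Real.pi_gt_three
    rw [← Complex.exp_add, ← sub_eq_add_neg, Complex.log_exp (by linarith) (by linarith)]; ring
  refine DifferentiableAt.congr_of_eventuallyEq ?_ hev
  refine (differentiableAt_const _).add (DifferentiableAt.clog (he.mul_const _) ?_)
  rw [← Complex.exp_add]; simp

end EQ

namespace EQ
open Metric Set MeasureTheory Topology

noncomputable def pp (κ : ℕ) (v l : ℂ) : ℂ × ℂ := (-v ^ 4, -I * (dd κ - exp l) * v ^ 2)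

lemma pp_1 (κ : ℕ) (v l : ℂ) : z6 ^ 8 * (pp κ v l).1 = (w12 * v) ^ 4 ∧
    z6 ^ 4 * (pp κ v l).2 = (dd κ - exp l) * (w12 * v) ^ 2 ∧
    z6⁻¹ ^ 8 * (pp κ v l).1 = (w12⁻¹ * v) ^ 4 ∧
    z6⁻¹ ^ 4 * (pp κ v l).2 = (dd κ - (2 * dd κ - exp l)) * (w12⁻¹ * v) ^ 2 := by
  have h6 := w12_six
  have h0 := w12_ne
  have hI : w12⁻¹ ^ 6 = -I := by rw [inv_pow, h6, inv_I]
  have h12 : w12 ^ 12 = -1 := by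
    calc w12 ^ 12 = (w12 ^ 6) ^ 2 := by ring
      _ = _ := by rw [h6, I_sq]
  have h12' : w12⁻¹ ^ 12 = -1 := by
    calc w12⁻¹ ^ 12 = (w12⁻¹ ^ 6) ^ 2 := by ring
      _ = _ := by rw [hI, neg_sq, I_sq]
  rw [← w12_sq]
  unfold pp
  rw [← inv_pow]
  generalize w12⁻¹ = u at *
  refine ⟨?_, ?_, ?_, ?_⟩
  · linear_combination (-v ^ 4 * w12 ^ 4) * h12
  · linear_combination (-I * (dd κ - exp l) * v ^ 2 * w12 ^ 2) * h6 - (dd κ - exp l) * v ^ 2 * w12 ^ 2 * I_sq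
  · linear_combination (-v ^ 4 * u ^ 4) * h12'
  · linear_combination (-I * (dd κ - exp l) * v ^ 2 * u ^ 2) * hI + (dd κ - exp l) * v ^ 2 * u ^ 2 * I_sq

lemma Ls_logd (κ : ℕ) {b : ℂ} (hb : ‖b - dd κ‖ ≤ 0.1) : log b ∈ Ls κ ∧ b ≠ 0 ∧ 0 < b.re := by
  have hd1 := dd_pos κ
  have hre := (abs_re_le_norm (b - dd κ)).trans hb
  rw [sub_re, ofReal_re, abs_le] at hre
  have hpos : 0 < b.re := by linarith
  have hb0 : b ≠ 0 := by rintro rfl; simp at hpos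
  have hdn : ‖(dd κ : ℂ)‖ = dd κ := by rw [Complex.norm_real, Real.norm_of_nonneg (by linarith)]
  have hbn1 : 0.9 ≤ ‖b‖ := by have := re_le_norm b; linarith
  have hbn2 : ‖b‖ ≤ dd κ + 0.1 := by
    calc ‖b‖ = ‖(b - dd κ) + dd κ‖ := by ring_nf
      _ ≤ _ := (norm_add_le _ _).trans (by rw [hdn]; linarith)
  have hb2 : ‖b - 2 * dd κ‖ ≤ dd κ + 0.1 := by
    calc ‖b - 2 * dd κ‖ = ‖(b - dd κ) - dd κ‖ := by ring_nf
      _ ≤ _ := (norm_sub_le _ _).trans (by rw [hdn]; linarith)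
  have hre2 : 0.9 ≤ (2 * (dd κ : ℂ) - b).re := by simp; linarith
  refine ⟨⟨?_, ?_⟩, hb0, hpos⟩
  · rw [log_im]; exact (abs_arg_le_pi b).trans (by linarith [Real.pi_lt_d2])
  · rw [exp_log hb0]
    refine ⟨⟨by linarith, by linarith, by linarith⟩, ⟨?_, ?_, ?_⟩, by linarith⟩
    · rw [show 2 * (dd κ : ℂ) - b - 2 * dd κ = - b by ring, norm_neg]; linarith
    · have := re_le_norm (2 * (dd κ : ℂ) - b); linarith
    · rw [norm_sub_rev]; linarith

theorem theta {κ : ℕ} (hκ : κ = 0 ∨ κ = 1) : ∃ v1 ≥ 10, ∃ Θ : ℂ × ℂ → ℂ, ContinuousOn Θ (Ds v1 ×ˢ Ls κ) ∧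
    (∀ v ∈ Ds v1, ∀ l ∈ Ls κ, ‖Θ (v, l)‖ ≤ 0.02 * ‖v‖) ∧
    (∀ v ∈ Ds v1, ∀ l ∈ Ls κ, F κ (pp κ v l).1 (pp κ v l).2 = 0 → ∃ n : ℤ, v ^ 6 = 3 * Real.pi * n + Θ (v, l)) ∧
    (∀ v l, Θ (v, l + 2 * Real.pi * I) = Θ (v, l) + 3 * Real.pi) ∧
    DifferentiableOn ℂ (fun v => Θ (v, log (dd κ))) (Ds v1) := by
  obtain ⟨c0, hc0, C, hC, h, hcont, H⟩ := asymp hκ (by norm_num : (0:ℝ) < 1 / 1000) le_rfl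
  have hd1 := dd_pos κ
  have hd3 : dd κ ≤ 3 := by rcases dd_cases hκ with h | h <;> rw [h] <;> norm_num
  obtain ⟨s0, hs0⟩ : ∃ s0 : ℝ, ∀ s ≥ s0, Real.log s ≤ (0.003 / C) * s := by
    have := (Real.isLittleO_log_id_atTop).bound (by positivity : 0 < 0.003 / C)
    obtain ⟨s0, h0⟩ := (this.and (eventually_ge_atTop 0)).exists_forall_of_atTop
    refine ⟨s0, fun s hs => ?_⟩
    obtain ⟨h1, h2⟩ := h0 s hs
    rw [id, Real.norm_of_nonneg h2] at h1
    exact (le_abs_self _).trans h1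
  set v1 := max c0 (max s0 10000) with hv1
  have hsub : ∀ v ∈ Ds v1, v ∈ Ds c0 := fun v hv => ⟨(le_max_left _ _).trans_lt hv.1, hv.2⟩
  let Θ : ℂ × ℂ → ℂ := fun q => (3 / (2 * I)) * (q.2 - log (2 * dd κ - exp q.2) + h (w12 * q.1, exp q.2)
    - h (w12⁻¹ * q.1, 2 * dd κ - exp q.2) + I * Real.pi * (4 * κ - 8) / 6)
  refine ⟨v1, ?_, Θ, ?_, ?_, ?_, ?_, ?_⟩
  · exact le_trans hc0 (le_max_left _ _)
  · refine ContinuousOn.mul continuousOn_const ?_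
    refine ContinuousOn.add (ContinuousOn.sub (ContinuousOn.add (ContinuousOn.sub continuousOn_snd ?_) ?_) ?_) continuousOn_const
    · refine ContinuousOn.clog (by fun_prop) fun q hq => Or.inl hq.2.2.2.2
    · exact hcont.comp (f := fun q : ℂ × ℂ => (w12 * q.1, exp q.2)) (by fun_prop)
        fun q hq => ⟨w12_mem (hsub _ hq.1), hq.2.2.1⟩
    · exact hcont.comp (f := fun q : ℂ × ℂ => (w12⁻¹ * q.1, 2 * dd κ - exp q.2)) (by fun_prop)
        fun q hq => ⟨w12_mem' (hsub _ hq.1), hq.2.2.2.1⟩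
  · intro v hv l hl
    have hb1 := hl.2.1
    have hb2 := hl.2.2.1
    have e1 := (H _ (w12_mem (hsub _ hv)) _ hb1).2
    have e2 := (H _ (w12_mem' (hsub _ hv)) _ hb2).2
    rw [norm_mul, w12_norm, one_mul] at e1
    rw [norm_mul, norm_inv, w12_norm, inv_one, one_mul] at e2
    have hvs : s0 < ‖v‖ := lt_of_le_of_lt ((le_max_left _ _).trans (le_max_right _ _)) hv.1
    have hv4 : 10000 < ‖v‖ := lt_of_le_of_lt ((le_max_right _ _).trans (le_max_right _ _)) hv.1
    have e3 : C * Real.log ‖v‖ ≤ 0.003 * ‖v‖ := by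
      calc _ ≤ C * (0.003 / C * ‖v‖) := by gcongr; exact hs0 _ hvs.le
        _ = _ := by field_simp
    have e4 : ‖l‖ ≤ 14 := by
      refine (norm_le_abs_re_add_abs_im l).trans ?_
      have := log_bd hb1.2.1 (hb1.2.2.trans (by linarith))
      rw [Complex.norm_exp, Real.log_exp] at this
      linarith [hl.1]
    have e5 : ‖log (2 * dd κ - exp l)‖ ≤ 11 := by
      refine (norm_le_abs_re_add_abs_im _).trans ?_
      have := log_bd hb2.2.1 (hb2.2.2.trans (by linarith))
      rw [log_re, log_im]
      linarith [abs_arg_le_pi (2 * dd κ - exp l), Real.pi_lt_d2]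
    have e6 : ‖I * (Real.pi:ℂ) * (4 * κ - 8) / 6‖ ≤ 6 := by
      have hp := Real.pi_lt_d2
      have hp0 := Real.pi_pos
      rw [norm_div, norm_mul, norm_mul, norm_I, Complex.norm_real, Real.norm_of_nonneg hp0.le]
      rcases hκ with rfl | rfl <;> norm_num <;> linarith
    show ‖(3 / (2 * I)) * _‖ ≤ _
    rw [norm_mul, norm_div, norm_mul, norm_I]
    norm_num
    have := norm_add_le (l - log (2 * dd κ - exp l) + h (w12 * v, exp l)
      - h (w12⁻¹ * v, 2 * dd κ - exp l)) (I * Real.pi * (4 * κ - 8) / 6)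
    have := norm_sub_le (l - log (2 * dd κ - exp l) + h (w12 * v, exp l)) (h (w12⁻¹ * v, 2 * dd κ - exp l))
    have := norm_add_le (l - log (2 * dd κ - exp l)) (h (w12 * v, exp l))
    have := norm_sub_le (l) (log (2 * dd κ - exp l))
    linarith
  · intro v hv l hl hF
    have key := (conn_ratio hκ hF).2
    obtain ⟨p1, p2, p3, p4⟩ := pp_1 κ v l
    rw [p1, p2, p3, p4, (H _ (w12_mem (hsub _ hv)) _ hl.2.1).1, (H _ (w12_mem' (hsub _ hv)) _ hl.2.2.1).1,
      mul_pow, mul_pow, inv_pow, w12_six, inv_I] at key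
    have hb2 : 2 * (dd κ : ℂ) - exp l ≠ 0 := by
      intro h0; have := hl.2.2.2; rw [h0] at this; simp at this
    have hz : ∀ n : ℕ, z6 ^ n = exp (n * (Real.pi * I / 6)) := fun n => by rw [Complex.exp_nat_mul]; rfl
    have hlog := exp_log hb2
    rw [hz, hz] at key
    show ∃ n : ℤ, v ^ 6 = 3 * Real.pi * n + (3 / (2 * I)) * (l - log (2 * dd κ - exp l) + h (w12 * v, exp l)
      - h (w12⁻¹ * v, 2 * dd κ - exp l) + I * Real.pi * (4 * κ - 8) / 6)
    generalize h (w12 * v, exp l) = h1 at *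
    generalize h (w12⁻¹ * v, 2 * dd κ - exp l) = h2 at *
    generalize log (2 * dd κ - exp l) = L at *
    rw [← hlog] at key
    simp only [← Complex.exp_add] at key
    obtain ⟨n, hn⟩ := Complex.exp_eq_exp_iff_exists_int.1 key
    refine ⟨-n, ?_⟩
    push_cast at hn ⊢
    field_simp
    linear_combination -18 * hn
  · intro v l
    show (3 / (2 * I)) * _ = (3 / (2 * I)) * _ + _
    simp only [Complex.exp_add, Complex.exp_two_pi_mul_I, mul_one]
    field_simp
    ring
  · intro v hv
    have hD := (Ls_logd κ (b := dd κ) (by simp; norm_num)).1.2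
    have hd0 : (dd κ : ℂ) ≠ 0 := (Ls_logd κ (b := dd κ) (by simp; norm_num)).2.1
    have he : exp (log (dd κ : ℂ)) = dd κ := exp_log hd0
    rw [he] at hD
    have aux : ∀ w : ℂ, (∀ v ∈ Ds v1, w * v ∈ Dc c0) → DifferentiableAt ℂ (fun v => h (w * v, dd κ)) v := by
      intro w hw
      refine cont_log ?_ ?_
      · have : ContinuousOn (fun v => h (w * v, dd κ)) (Ds v1) :=
          hcont.comp (f := fun v : ℂ => (w * v, (dd κ : ℂ))) (by fun_prop) fun q hq => ⟨hw _ hq, hD.1⟩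
        exact this.continuousAt ((Ds_open v1).mem_nhds hv)
      · have hd : DifferentiableAt ℂ (fun v => F κ ((w * v) ^ 4) (0 * (w * v) ^ 2) * exp ((w * v) ^ 6 / 3) / dd κ) v := by
          have hF : DifferentiableAt ℂ (fun v => F κ ((w * v) ^ 4) (0 * (w * v) ^ 2)) v :=
            (F_differentiable hκ).differentiableAt.comp v (f := fun v : ℂ => ((w * v) ^ 4, 0 * (w * v) ^ 2)) (by fun_prop)
          exact (hF.mul (by fun_prop)).div_const _
        refine hd.congr_of_eventuallyEq ?_
        filter_upwards [(Ds_open v1).mem_nhds hv] with z hz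
        have := (H _ (hw z hz) _ hD.1).1
        rw [sub_self] at this
        rw [this]
        have e : exp (-(w * z) ^ 6 / 3) * exp ((w * z) ^ 6 / 3) = 1 := by
          rw [← Complex.exp_add]; ring_nf; simp
        rw [eq_div_iff hd0]
        linear_combination (-exp (h (w * z, dd κ)) * dd κ) * e
    refine DifferentiableAt.differentiableWithinAt ?_
    show DifferentiableAt ℂ (fun v => (3 / (2 * I)) * (log (dd κ) - log (2 * dd κ - exp (log (dd κ))) + h (w12 * v, exp (log (dd κ)))
      - h (w12⁻¹ * v, 2 * dd κ - exp (log (dd κ))) + I * Real.pi * (4 * κ - 8) / 6)) v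
    rw [he, show 2 * (dd κ : ℂ) - dd κ = dd κ by ring]
    exact ((((differentiableAt_const _).add (aux w12 fun v hv => w12_mem (hsub _ hv))).sub
      (aux w12⁻¹ fun v hv => w12_mem' (hsub _ hv))).add_const _).const_mul _
end EQ

namespace EQ
open Metric Set MeasureTheory Topology

lemma hurwitz {X : Type*} [TopologicalSpace X] {Φ : X → ℂ → ℂ} (hc : Continuous fun q : X × ℂ => Φ q.1 q.2)
    (hd : ∀ x, Differentiable ℂ (Φ x)) {x0 : X} {v0 : ℂ} (h0 : Φ x0 v0 = 0) (hne : ∃ v, Φ x0 v ≠ 0)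
    {ε : ℝ} (hε : 0 < ε) : ∀ᶠ x in 𝓝 x0, ∃ v, ‖v - v0‖ < ε ∧ Φ x v = 0 := by
  have hev : ∀ᶠ z in 𝓝[≠] v0, Φ x0 z ≠ 0 := by
    rcases ((hd x0).analyticAt v0).eventually_eq_zero_or_eventually_ne_zero with h | h
    · exfalso
      obtain ⟨v, hv⟩ := hne
      have ha : AnalyticOnNhd ℂ (Φ x0) univ := fun z _ => (hd x0).analyticAt z
      have := ha.eqOn_zero_of_preconnected_of_eventuallyEq_zero isPreconnected_univ (mem_univ v0) h
      exact hv (this (mem_univ v))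
    · exact h
  obtain ⟨ρ, hρ, hball⟩ := Metric.mem_nhdsWithin_iff.1 hev
  obtain ⟨r, hr, hrρ, hrε⟩ : ∃ r > 0, r < ρ ∧ r < ε :=
    ⟨min ρ ε / 2, by positivity, by have := min_le_left ρ ε; have := lt_min hρ hε; linarith, by have := min_le_right ρ ε; have := lt_min hρ hε; linarith⟩
  have hs : ∀ z ∈ sphere v0 r, Φ x0 z ≠ 0 := by
    intro z hz
    refine hball ⟨?_, ?_⟩
    · rw [mem_sphere] at hz; rw [mem_ball]; linarith
    · rintro rfl; rw [mem_sphere, dist_self] at hz; linarith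
  have hcs : IsCompact (sphere v0 r) := isCompact_sphere v0 r
  have hcx : Continuous (Φ x0) := (hd x0).continuous
  obtain ⟨m, hm, hmin⟩ : ∃ m > 0, ∀ z ∈ sphere v0 r, m ≤ ‖Φ x0 z‖ := by
    have hn : (sphere v0 r).Nonempty := NormedSpace.sphere_nonempty.2 hr.le
    obtain ⟨z, hz, hzm⟩ := hcs.exists_isMinOn hn hcx.norm.continuousOn
    exact ⟨‖Φ x0 z‖, norm_pos_iff.2 (hs z hz), fun w hw => hzm hw⟩
  have e1 : ∀ᶠ x in 𝓝 x0, ∀ z ∈ sphere v0 r, m / 2 < ‖Φ x z - Φ x v0‖ := by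
    refine hcs.eventually_forall_of_forall_eventually fun z hz => ?_
    have hcc : Continuous fun q : X × ℂ => ‖Φ q.1 q.2 - Φ q.1 v0‖ := 
      (hc.sub (hc.comp (by fun_prop : Continuous fun q : X × ℂ => (q.1, v0)))).norm
    exact hcc.continuousAt.eventually (lt_mem_nhds (by simp only [h0, sub_zero]; have := hmin z hz; linarith))
  have e2 : ∀ᶠ x in 𝓝 x0, ‖Φ x v0‖ < m / 4 := by
    have hcc : Continuous fun x : X => ‖Φ x v0‖ := (hc.comp (by fun_prop : Continuous fun q : X => (q, v0))).norm
    exact hcc.continuousAt.eventually (gt_mem_nhds (by simp only [h0, norm_zero]; linarith))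
  filter_upwards [e1, e2] with x h1 h2
  have hfreq : ∃ᶠ z in 𝓝 v0, Φ x z ≠ Φ x v0 := by
    by_contra hcon
    rw [not_frequently] at hcon
    have ha : AnalyticOnNhd ℂ (fun z => Φ x z - Φ x v0) univ := fun z _ => ((hd x).sub_const _).analyticAt z
    have := ha.eqOn_zero_of_preconnected_of_eventuallyEq_zero isPreconnected_univ (mem_univ v0)
      (hcon.mono fun z hz => by simp only [not_not] at hz; simp [hz])
    obtain ⟨z, hz⟩ : (sphere v0 r).Nonempty := NormedSpace.sphere_nonempty.2 hr.le
    have h3 := h1 z hz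
    have h4 : Φ x z - Φ x v0 = 0 := this (mem_univ z)
    rw [h4, norm_zero] at h3; linarith
  have := DiffContOnCl.ball_subset_image_closedBall (f := Φ x) (z₀ := v0) (r := r) (ε := m / 2)
    (hd x).diffContOnCl hr (fun z hz => (h1 z hz).le) hfreq
  obtain ⟨v, hv, hv0⟩ := this (show (0:ℂ) ∈ _ by rw [mem_ball, dist_zero_left]; linarith)
  refine ⟨v, ?_, hv0⟩
  rw [mem_closedBall, dist_eq_norm] at hv; linarith

/-- the zero set -/
def Zk (κ : ℕ) : Set (ℂ × ℂ) := {p | F κ p.1 p.2 = 0}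

def ThOK (κ : ℕ) (v1 : ℝ) (Θ : ℂ × ℂ → ℂ) : Prop := 10 ≤ v1 ∧ ContinuousOn Θ (Ds v1 ×ˢ Ls κ) ∧
    (∀ v ∈ Ds v1, ∀ l ∈ Ls κ, ‖Θ (v, l)‖ ≤ 0.02 * ‖v‖) ∧
    (∀ v ∈ Ds v1, ∀ l ∈ Ls κ, F κ (pp κ v l).1 (pp κ v l).2 = 0 → ∃ n : ℤ, v ^ 6 = 3 * Real.pi * n + Θ (v, l)) ∧
    (∀ v l, Θ (v, l + 2 * Real.pi * I) = Θ (v, l) + 3 * Real.pi) ∧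
    DifferentiableOn ℂ (fun v => Θ (v, log (dd κ))) (Ds v1)

lemma pp_nonzero {κ : ℕ} (hκ : κ = 0 ∨ κ = 1) (l : ℂ) : ∃ v, F κ (pp κ v l).1 (pp κ v l).2 ≠ 0 := by
  by_contra hcon
  push Not at hcon
  unfold pp at hcon
  simp only at hcon
  obtain ⟨μ, hμ⟩ : ∃ μ, μ = -I * (dd κ - exp l) := ⟨_, rfl⟩
  rw [← hμ] at hcon
  have sq : ∀ u : ℂ, ∃ v : ℂ, v ^ 2 = u := fun u => IsAlgClosed.exists_pow_nat_eq u (by norm_num)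
  by_cases h0 : μ = 0
  · obtain ⟨v1, h1⟩ := sq I
    obtain ⟨v, hv⟩ := sq v1
    have := nr_real hκ (hcon v) (by simp [h0])
    have h4 : v ^ 4 = I := by rw [← h1, ← hv]; ring
    rw [h4] at this; simp at this
  · have key : ∀ u : ℂ, F κ (-(μ⁻¹ ^ 2) * u ^ 2) u = 0 := by
      intro u
      obtain ⟨v, hv⟩ := sq (μ⁻¹ * u)
      have := hcon v
      rw [show v ^ 4 = (v ^ 2) ^ 2 by ring, hv, show μ * (μ⁻¹ * u) = u by field_simp] at this
      rw [← this]; congr 1; ring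
    generalize -(μ⁻¹ ^ 2) = m at key
    have k1 := nr_real hκ (key 1) (by simp)
    have k2 := nr_pos hκ (key (1 + I)) (by simp)
    have k3 := nr_pos hκ (key (-1 + I)) (by simp)
    have e2 : (1 + I) ^ 2 = 2 * I := by linear_combination I_sq
    have e3 : (-1 + I) ^ 2 = -2 * I := by linear_combination I_sq
    rw [e2] at k2; rw [e3] at k3
    simp at k1 k2 k3
    linarith

lemma F_cont {κ : ℕ} (hκ : κ = 0 ∨ κ = 1) : Continuous fun p : ℂ × ℂ => F κ p.1 p.2 := (F_differentiable hκ).continuous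

lemma pp_cont (κ : ℕ) : Continuous fun q : ℂ × ℂ => pp κ q.2 q.1 := by unfold pp; fun_prop

lemma lab_big {κ : ℕ} {v1 : ℝ} {Θ : ℂ × ℂ → ℂ} (hT : ThOK κ v1 Θ) : ∃ n0 : ℤ, ∀ n ≥ n0, ∀ v ∈ Ds v1, ∀ l ∈ Ls κ,
    v ^ 6 = 3 * Real.pi * n + Θ (v, l) → v1 + 1 ≤ ‖v‖ ∧ ‖v‖ ≤ 6 * Real.pi * n ∧ |v.im| ≤ 0.005 * v.re := by
  obtain ⟨n0, hn0⟩ := exists_int_gt (2 * (v1 + 1) ^ 6)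
  have h10 := hT.1
  refine ⟨n0, fun n hn v hv l hl h => ?_⟩
  have hnn : (2 * (v1 + 1) ^ 6) < (n:ℝ) := hn0.trans_le (by exact_mod_cast hn)
  have hb := hT.2.2.1 v hv l hl
  have hp := Real.pi_gt_three
  have hn0 : (0:ℝ) < n := lt_trans (by positivity) hnn
  have hv10 : 10 < ‖v‖ := h10.trans_lt hv.1
  have e1 : ‖v‖ ^ 6 ≤ 3 * Real.pi * n + 0.02 * ‖v‖ := by
    rw [← norm_pow, h]
    refine (norm_add_le _ _).trans (add_le_add (le_of_eq ?_) hb)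
    rw [show (3 * (Real.pi : ℂ) * n) = ((3 * Real.pi * n : ℝ) : ℂ) by push_cast; ring, Complex.norm_real, Real.norm_of_nonneg (by positivity)]
  have e2 : 3 * Real.pi * n ≤ ‖v‖ ^ 6 + 0.02 * ‖v‖ := by
    have : ((3 * Real.pi * n : ℝ) : ℂ) = v ^ 6 - Θ (v, l) := by rw [h]; push_cast; ring
    have h2 := norm_sub_le (v ^ 6) (Θ (v, l))
    rw [← this, Complex.norm_real, Real.norm_of_nonneg (by positivity), norm_pow] at h2
    linarith
  have e3 : ‖v‖ ≤ ‖v‖ ^ 6 := by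
    calc ‖v‖ = ‖v‖ ^ 1 := by ring
      _ ≤ ‖v‖ ^ 6 := pow_le_pow_right₀ (by linarith) (by norm_num)
  refine ⟨?_, by nlinarith, ?_⟩
  · by_contra hcon
    push Not at hcon
    have : ‖v‖ ^ 6 ≤ (v1 + 1) ^ 6 := by gcongr
    nlinarith
  · have e4 := (Ds_im6' hv.2.le).1
    have e5 : |(v ^ 6).im| ≤ 0.02 * ‖v‖ := by
      rw [h, show (3 * (Real.pi : ℂ) * n) = ((3 * Real.pi * n : ℝ) : ℂ) by push_cast; ring, add_im, ofReal_im, zero_add]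
      exact (abs_im_le_norm _).trans hb
    have hx := norm_le_abs_re_add_abs_im v
    have hxp : 0 ≤ v.re := by have := abs_nonneg v.im; linarith [hv.2]
    rw [abs_of_nonneg hxp] at hx
    have hx1 : 9 ≤ v.re := by linarith [hv.2]
    have e6 : 5 * |v.im| * v.re ^ 5 ≤ 0.0202 * v.re := by linarith [hv.2]
    have e7 : |v.im| * v.re ^ 5 ≥ |v.im| * v.re := by
      have : v.re ^ 1 ≤ v.re ^ 5 := pow_le_pow_right₀ (by linarith) (by norm_num)
      rw [pow_one] at this
      gcongr
    have e8 : |v.im| * v.re ≤ 0.005 * v.re := by linarith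
    have e9 := le_of_mul_le_mul_right e8 (by linarith)
    linarith

/-- point of `A` with label `n` over `l` -/
def Lab (κ : ℕ) (v1 : ℝ) (Θ : ℂ × ℂ → ℂ) (A : Set (ℂ × ℂ)) (n : ℤ) (l : ℂ) : Prop :=
  ∃ v ∈ Ds v1, v ^ 6 = 3 * Real.pi * n + Θ (v, l) ∧ pp κ v l ∈ A

set_option maxHeartbeats 800000 in
lemma lab_path {κ : ℕ} (hκ : κ = 0 ∨ κ = 1) {v1 : ℝ} {Θ : ℂ × ℂ → ℂ} (hT : ThOK κ v1 Θ) {n : ℤ}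
    (hn : ∀ v ∈ Ds v1, ∀ l ∈ Ls κ,
    v ^ 6 = 3 * Real.pi * n + Θ (v, l) → v1 + 1 ≤ ‖v‖ ∧ ‖v‖ ≤ 6 * Real.pi * n ∧ |v.im| ≤ 0.005 * v.re)
    {A B : Set (ℂ × ℂ)} (hA : IsClosed A) (hB : IsClosed B) (hAB : A ∪ B = Zk κ) (hdis : Disjoint A B)
    {γ : unitInterval → ℂ} (hγ : Continuous γ) (hγL : ∀ t, γ t ∈ Ls κ) (h0 : Lab κ v1 Θ A n (γ 0)) :
    Lab κ v1 Θ A n (γ 1) := by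
  have hAZ : A ⊆ Zk κ := hAB ▸ subset_union_left
  have hpc : Continuous fun q : unitInterval × ℂ => pp κ q.2 (γ q.1) := by unfold pp; fun_prop
  have hclosed : IsClosed {t | Lab κ v1 Θ A n (γ t)} := by
    let K : Set ℂ := {v | v1 + 1 ≤ ‖v‖ ∧ ‖v‖ ≤ 6 * Real.pi * n ∧ |v.im| ≤ 0.005 * v.re}
    have hK : IsCompact K := by
      refine (isCompact_closedBall (0:ℂ) (6 * Real.pi * n)).of_isClosed_subset ?_ ?_
      · exact (isClosed_le continuous_const continuous_norm).inter ((isClosed_le continuous_norm continuous_const).inter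
          (isClosed_le continuous_im.abs (continuous_const.mul continuous_re)))
      · intro v hv; rw [mem_closedBall_zero_iff]; exact hv.2.1
    have hKD : K ⊆ Ds v1 := by
      intro v hv
      have h10 := hT.1
      have h1 := hv.1
      refine ⟨by linarith, ?_⟩
      have := norm_le_abs_re_add_abs_im v
      have h3 := hv.2.2
      have hxp : 0 ≤ v.re := by have := abs_nonneg v.im; linarith
      rw [abs_of_nonneg hxp] at this
      linarith
    have hKu : IsCompact ((univ : Set unitInterval) ×ˢ K) := isCompact_univ.prod hK
    have hcont : ContinuousOn (fun q : unitInterval × ℂ => q.2 ^ 6 - Θ (q.2, γ q.1)) (univ ×ˢ K) := by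
      refine ContinuousOn.sub (by fun_prop) ?_
      exact hT.2.1.comp (f := fun q : unitInterval × ℂ => (q.2, γ q.1)) (by fun_prop) fun q hq => ⟨hKD hq.2, hγL _⟩
    have hS : IsCompact (((univ : Set unitInterval) ×ˢ K) ∩ ((fun q : unitInterval × ℂ => q.2 ^ 6 - Θ (q.2, γ q.1)) ⁻¹' {3 * Real.pi * (n:ℂ)})) :=
      hKu.of_isClosed_subset (hcont.preimage_isClosed_of_isClosed hKu.isClosed isClosed_singleton) inter_subset_left
    have hS2 := hS.inter_right (hA.preimage (f := fun q : unitInterval × ℂ => pp κ q.2 (γ q.1))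
      hpc)
    have hcl := (hS2.image continuous_fst).isClosed
    refine isClosed_of_closure_subset ?_
    refine (closure_minimal ?_ hcl).trans ?_
    rotate_left
    rotate_left
    · rintro t ⟨v, hv, h1, h2⟩
      exact ⟨(t, v), ⟨⟨⟨mem_univ _, hn v hv _ (hγL t) h1⟩, by simp only [mem_preimage, mem_singleton_iff, h1]; ring⟩, h2⟩, rfl⟩
    · rintro _ ⟨⟨t', v⟩, ⟨⟨⟨_, hv⟩, h1⟩, h2⟩, rfl⟩
      simp only [mem_preimage, mem_singleton_iff] at h1
      exact ⟨v, hKD hv, by rw [← h1]; ring, h2⟩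
  have hopen : IsOpen {t | Lab κ v1 Θ A n (γ t)} := by
    rw [isOpen_iff_mem_nhds]
    rintro t0 ⟨v, hv, h1, h2⟩
    have hcF : Continuous fun q : unitInterval × ℂ => F κ (pp κ q.2 (γ q.1)).1 (pp κ q.2 (γ q.1)).2 :=
      (F_cont hκ).comp hpc
    have hdF : ∀ t, Differentiable ℂ (fun v => F κ (pp κ v (γ t)).1 (pp κ v (γ t)).2) := fun t =>
      (F_differentiable hκ).comp (by unfold pp; fun_prop : Differentiable ℂ fun v => pp κ v (γ t))
    have hnB : pp κ v (γ t0) ∉ B := fun hb => (disjoint_left.1 hdis) h2 hb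
    have hcp : ContinuousAt (fun q : unitInterval × ℂ => pp κ q.2 (γ q.1)) (t0, v) :=
      hpc.continuousAt
    have ev1 : ∀ᶠ q in 𝓝 (t0, v), pp κ q.2 (γ q.1) ∉ B := hcp.eventually (hB.isOpen_compl.mem_nhds hnB)
    have ev2 : ∀ᶠ q in 𝓝 (t0, v), q.2 ∈ Ds v1 := continuousAt_snd.eventually ((Ds_open v1).mem_nhds hv)
    have ev3 : ∀ᶠ q : unitInterval × ℂ in 𝓝 (t0, v), ‖q.2 ^ 6 - Θ (q.2, γ q.1) - 3 * Real.pi * n‖ < 1 := by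
      have hc : ContinuousOn (fun q : unitInterval × ℂ => ‖q.2 ^ 6 - Θ (q.2, γ q.1) - 3 * Real.pi * n‖) (univ ×ˢ Ds v1) := by
        refine ContinuousOn.norm (ContinuousOn.sub (ContinuousOn.sub (by fun_prop) ?_) (by fun_prop))
        exact hT.2.1.comp (f := fun q : unitInterval × ℂ => (q.2, γ q.1)) (by fun_prop) fun q hq => ⟨hq.2, hγL _⟩
      have hca := hc.continuousAt (x := (t0, v)) ((isOpen_univ.prod (Ds_open v1)).mem_nhds ⟨mem_univ _, hv⟩)
      refine hca.eventually (gt_mem_nhds ?_)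
      simp only [h1]
      rw [show 3 * (Real.pi:ℂ) * n + Θ (v, γ t0) - Θ (v, γ t0) - 3 * Real.pi * n = 0 by ring, norm_zero]; norm_num
    obtain ⟨U, hU, V, hV, hUV⟩ := mem_nhds_prod_iff.1 ((ev1.and ev2).and ev3)
    obtain ⟨ε, hε, hεV⟩ := Metric.mem_nhds_iff.1 hV
    have hh := hurwitz hcF hdF (x0 := t0) (v0 := v) (hAZ h2) (pp_nonzero hκ _) hε
    filter_upwards [hh, hU] with t ht htU
    obtain ⟨v', hv', hF⟩ := ht
    have hV' : v' ∈ V := hεV (by rw [mem_ball, dist_eq_norm]; exact hv')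
    obtain ⟨⟨q1, q2⟩, q3⟩ := hUV (show (t, v') ∈ U ×ˢ V from ⟨htU, hV'⟩)
    simp only at q1 q2 q3
    obtain ⟨m, hm⟩ := hT.2.2.2.1 v' q2 _ (hγL t) hF
    have hpA : pp κ v' (γ t) ∈ A := by
      have : pp κ v' (γ t) ∈ A ∪ B := by rw [hAB]; exact hF
      exact this.resolve_right q1
    have hmn : m = n := by
      rw [hm, show 3 * (Real.pi:ℂ) * m + Θ (v', γ t) - Θ (v', γ t) - 3 * Real.pi * n = ((3 * Real.pi * ((m - n : ℤ) : ℝ) : ℝ) : ℂ) by push_cast; ring,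
        Complex.norm_real, norm_mul, Real.norm_of_nonneg (by positivity)] at q3
      by_contra hne
      have h1 : 1 ≤ |m - n| := Int.one_le_abs (sub_ne_zero.2 hne)
      have h2 : (1:ℝ) ≤ ‖((m - n : ℤ) : ℝ)‖ := by rw [Real.norm_eq_abs]; exact_mod_cast h1
      have := Real.pi_gt_three
      nlinarith
    exact ⟨v', q2, hmn ▸ hm, hpA⟩
  have huniv : {t | Lab κ v1 Θ A n (γ t)} = univ := IsClopen.eq_univ ⟨hclosed, hopen⟩ ⟨0, h0⟩
  have : (1 : unitInterval) ∈ {t | Lab κ v1 Θ A n (γ t)} := by rw [huniv]; trivial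
  exact this

end EQ

namespace EQ
open Metric Set MeasureTheory Topology

lemma logd_eq (κ : ℕ) : log (dd κ : ℂ) = (Real.log (dd κ) : ℂ) := by
  rw [Complex.ofReal_log (by linarith [dd_pos κ])]

lemma Bs_real {κ : ℕ} {b : ℝ} (h1 : 1 / 1000 ≤ b) (h2 : b ≤ dd κ) : (b : ℂ) ∈ Bs κ := by
  have hd1 := dd_pos κ
  have e0 : 2 * (dd κ : ℂ) - b = ((2 * dd κ - b : ℝ) : ℂ) := by push_cast; ring
  refine ⟨⟨?_, ?_, ?_⟩, ⟨?_, ?_, ?_⟩, ?_⟩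
  · rw [norm_sub_rev, e0, Complex.norm_real, Real.norm_of_nonneg (by linarith)]; linarith
  · rw [Complex.norm_real, Real.norm_of_nonneg (by linarith)]; linarith
  · rw [Complex.norm_real, Real.norm_of_nonneg (by linarith)]; linarith
  · rw [show 2 * (dd κ : ℂ) - b - 2 * dd κ = - b by ring, norm_neg, Complex.norm_real, Real.norm_of_nonneg (by linarith)]; linarith
  · rw [e0, Complex.norm_real, Real.norm_of_nonneg (by linarith)]; linarith
  · rw [e0, Complex.norm_real, Real.norm_of_nonneg (by linarith)]; linarith
  · rw [e0, ofReal_re]; linarith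

lemma Bs_circ {κ : ℕ} {b : ℂ} (h1 : ‖b‖ = 1 / 1000) : b ∈ Bs κ := by
  have hd1 := dd_pos κ
  have hdn : ‖2 * (dd κ : ℂ)‖ = 2 * dd κ := by
    rw [norm_mul, Complex.norm_real, Real.norm_of_nonneg (by linarith)]; norm_num
  have hre := (abs_re_le_norm b)
  rw [abs_le] at hre
  have e1 : 1 ≤ (2 * (dd κ : ℂ) - b).re := by simp; linarith
  refine ⟨⟨?_, ?_, ?_⟩, ⟨?_, ?_, ?_⟩, ?_⟩
  · exact (norm_sub_le _ _).trans (by rw [hdn, h1]; linarith)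
  · linarith
  · linarith
  · rw [show 2 * (dd κ : ℂ) - b - 2 * dd κ = - b by ring, norm_neg]; linarith
  · have := re_le_norm (2 * (dd κ : ℂ) - b); linarith
  · exact (norm_sub_le _ _).trans (by rw [hdn, h1]; linarith)
  · linarith

lemma Ls_real {κ : ℕ} {r : ℝ} (h1 : Real.log (1 / 1000) ≤ r) (h2 : r ≤ Real.log (dd κ)) :
    (r : ℂ) ∈ Ls κ ∧ (r : ℂ) + 2 * Real.pi * I ∈ Ls κ := by
  have hd1 := dd_pos κ
  have hb : exp (r : ℂ) ∈ Bs κ := by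
    rw [← ofReal_exp]
    exact Bs_real ((Real.log_le_iff_le_exp (by norm_num)).1 h1) ((Real.le_log_iff_exp_le (by linarith)).1 h2)
  have hp := Real.pi_lt_d2
  have hp0 := Real.pi_pos
  refine ⟨⟨by simp, hb⟩, ⟨?_, ?_⟩⟩
  · simp [abs_of_pos hp0]; linarith
  · rw [Complex.exp_add, Complex.exp_two_pi_mul_I, mul_one]; exact hb

lemma Ls_circ {κ : ℕ} {s : ℝ} (h0 : 0 ≤ s) (h1 : s ≤ 1) : (Real.log (1 / 1000) : ℂ) + s * (2 * Real.pi * I) ∈ Ls κ := by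
  have hp := Real.pi_lt_d2
  have hp0 := Real.pi_pos
  refine ⟨?_, Bs_circ ?_⟩
  · have : ((Real.log (1 / 1000) : ℂ) + s * (2 * Real.pi * I)).im = s * (2 * Real.pi) := by simp [-one_div]
    rw [this, abs_of_nonneg (by positivity)]; nlinarith
  · have : ((Real.log (1 / 1000) : ℂ) + s * (2 * Real.pi * I)).re = Real.log (1 / 1000) := by simp [-one_div]
    rw [Complex.norm_exp, this, Real.exp_log (by norm_num)]

lemma lab_shift {κ : ℕ} (hκ : κ = 0 ∨ κ = 1) {v1 : ℝ} {Θ : ℂ × ℂ → ℂ} (hT : ThOK κ v1 Θ) {n : ℤ}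
    (hn : ∀ v ∈ Ds v1, ∀ l ∈ Ls κ,
    v ^ 6 = 3 * Real.pi * n + Θ (v, l) → v1 + 1 ≤ ‖v‖ ∧ ‖v‖ ≤ 6 * Real.pi * n ∧ |v.im| ≤ 0.005 * v.re)
    {A B : Set (ℂ × ℂ)} (hA : IsClosed A) (hB : IsClosed B) (hAB : A ∪ B = Zk κ) (hdis : Disjoint A B)
    (h0 : Lab κ v1 Θ A n (log (dd κ))) : Lab κ v1 Θ A (n + 1) (log (dd κ)) := by
  have hd1 := dd_pos κ
  have hlog : Real.log (1 / 1000) ≤ Real.log (dd κ) := Real.log_le_log (by norm_num) (by linarith)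
  have path := @lab_path κ hκ v1 Θ hT n hn A B hA hB hAB hdis
  rw [logd_eq] at h0 ⊢
  have hseg : ∀ t : unitInterval, Real.log (1 / 1000) ≤ (1 - t) * Real.log (dd κ) + t * Real.log (1 / 1000) ∧
      (1 - t) * Real.log (dd κ) + t * Real.log (1 / 1000) ≤ Real.log (dd κ) := by
    intro t
    have := t.2.1
    have := t.2.2
    constructor <;> nlinarith
  have hseg' : ∀ t : unitInterval, Real.log (1 / 1000) ≤ t * Real.log (dd κ) + (1 - t) * Real.log (1 / 1000) ∧
      t * Real.log (dd κ) + (1 - t) * Real.log (1 / 1000) ≤ Real.log (dd κ) := by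
    intro t
    have := t.2.1
    have := t.2.2
    constructor <;> nlinarith
  have p1 : Lab κ v1 Θ A n (Real.log (1 / 1000)) := by
    have := path (γ := fun t => (((1 - t) * Real.log (dd κ) + t * Real.log (1 / 1000) : ℝ) : ℂ))
      (by fun_prop) (fun t => (Ls_real (hseg t).1 (hseg t).2).1)
    simpa [-one_div, h0] using this
  have p2 : Lab κ v1 Θ A n (Real.log (1 / 1000) + 2 * Real.pi * I) := by
    have := path (γ := fun t => (Real.log (1 / 1000) : ℂ) + (t : ℝ) * (2 * Real.pi * I))
      (by fun_prop) (fun t => Ls_circ t.2.1 t.2.2)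
    simp only [Set.Icc.coe_zero, ofReal_zero, zero_mul, add_zero, Set.Icc.coe_one, ofReal_one, one_mul] at this
    exact this p1
  have p3 : Lab κ v1 Θ A n (Real.log (dd κ) + 2 * Real.pi * I) := by
    have := path (γ := fun t => ((t * Real.log (dd κ) + (1 - t) * Real.log (1 / 1000) : ℝ) : ℂ) + 2 * Real.pi * I)
      (by fun_prop) (fun t => (Ls_real (hseg' t).1 (hseg' t).2).2)
    simp only [Set.Icc.coe_zero, zero_mul, zero_add, Set.Icc.coe_one, one_mul, sub_zero, sub_self, add_zero] at this
    exact this p2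
  obtain ⟨v, hv, h1, h2⟩ := p3
  refine ⟨v, hv, ?_, ?_⟩
  · rw [h1, hT.2.2.2.2.1]; push_cast; ring
  · unfold pp at h2 ⊢
    rwa [Complex.exp_add, Complex.exp_two_pi_mul_I, mul_one] at h2

lemma lab_unique {κ : ℕ} (hκ : κ = 0 ∨ κ = 1) {v1 : ℝ} {Θ : ℂ × ℂ → ℂ} (hT : ThOK κ v1 Θ) {n : ℤ}
    (hn : ∀ v ∈ Ds v1, ∀ l ∈ Ls κ,
    v ^ 6 = 3 * Real.pi * n + Θ (v, l) → v1 + 1 ≤ ‖v‖ ∧ ‖v‖ ≤ 6 * Real.pi * n ∧ |v.im| ≤ 0.005 * v.re)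
    {A B : Set (ℂ × ℂ)} (hAB : A ∪ B = Zk κ) (hdis : Disjoint A B)
    (hA : Lab κ v1 Θ A n (log (dd κ))) (hB : Lab κ v1 Θ B n (log (dd κ))) : False := by
  have h10 := hT.1
  have hL : log (dd κ : ℂ) ∈ Ls κ := (Ls_logd κ (by simp; norm_num)).1
  have hd0 : (dd κ : ℂ) ≠ 0 := by exact_mod_cast (by linarith [dd_pos κ] : dd κ ≠ 0)
  have real : ∀ v ∈ Ds v1, v ^ 6 = 3 * Real.pi * n + Θ (v, log (dd κ)) → pp κ v (log (dd κ)) ∈ Zk κ → ∃ x : ℝ, v = x ∧ v1 + 1 ≤ x := by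
    intro v hv h1 h2
    have h3 := nr_real hκ h2 (by unfold pp; simp [exp_log hd0])
    have hx : 0 < v.re := by have := abs_nonneg v.im; linarith [hv.2]
    have hy : v.im = 0 := by
      have : (v ^ 4).im = v.im * (4 * v.re * (v.re ^ 2 - v.im ^ 2)) := by
        simp only [pow_succ, pow_zero, one_mul, mul_im, mul_re]; ring
      unfold pp at h3
      simp only [neg_im, neg_eq_zero] at h3
      rw [this] at h3
      refine (mul_eq_zero.1 h3).resolve_right ?_
      have : v.im ^ 2 < v.re ^ 2 := by rw [sq_lt_sq, abs_of_pos hx]; linarith [hv.2]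
      have : 0 < v.re ^ 2 - v.im ^ 2 := by linarith
      positivity
    have hvx : v = (v.re : ℂ) := by apply Complex.ext <;> simp [hy]
    refine ⟨v.re, hvx, ?_⟩
    have := (hn v hv _ hL h1).1
    rw [hvx, Complex.norm_real, Real.norm_of_nonneg hx.le] at this
    exact this
  have mono : StrictMonoOn (fun x : ℝ => (((x:ℂ)) ^ 6 - Θ (x, log (dd κ))).re) (Ici (v1 + 1)) := by
    have hder : ∀ x : ℝ, v1 + 1 ≤ x → ∃ f' : ℝ, 0 < f' ∧ HasDerivAt (fun x : ℝ => (((x:ℂ)) ^ 6 - Θ (x, log (dd κ))).re) f' x := by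
      intro x hx
      have hsub : closedBall (x:ℂ) 0.05 ⊆ Ds v1 := by
        intro z hz
        rw [mem_closedBall, dist_eq_norm] at hz
        have hr := (abs_re_le_norm (z - x)).trans hz
        have hi := (abs_im_le_norm (z - x)).trans hz
        rw [sub_re, ofReal_re, abs_le] at hr
        rw [sub_im, ofReal_im, sub_zero] at hi
        refine ⟨?_, by linarith⟩
        have := re_le_norm z
        linarith
      have hxD : (x : ℂ) ∈ Ds v1 := hsub (by simp; norm_num)
      have hdx : DifferentiableAt ℂ (fun v => Θ (v, log (dd κ))) x :=
        hT.2.2.2.2.2.differentiableAt ((Ds_open v1).mem_nhds hxD)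
      have hcau : ‖deriv (fun v => Θ (v, log (dd κ))) x‖ ≤ (0.02 * (x + 0.05)) / 0.05 := by
        refine Complex.norm_deriv_le_of_forall_mem_sphere_norm_le (by norm_num) ?_ ?_
        · refine DifferentiableOn.diffContOnCl ?_
          rw [closure_ball _ (by norm_num)]
          exact hT.2.2.2.2.2.mono hsub
        · intro z hz
          refine (hT.2.2.1 z (hsub (sphere_subset_closedBall hz)) _ hL).trans ?_
          gcongr
          rw [mem_sphere, dist_eq_norm] at hz
          calc ‖z‖ = ‖(z - x) + x‖ := by ring_nf
            _ ≤ ‖z - x‖ + ‖(x:ℂ)‖ := norm_add_le _ _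
            _ = _ := by rw [hz, Complex.norm_real, Real.norm_of_nonneg (by linarith)]; ring
      have hD := ((hasDerivAt_pow 6 (x:ℂ)).sub hdx.hasDerivAt).real_of_complex
      refine ⟨_, ?_, hD⟩
      have h1 := (abs_re_le_norm (deriv (fun v => Θ (v, log (dd κ))) x)).trans hcau
      rw [abs_le] at h1
      have e : ((6:ℕ) * (x:ℂ) ^ (6 - 1)).re = 6 * x ^ 5 := by
        rw [show ((6:ℕ) * (x:ℂ) ^ (6 - 1)) = ((6 * x ^ 5 : ℝ) : ℂ) by push_cast; ring, ofReal_re]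
      rw [sub_re, e]
      have : x ^ 1 ≤ x ^ 5 := pow_le_pow_right₀ (by linarith) (by norm_num)
      rw [pow_one] at this
      have h2 := h1.2
      rw [le_div_iff₀ (by norm_num)] at h2
      linarith
    refine strictMonoOn_of_deriv_pos (convex_Ici _) ?_ ?_
    · intro x hx
      obtain ⟨f', _, h⟩ := hder x hx
      exact h.continuousAt.continuousWithinAt
    · intro x hx
      rw [interior_Ici] at hx
      obtain ⟨f', h1, h⟩ := hder x (le_of_lt hx)
      rw [h.deriv]; exact h1
  obtain ⟨v, hv, e1, e2⟩ := hA
  obtain ⟨v', hv', e1', e2'⟩ := hB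
  obtain ⟨x, rfl, hx⟩ := real v hv e1 (hAB ▸ Or.inl e2)
  obtain ⟨x', rfl, hx'⟩ := real v' hv' e1' (hAB ▸ Or.inr e2')
  have : x = x' := by
    refine mono.injOn hx hx' ?_
    simp only [e1, e1']
    simp
  subst this
  exact disjoint_left.1 hdis e2 e2'

def Bdd (A : Set (ℂ × ℂ)) : Prop := ∀ Λ : ℝ, ∃ R : ℝ, ∀ p ∈ A, ‖p.2‖ ≤ Λ → ‖p.1‖ ≤ R

lemma lab_exists {κ : ℕ} (hκ : κ = 0 ∨ κ = 1) {v1 : ℝ} {Θ : ℂ × ℂ → ℂ} (hT : ThOK κ v1 Θ) {n0 : ℤ}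
    (hn : ∀ n ≥ n0, ∀ v ∈ Ds v1, ∀ l ∈ Ls κ,
    v ^ 6 = 3 * Real.pi * n + Θ (v, l) → v1 + 1 ≤ ‖v‖ ∧ ‖v‖ ≤ 6 * Real.pi * n ∧ |v.im| ≤ 0.005 * v.re)
    {A B : Set (ℂ × ℂ)} (hA : IsClosed A) (hB : IsClosed B) (hAB : A ∪ B = Zk κ) (hdis : Disjoint A B)
    (hub : ¬ Bdd A) : ∃ n ≥ n0, Lab κ v1 Θ A n (log (dd κ)) := by
  unfold Bdd at hub
  push Not at hub
  obtain ⟨Λ, hΛ⟩ := hub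
  have h10 := hT.1
  obtain ⟨T, hT0⟩ : ∃ T : ℝ, T = 1 + v1 + 100 * |Λ| + 20 * |(n0:ℝ)| := ⟨_, rfl⟩
  have hTΛ := abs_nonneg Λ
  have hTn := abs_nonneg (n0 : ℝ)
  obtain ⟨⟨a, l⟩, hp, hl, ha⟩ := hΛ (T ^ 4)
  simp only at hl ha
  have hF : F κ a l = 0 := (hAB ▸ Or.inl hp : (a, l) ∈ Zk κ)
  have hpar := nr_par hκ hF
  have hlΛ : ‖l‖ ≤ |Λ| := hl.trans (le_abs_self _)
  have sq : ∀ u : ℂ, ∃ v : ℂ, v ^ 2 = u ∧ 0 ≤ v.re := fun u => by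
    obtain ⟨v, hv⟩ := IsAlgClosed.exists_pow_nat_eq u (n := 2) (by norm_num)
    rcases le_total 0 v.re with h | h
    · exact ⟨v, hv, h⟩
    · exact ⟨-v, by rw [neg_sq, hv], by simpa using h⟩
  obtain ⟨w, hw, hwr⟩ := sq (-a)
  obtain ⟨v, hv, hvr⟩ := sq w
  have hnw : ‖w‖ ^ 2 = ‖a‖ := by rw [← norm_pow, hw, norm_neg]
  have hnv : ‖v‖ ^ 2 = ‖w‖ := by rw [← norm_pow, hv]
  have hvT : T < ‖v‖ := by
    have : T ^ 4 < ‖v‖ ^ 4 := by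
      rw [show ‖v‖ ^ 4 = (‖v‖ ^ 2) ^ 2 by ring, hnv, hnw]; exact ha
    exact lt_of_pow_lt_pow_left₀ 4 (norm_nonneg _) this
  have hnsq : ∀ z : ℂ, ‖z‖ ^ 2 = z.re ^ 2 + z.im ^ 2 := fun z => by
    rw [← Complex.normSq_eq_norm_sq, normSq_apply]; ring
  have hwi : |w.im| ≤ |Λ| := by
    rw [← sq_le_sq]
    have e1 : a.re = w.im ^ 2 - w.re ^ 2 := by
      have : a = -w ^ 2 := by rw [hw]; ring
      rw [this]; simp [pow_two]
    have e2 := hnsq w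
    have e3 : ‖l‖ ^ 2 ≤ |Λ| ^ 2 := by gcongr
    rw [sq_abs] at e3
    linarith
  have hv1 : 2 * v.re * v.im = w.im := by rw [← hv, pow_two, mul_im]; ring
  have hv2 : v.re ^ 2 - v.im ^ 2 = w.re := by rw [← hv, pow_two v, mul_re]; ring
  have hv3 := hnsq v
  have hT1 : T ≤ ‖v‖ ^ 2 := by nlinarith
  have hvr0 : 0 < v.re := by
    rcases hvr.lt_or_eq with h | h
    · exact h
    · rw [← h] at hv2 hv3; nlinarith
  have hvim : |v.im| < 0.01 * v.re := by
    have e1 : 2 * v.re * |v.im| ≤ |Λ| := by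
      rw [← hv1, abs_mul, abs_mul, abs_of_pos hvr0] at hwi; simpa using hwi
    have e2 : 2 * v.re * |v.im| < 2 * v.re * (0.01 * v.re) := by nlinarith
    exact lt_of_mul_lt_mul_left e2 (by linarith)
  have hvD : v ∈ Ds v1 := ⟨by linarith, hvim⟩
  have hv0 : v ≠ 0 := by rintro rfl; simp at hvr0
  obtain ⟨μ, hμ⟩ : ∃ μ, μ = I * l / v ^ 2 := ⟨_, rfl⟩
  have hμn : ‖μ‖ ≤ 0.1 := by
    rw [hμ, norm_div, norm_mul, norm_I, one_mul, norm_pow, div_le_iff₀ (by nlinarith)]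
    linarith
  have hγ : ∀ t : unitInterval, ‖((dd κ : ℂ) - (1 - (t:ℝ)) * μ) - dd κ‖ ≤ 0.1 := by
    intro t
    rw [show ((dd κ : ℂ) - (1 - (t:ℝ)) * μ) - dd κ = -(((1 - t : ℝ) : ℂ) * μ) by push_cast; ring, norm_neg, norm_mul,
      Complex.norm_real, Real.norm_of_nonneg (by linarith [t.2.2])]
    have := t.2.1
    nlinarith [norm_nonneg μ, t.2.2]
  have hb := Ls_logd κ (b := dd κ - μ) (by simpa using hμn)
  have hpp : pp κ v (log (dd κ - μ)) = (a, l) := by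
    unfold pp
    rw [exp_log hb.2.1]
    refine Prod.ext ?_ ?_
    · show -v ^ 4 = a
      rw [show v ^ 4 = (v ^ 2) ^ 2 by ring, hv, hw, neg_neg]
    · show -I * (dd κ - (dd κ - μ)) * v ^ 2 = l
      rw [hμ]; field_simp; linear_combination (-l) * I_sq
  obtain ⟨n, hlab⟩ := hT.2.2.2.1 v hvD _ hb.1 (by rw [hpp]; exact hF)
  have hnn : n0 ≤ n := by
    by_contra hcon
    push Not at hcon
    have hc : (n : ℝ) ≤ |(n0 : ℝ)| := le_trans (by exact_mod_cast hcon.le) (le_abs_self _)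
    have hp := Real.pi_lt_d2
    have hp0 := Real.pi_pos
    have h1 : (v ^ 6).re ≤ 3 * Real.pi * n + 0.02 * ‖v‖ := by
      rw [hlab, show (3 * (Real.pi : ℂ) * n) = ((3 * Real.pi * n : ℝ) : ℂ) by push_cast; ring, add_re, ofReal_re]
      gcongr
      exact (re_le_norm _).trans (hT.2.2.1 v hvD _ hb.1)
    have h2 : (v ^ 6).re = v.re ^ 6 - 15 * v.re ^ 4 * v.im ^ 2 + 15 * v.re ^ 2 * v.im ^ 4 - v.im ^ 6 := by
      simp only [pow_succ, pow_zero, one_mul, mul_im, mul_re]; ring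
    have hy : v.im ^ 2 ≤ 0.0001 * v.re ^ 2 := by
      have : |v.im| ^ 2 ≤ (0.01 * v.re) ^ 2 := by gcongr
      rw [sq_abs] at this; linarith
    have h3 : v.re ^ 4 * v.im ^ 2 ≤ v.re ^ 4 * (0.0001 * v.re ^ 2) := by gcongr
    have h4 : v.im ^ 6 ≤ v.re ^ 6 * 0.001 := by
      have : (v.im ^ 2) ^ 3 ≤ (0.0001 * v.re ^ 2) ^ 3 := by gcongr
      have h6 : 0 ≤ v.re ^ 6 := by positivity
      nlinarith
    have h5 : 0 ≤ v.re ^ 2 * v.im ^ 4 := by positivity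
    have h6 : 0.9 * v.re ^ 6 ≤ (v ^ 6).re := by rw [h2]; nlinarith
    have hx := norm_le_abs_re_add_abs_im v
    rw [abs_of_pos hvr0] at hx
    have h7 : v.re ^ 1 ≤ v.re ^ 6 := pow_le_pow_right₀ (by linarith) (by norm_num)
    rw [pow_one] at h7
    have h8 : 3 * Real.pi * n ≤ 3 * Real.pi * |(n0:ℝ)| := by gcongr
    have h9 : 3 * Real.pi * |(n0:ℝ)| ≤ 9.45 * |(n0:ℝ)| := by gcongr; linarith
    linarith
  refine ⟨n, hnn, ?_⟩
  have := lab_path hκ hT (hn n hnn) hA hB hAB hdis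
    (γ := fun t => log ((dd κ : ℂ) - (1 - (t:ℝ)) * μ)) 
    (Continuous.clog (by fun_prop) fun t => Or.inl (Ls_logd κ (hγ t)).2.2) (fun t => (Ls_logd κ (hγ t)).1)
  simp only [Set.Icc.coe_zero, ofReal_zero, sub_zero, one_mul, Set.Icc.coe_one, ofReal_one, sub_self, zero_mul] at this
  exact this ⟨v, hvD, hlab, by rw [hpp]; exact hp⟩

theorem not_both {κ : ℕ} (hκ : κ = 0 ∨ κ = 1) {A B : Set (ℂ × ℂ)} (hA : IsClosed A) (hB : IsClosed B)
    (hAB : A ∪ B = Zk κ) (hdis : Disjoint A B) : Bdd A ∨ Bdd B := by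
  by_contra hcon
  push Not at hcon
  obtain ⟨v1, hv1, Θ, t1, t2, t3, t4, t5⟩ := theta hκ
  have hT : ThOK κ v1 Θ := ⟨hv1, t1, t2, t3, t4, t5⟩
  obtain ⟨n0, hn⟩ := lab_big hT
  obtain ⟨n, hn1, hLA⟩ := lab_exists hκ hT hn hA hB hAB hdis hcon.1
  obtain ⟨m, hm1, hLB⟩ := lab_exists hκ hT hn hB hA (by rw [union_comm]; exact hAB) hdis.symm hcon.2
  have upA : ∀ k : ℕ, Lab κ v1 Θ A (n + k) (log (dd κ)) := by
    intro k
    induction k with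
    | zero => simpa using hLA
    | succ k ih =>
      have := lab_shift hκ hT (hn (n + k) (by omega)) hA hB hAB hdis ih
      rw [show n + ((k + 1 : ℕ) : ℤ) = n + k + 1 by push_cast; ring]; exact this
  have upB : ∀ k : ℕ, Lab κ v1 Θ B (m + k) (log (dd κ)) := by
    intro k
    induction k with
    | zero => simpa using hLB
    | succ k ih =>
      have := lab_shift hκ hT (hn (m + k) (by omega)) hB hA (by rw [union_comm]; exact hAB) hdis.symm ih
      rw [show m + ((k + 1 : ℕ) : ℤ) = m + k + 1 by push_cast; ring]; exact this
  have hA' := upA (max n m - n).toNat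
  have hB' := upB (max n m - m).toNat
  rw [show n + ((max n m - n).toNat : ℤ) = max n m by omega] at hA'
  rw [show m + ((max n m - m).toNat : ℤ) = max n m by omega] at hB'
  exact lab_unique hκ hT (hn (max n m) (by omega)) hAB hdis hA' hB'

end EQ

namespace EQ
open Metric Set MeasureTheory Topology

/-- Global factorization of an entire function at a point. -/
lemma factor_at {f : ℂ → ℂ} (hf : Differentiable ℂ f) (a : ℂ) (hne : ∃ z, f z ≠ 0) :
    ∃ g : ℂ → ℂ, Differentiable ℂ g ∧ g a ≠ 0 ∧
      ∀ z, f z = (z - a) ^ (analyticOrderNatAt f a) * g z := by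
  obtain ⟨p, hp⟩ := hf.analyticAt a
  have hp0 : p ≠ 0 := by
    intro h
    have h1 := (hp.locally_zero_iff).2 h
    have h2 : AnalyticOnNhd ℂ f univ := fun z _ => hf.analyticAt z
    obtain ⟨z, hz⟩ := hne
    exact hz (h2.eqOn_zero_of_preconnected_of_eventuallyEq_zero isPreconnected_univ
      (mem_univ a) h1 (mem_univ z))
  have hgd : ∀ n : ℕ, Differentiable ℂ ((Function.swap dslope a)^[n] f) := by
    intro n
    induction n with
    | zero => exact hf
    | succ n ih =>
      rw [Function.iterate_succ_apply']
      have := (Complex.differentiableOn_dslope (s := univ) (c := a) univ_mem).2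
        ih.differentiableOn
      exact differentiableOn_univ.1 this
  have hg0 := hp.iterate_dslope_fslope_ne_zero hp0
  have heq := hp.eq_pow_order_mul_iterate_dslope
  have hord : analyticOrderAt f a = (p.order : ℕ∞) :=
    ((hf.analyticAt a).analyticOrderAt_eq_natCast).2
      ⟨_, (hgd p.order).analyticAt a, hg0, Eventually.of_forall heq⟩
  have hn : analyticOrderNatAt f a = p.order := by
    simp [analyticOrderNatAt, hord]
  refine ⟨_, hgd p.order, hg0, ?_⟩
  intro z
  rw [hn, heq z, smul_eq_mul]

lemma circ_id_inv {c a : ℂ} {r : ℝ} (ha : a ∈ ball c r) :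
    (∮ z in C(c, r), z * (z - a)⁻¹) = 2 * Real.pi * I * a := by
  have hr : 0 < r := dist_nonneg.trans_lt ha
  have hne : ∀ z ∈ sphere c r, z - a ≠ 0 := by
    intro z hz h
    rw [sub_eq_zero] at h
    subst h
    simp only [mem_sphere, mem_ball] at hz ha
    linarith
  have h1 : EqOn (fun z => z * (z - a)⁻¹) (fun z => 1 + a * (z - a)⁻¹) (sphere c r) := by
    intro z hz
    have := hne z hz
    simp only
    field_simp
    ring
  rw [circleIntegral.integral_congr hr.le h1, circleIntegral.integral_add,
    circleIntegral.integral_const_mul, circleIntegral.integral_sub_inv_of_mem_ball ha]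
  · have : (∮ _z in C(c, r), (1:ℂ)) = 0 :=
      Complex.circleIntegral_eq_zero_of_differentiable_on_off_countable hr.le
        countable_empty continuousOn_const (fun z _ => differentiableAt_const _)
    rw [this]; ring
  · exact continuousOn_const.circleIntegrable hr.le
  · refine ContinuousOn.circleIntegrable hr.le ?_
    exact continuousOn_const.mul ((continuousOn_id.sub continuousOn_const).inv₀ hne)

/-- Argument principle for sums of zeros. -/
lemma arg_princ {c : ℂ} {r : ℝ} (hr : 0 < r) (s : Finset ℂ) : ∀ {f : ℂ → ℂ},
    Differentiable ℂ f → (∀ z ∈ closedBall c r, f z = 0 ↔ z ∈ s) → (∀ a ∈ s, a ∈ ball c r) →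
    (∮ z in C(c, r), z * (deriv f z / f z)) =
      2 * Real.pi * I * ∑ a ∈ s, (analyticOrderNatAt f a : ℂ) * a := by
  classical
  induction s using Finset.induction_on with
  | empty =>
    intro f hf hz _
    have hne : ∀ z ∈ closedBall c r, f z ≠ 0 := fun z h1 h2 => by simpa using (hz z h1).1 h2
    have hd : Differentiable ℂ (deriv f) := by
      have := (hf.differentiableOn (s := univ)).deriv isOpen_univ
      exact differentiableOn_univ.1 this
    simp only [Finset.sum_empty, mul_zero]
    refine Complex.circleIntegral_eq_zero_of_differentiable_on_off_countable hr.le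
        countable_empty ?_ ?_
    · exact continuousOn_id.mul (hd.continuous.continuousOn.div hf.continuous.continuousOn hne)
    · intro z hz'
      exact differentiableAt_id.mul ((hd z).div (hf z) (hne z (ball_subset_closedBall hz'.1)))
  | insert a s has ih =>
    intro f hf hz hb
    have hab := hb a (Finset.mem_insert_self _ _)
    have hsph : ∀ z ∈ sphere c r, f z ≠ 0 := by
      intro z hz' h0
      have h1 := hb z ((hz z (sphere_subset_closedBall hz')).1 h0)
      simp only [mem_sphere, mem_ball] at hz' h1
      linarith
    have hne : ∃ z, f z ≠ 0 := by
      refine ⟨c + r, hsph _ ?_⟩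
      simp [abs_of_pos hr]
    obtain ⟨g, hg, hga, hfg⟩ := factor_at hf a hne
    set m := analyticOrderNatAt f a with hm
    have hd : Differentiable ℂ (deriv g) := by
      have := (hg.differentiableOn (s := univ)).deriv isOpen_univ
      exact differentiableOn_univ.1 this
    have hfa : f a = 0 := (hz a (ball_subset_closedBall hab)).2 (Finset.mem_insert_self _ _)
    have hm0 : m ≠ 0 := by
      intro h
      have := hfg a
      rw [h, hfa] at this
      simp at this
      exact hga this.symm
    have hgz : ∀ z ∈ closedBall c r, g z = 0 ↔ z ∈ s := by
      intro z h1
      constructor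
      · intro h2
        have h3 : f z = 0 := by rw [hfg z, h2, mul_zero]
        rcases Finset.mem_insert.1 ((hz z h1).1 h3) with h4 | h4
        · subst h4; exact absurd h2 hga
        · exact h4
      · intro h2
        have h3 := (hz z h1).2 (Finset.mem_insert_of_mem h2)
        rw [hfg z] at h3
        rcases mul_eq_zero.1 h3 with h4 | h4
        · have := pow_eq_zero_iff hm0 |>.1 h4
          rw [sub_eq_zero] at this
          subst this; exact absurd h2 has
        · exact h4
    have ihg := ih hg hgz (fun b hb' => hb b (Finset.mem_insert_of_mem hb'))
    have hgs : ∀ z ∈ sphere c r, g z ≠ 0 := by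
      intro z h1 h2
      exact hsph z h1 (by rw [hfg z, h2, mul_zero])
    have has' : ∀ z ∈ sphere c r, z - a ≠ 0 := by
      intro z h1 h
      rw [sub_eq_zero] at h
      subst h
      exact hsph z h1 hfa
    have hEq : EqOn (fun z => z * (deriv f z / f z))
        (fun z => (m:ℂ) * (z * (z - a)⁻¹) + z * (deriv g z / g z)) (sphere c r) := by
      intro z h1
      have e1 := has' z h1
      have e2 := hgs z h1
      have hder : HasDerivAt f
          ((m:ℂ) * (z - a) ^ (m - 1) * g z + (z - a) ^ m * deriv g z) z := by
        have h3 : HasDerivAt (fun z => (z - a) ^ m) ((m:ℂ) * (z - a) ^ (m - 1) * 1) z :=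
          ((hasDerivAt_id z).sub_const a).pow m
        have h4 := h3.mul (hg z).hasDerivAt
        have h5 : f = (fun z => (z - a) ^ m) * g := by
          funext w; exact hfg w
        rw [h5]
        simpa using h4
      simp only
      rw [hder.deriv, hfg z]
      obtain ⟨k, hk⟩ := Nat.exists_eq_succ_of_ne_zero hm0
      rw [hk, Nat.succ_eq_add_one, Nat.add_sub_cancel]
      field_simp
      ring
    rw [circleIntegral.integral_congr hr.le hEq, circleIntegral.integral_add,
      circleIntegral.integral_const_mul, circ_id_inv hab, ihg, Finset.sum_insert has]
    · have hsum : ∑ b ∈ s, (analyticOrderNatAt g b : ℂ) * b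
          = ∑ b ∈ s, (analyticOrderNatAt f b : ℂ) * b := by
        refine Finset.sum_congr rfl ?_
        intro b hb'
        have hba : b ≠ a := by rintro rfl; exact has hb'
        have h5 : f = (fun z => (z - a) ^ m) * g := by
          funext w; exact hfg w
        have hpa : AnalyticAt ℂ (fun z => (z - a) ^ m) b := by fun_prop
        have h6 : analyticOrderAt f b = analyticOrderAt g b := by
          rw [h5, analyticOrderAt_mul hpa (hg.analyticAt b)]
          have : analyticOrderAt (fun z => (z - a) ^ m) b = 0 := by
            rw [analyticOrderAt_eq_zero]
            exact Or.inr (pow_ne_zero _ (sub_ne_zero.2 hba))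
          rw [this, zero_add]
        simp only [analyticOrderNatAt, h6]
      rw [hsum]; ring
    · refine ContinuousOn.circleIntegrable hr.le ?_
      exact continuousOn_const.mul
        (continuousOn_id.mul ((continuousOn_id.sub continuousOn_const).inv₀ has'))
    · refine ContinuousOn.circleIntegrable hr.le ?_
      exact continuousOn_id.mul (hd.continuous.continuousOn.div hg.continuous.continuousOn hgs)

end EQ

namespace EQ
open Metric Set MeasureTheory Topology

/-- Circle integrals depend holomorphically on parameters. -/
lemma circ_param {U : Set (ℂ × ℂ)} (hU : IsOpen U) {P : ℂ × ℂ → ℂ} (hP : DifferentiableOn ℂ P U)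
    {c l0 : ℂ} {r : ℝ} (hr : 0 < r) (hs : ∀ z ∈ sphere c r, (z, l0) ∈ U) :
    DifferentiableAt ℂ (fun l => ∮ z in C(c, r), P (z, l)) l0 := by
  have hev : ∀ᶠ l in 𝓝 l0, ∀ z ∈ sphere c r, (z, l) ∈ U := by
    refine IsCompact.eventually_forall_of_forall_eventually (isCompact_sphere c r) ?_
    intro z hz
    have h1 : Tendsto (fun q : ℂ × ℂ => (q.2, q.1)) (𝓝 (l0, z)) (𝓝 (z, l0)) :=
      (continuous_snd.prodMk continuous_fst).tendsto _
    exact h1.eventually (hU.mem_nhds (hs z hz))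
  obtain ⟨e, he, hball⟩ := Metric.nhds_basis_closedBall.eventually_iff.1 hev
  set Q : ℂ × ℂ → ℂ := fun x => fderiv ℂ P x (0, 1) with hQ
  have hQd : DifferentiableOn ℂ Q U := differentiableOn_fderiv_apply hU hP (0, 1)
  have hK : IsCompact (sphere c r ×ˢ closedBall l0 e) :=
    (isCompact_sphere c r).prod (isCompact_closedBall l0 e)
  have hKU : sphere c r ×ˢ closedBall l0 e ⊆ U := fun x hx => hball hx.2 x.1 hx.1
  obtain ⟨M, hM⟩ := hK.exists_bound_of_continuousOn (hQd.continuousOn.mono hKU)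
  have hcm : ∀ θ : ℝ, circleMap c r θ ∈ sphere c r := fun θ => circleMap_mem_sphere c hr.le θ
  have hl0 : l0 ∈ closedBall l0 e := mem_closedBall_self he.le
  have hcirc : Continuous (circleMap c r) := continuous_circleMap c r
  have hdc : Continuous (deriv (circleMap c r)) := by
    have : deriv (circleMap c r) = fun θ => circleMap 0 r θ * I := by
      funext θ; exact deriv_circleMap c r θ
    rw [this]
    exact (continuous_circleMap 0 r).mul continuous_const
  have hcont : ∀ G : ℂ × ℂ → ℂ, ContinuousOn G U → ∀ l ∈ closedBall l0 e,
      Continuous (fun θ : ℝ => deriv (circleMap c r) θ * G (circleMap c r θ, l)) := by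
    intro G hG l hl
    refine hdc.mul ?_
    exact hG.comp_continuous (hcirc.prodMk continuous_const) (fun θ => hball hl _ (hcm θ))
  have hmain := intervalIntegral.hasDerivAt_integral_of_dominated_loc_of_deriv_le
    (𝕜 := ℂ) (μ := volume) (a := 0) (b := 2 * Real.pi)
    (F := fun l θ => deriv (circleMap c r) θ * P (circleMap c r θ, l))
    (F' := fun l θ => deriv (circleMap c r) θ * Q (circleMap c r θ, l))
    (x₀ := l0) (s := ball l0 e) (bound := fun θ => ‖deriv (circleMap c r) θ‖ * M)
    (ball_mem_nhds l0 he) ?_ ?_ ?_ ?_ ?_ ?_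
  · have h2 := hmain.2.differentiableAt
    exact h2
  · filter_upwards [closedBall_mem_nhds l0 he] with l hl
    exact (hcont P hP.continuousOn l hl).aestronglyMeasurable
  · exact (hcont P hP.continuousOn l0 hl0).intervalIntegrable _ _
  · exact (hcont Q hQd.continuousOn l0 hl0).aestronglyMeasurable
  · refine Eventually.of_forall ?_
    intro θ _ l hl
    rw [norm_mul]
    exact mul_le_mul_of_nonneg_left (hM (circleMap c r θ, l) ⟨hcm θ, ball_subset_closedBall hl⟩)
      (norm_nonneg _)
  · exact (hdc.norm.mul continuous_const).intervalIntegrable _ _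
  · refine Eventually.of_forall ?_
    intro θ _ l hl
    refine HasDerivAt.const_mul _ ?_
    have h1 : HasFDerivAt P (fderiv ℂ P (circleMap c r θ, l)) (circleMap c r θ, l) :=
      (hP.differentiableAt (hU.mem_nhds (hball (ball_subset_closedBall hl) _ (hcm θ)))).hasFDerivAt
    have h2 : HasDerivAt (fun l : ℂ => (circleMap c r θ, l)) ((0, 1) : ℂ × ℂ) l :=
      (hasDerivAt_const l (circleMap c r θ)).prodMk (hasDerivAt_id l)
    exact h1.comp_hasDerivAt l h2

end EQ

namespace EQ
open Metric Set MeasureTheory Topology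

def Joint (G : ℂ → ℂ → ℂ) : Prop :=
  Differentiable ℂ (fun p : ℂ × ℂ => G p.1 p.2) ∧ ∀ l, ∃ a, G a l ≠ 0

def ZG (G : ℂ → ℂ → ℂ) : Set (ℂ × ℂ) := {p | G p.1 p.2 = 0}

lemma F_slice {G : ℂ → ℂ → ℂ} (hG : Joint G) (l : ℂ) : Differentiable ℂ (fun a => G a l) := by
  have h := hG.1
  have h2 : Differentiable ℂ (fun a : ℂ => (a, l)) := by fun_prop
  exact h.comp h2

lemma F_slice_ne {G : ℂ → ℂ → ℂ} (hG : Joint G) (l : ℂ) : ∃ a, G a l ≠ 0 := hG.2 l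

def fib (A : Set (ℂ × ℂ)) (l : ℂ) : Set ℂ := {a | (a, l) ∈ A}

lemma zeros_finite {G : ℂ → ℂ → ℂ} (hG : Joint G) (l : ℂ) (R : ℝ) :
    ({a | G a l = 0} ∩ closedBall 0 R).Finite := by
  by_contra hinf
  have hinf : ({a | G a l = 0} ∩ closedBall 0 R).Infinite := hinf
  obtain ⟨x, _, hx⟩ := hinf.exists_accPt_of_subset_isCompact (isCompact_closedBall (0:ℂ) R)
    inter_subset_right
  have hx' : ∃ᶠ z in 𝓝[≠] x, G z l = 0 := by
    have := accPt_iff_frequently_nhdsNE.1 hx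
    exact this.mono fun z hz => hz.1
  have h2 : AnalyticOnNhd ℂ (fun a => G a l) univ := fun z _ => (F_slice hG l).analyticAt z
  obtain ⟨a, ha⟩ := F_slice_ne hG l
  exact ha (h2.eqOn_zero_of_preconnected_of_frequently_eq_zero isPreconnected_univ (mem_univ x)
    hx' (mem_univ a))

lemma fib_finite {G : ℂ → ℂ → ℂ} (hG : Joint G) {A : Set (ℂ × ℂ)} (hAZ : A ⊆ ZG G) (hb : Bdd A) (l : ℂ) :
    (fib A l).Finite := by
  obtain ⟨R, hR⟩ := hb ‖l‖
  refine (zeros_finite hG l R).subset ?_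
  intro a ha
  have ha' : (a, l) ∈ A := ha
  refine ⟨hAZ ha', ?_⟩
  rw [mem_closedBall_zero_iff]
  exact hR (a, l) ha' le_rfl

/-- radius isolating the finitely many points -/
lemma sep_radius {G : ℂ → ℂ → ℂ} (hG : Joint G) (l : ℂ) (T : Finset ℂ) :
    ∃ ρ > 0, (∀ a ∈ T, ∀ z ∈ closedBall a ρ, G z l = 0 → z = a) ∧
      ∀ a ∈ T, ∀ b ∈ T, ∀ z, z ∈ closedBall a ρ → z ∈ closedBall b ρ → a = b := by
  have h1 : ∀ a : ℂ, ∀ᶠ ρ in 𝓝[>] (0:ℝ), ∀ z ∈ closedBall a ρ, G z l = 0 → z = a := by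
    intro a
    have h2 : ∀ᶠ z in 𝓝 a, G z l = 0 → z = a := by
      have h3 := ((F_slice hG l).analyticAt a).eventually_eq_zero_or_eventually_ne_zero
      rcases h3 with h3 | h3
      · exfalso
        have h2 : AnalyticOnNhd ℂ (fun a => G a l) univ := fun z _ => (F_slice hG l).analyticAt z
        obtain ⟨b, hb⟩ := F_slice_ne hG l
        exact hb (h2.eqOn_zero_of_preconnected_of_eventuallyEq_zero isPreconnected_univ
          (mem_univ a) h3 (mem_univ b))
      · rw [eventually_nhdsWithin_iff] at h3
        filter_upwards [h3] with z hz h0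
        by_contra hne
        exact hz hne h0
    obtain ⟨e, he, hball⟩ := Metric.nhds_basis_ball.eventually_iff.1 h2
    filter_upwards [Ioo_mem_nhdsGT he] with ρ hρ z hz
    exact hball (closedBall_subset_ball hρ.2 hz)
  have h2 : ∀ a b : ℂ, ∀ᶠ ρ in 𝓝[>] (0:ℝ), ∀ z, z ∈ closedBall a ρ → z ∈ closedBall b ρ → a = b := by
    intro a b
    by_cases hab : a = b
    · exact Eventually.of_forall fun _ _ _ _ => hab
    · have hd : 0 < dist a b / 2 := half_pos (dist_pos.2 hab)
      filter_upwards [Ioo_mem_nhdsGT hd] with ρ hρ z hz1 hz2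
      exfalso
      have := dist_triangle_left a b z
      rw [mem_closedBall] at hz1 hz2
      linarith [hρ.2]
  have h3 : ∀ᶠ ρ in 𝓝[>] (0:ℝ), (∀ a ∈ T, ∀ z ∈ closedBall a ρ, G z l = 0 → z = a) :=
    (Finset.eventually_all T).2 fun a _ => h1 a
  have h4 : ∀ᶠ ρ in 𝓝[>] (0:ℝ), ∀ a ∈ T, ∀ b ∈ T, ∀ z, z ∈ closedBall a ρ →
      z ∈ closedBall b ρ → a = b :=
    (Finset.eventually_all T).2 fun a _ => (Finset.eventually_all T).2 fun b _ => h2 a b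
  obtain ⟨ρ, ⟨ha, hb⟩, hc⟩ := ((h3.and h4).and self_mem_nhdsWithin).exists
  exact ⟨ρ, hc, ha, hb⟩

lemma swap_ev {p : ℂ × ℂ → Prop} {z l : ℂ} (h : ∀ᶠ q in 𝓝 (z, l), p q) :
    ∀ᶠ q in 𝓝 (l, z), p (q.2, q.1) :=
  ((continuous_snd.prodMk continuous_fst).tendsto (l, z)).eventually h

/-- points of the bounded piece near a given fibre -/
lemma fib_near {A : Set (ℂ × ℂ)} (hA : IsClosed A) (hb : Bdd A)
    {l0 : ℂ} {ρ : ℝ} (T : Finset ℂ) (hρ : 0 < ρ) (hT : ∀ a ∈ fib A l0, a ∈ T) :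
    ∀ᶠ l in 𝓝 l0, ∀ a ∈ fib A l, ∃ t ∈ T, a ∈ ball t ρ := by
  obtain ⟨R, hR⟩ := hb (‖l0‖ + 1)
  set U : Set ℂ := ⋃ t ∈ T, ball t ρ with hU
  have hUo : IsOpen U := isOpen_biUnion fun t _ => isOpen_ball
  have hK : IsCompact (closedBall (0:ℂ) R \ U) := (isCompact_closedBall 0 R).diff hUo
  have hev : ∀ᶠ l in 𝓝 l0, ∀ z ∈ closedBall (0:ℂ) R \ U, (z, l) ∉ A := by
    refine IsCompact.eventually_forall_of_forall_eventually hK ?_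
    intro z hz
    have hzA : (z, l0) ∉ A := by
      intro h
      refine hz.2 ?_
      rw [hU]
      exact mem_biUnion (hT z h) (mem_ball_self hρ)
    exact swap_ev (hA.isOpen_compl.mem_nhds hzA)
  have hn : ∀ᶠ l in 𝓝 l0, ‖l‖ ≤ ‖l0‖ + 1 := by
    have : Tendsto (fun l : ℂ => ‖l‖) (𝓝 l0) (𝓝 ‖l0‖) := continuous_norm.tendsto l0
    exact this.eventually (eventually_le_nhds (by linarith))
  filter_upwards [hev, hn] with l h1 h2 a ha
  have h3 : a ∈ closedBall (0:ℂ) R := by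
    rw [mem_closedBall_zero_iff]; exact hR (a, l) ha h2
  by_contra h4
  refine h1 a ⟨h3, ?_⟩ ha
  intro h5
  rw [hU] at h5
  simp only [mem_iUnion, exists_prop] at h5
  exact h4 h5

noncomputable def Ssum (G : ℂ → ℂ → ℂ) (A : Set (ℂ × ℂ)) (l : ℂ) : ℂ :=
  ∑ᶠ a ∈ fib A l, (analyticOrderNatAt (fun z => G z l) a : ℂ) * a

lemma Ssum_differentiable {G : ℂ → ℂ → ℂ} (hG : Joint G) {A B : Set (ℂ × ℂ)} (hA : IsClosed A)
    (hB : IsClosed B) (hAB : A ∪ B = ZG G) (hdis : Disjoint A B) (hb : Bdd A) :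
    Differentiable ℂ (Ssum G A) := by
  classical
  intro l0
  have hAZ : A ⊆ ZG G := hAB ▸ subset_union_left
  have hfin := fib_finite hG hAZ hb
  set T := (hfin l0).toFinset with hTdef
  have hT : ∀ a, a ∈ T ↔ (a, l0) ∈ A := fun a => by
    rw [hTdef, Set.Finite.mem_toFinset]; rfl
  obtain ⟨ρ, hρ, hiso, hsep⟩ := sep_radius hG l0 T
  have e1 := fib_near hA hb (l0 := l0) T hρ (fun a ha => (hT a).2 ha)
  have hFc := hG.1.continuous
  set U : Set (ℂ × ℂ) := {p | G p.1 p.2 ≠ 0} with hUdef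
  have hUo : IsOpen U := isOpen_ne_fun hFc continuous_const
  have hsphU : ∀ a ∈ T, ∀ z ∈ sphere a ρ, (z, l0) ∈ U := by
    intro a ha z hz h0
    have := hiso a ha z (sphere_subset_closedBall hz) h0
    subst this
    simp only [mem_sphere, dist_self] at hz
    linarith
  have e2 : ∀ᶠ l in 𝓝 l0, ∀ a ∈ T, ∀ z ∈ sphere a ρ, G z l ≠ 0 := by
    refine (Finset.eventually_all T).2 fun a ha => ?_
    refine IsCompact.eventually_forall_of_forall_eventually (isCompact_sphere a ρ) ?_
    intro z hz
    exact swap_ev (p := fun q => G q.1 q.2 ≠ 0) (hUo.mem_nhds (hsphU a ha z hz))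
  have e3 : ∀ᶠ l in 𝓝 l0, ∀ a ∈ T, ∀ z ∈ closedBall a ρ, (z, l) ∉ B := by
    refine (Finset.eventually_all T).2 fun a ha => ?_
    refine IsCompact.eventually_forall_of_forall_eventually (isCompact_closedBall a ρ) ?_
    intro z hz
    have : (z, l0) ∉ B := by
      intro h
      have hz0 : (z, l0) ∈ ZG G := hAB ▸ Or.inr h
      have := hiso a ha z hz hz0
      subst this
      exact disjoint_left.1 hdis ((hT z).1 ha) h
    exact swap_ev (hB.isOpen_compl.mem_nhds this)
  set D : ℂ × ℂ → ℂ := fun x => fderiv ℂ (fun p : ℂ × ℂ => G p.1 p.2) x (1, 0) with hD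
  have hDd : DifferentiableOn ℂ D univ :=
    differentiableOn_fderiv_apply isOpen_univ hG.1.differentiableOn (1, 0)
  have hDeq : ∀ z l, deriv (fun w => G w l) z = D (z, l) := by
    intro z l
    have h1 := (hG.1 (z, l)).hasFDerivAt
    have h2 : HasDerivAt (fun w : ℂ => (w, l)) ((1, 0) : ℂ × ℂ) z :=
      (hasDerivAt_id z).prodMk (hasDerivAt_const z l)
    exact (h1.comp_hasDerivAt z h2).deriv
  set P : ℂ × ℂ → ℂ := fun x => x.1 * (D x / G x.1 x.2) with hP
  have hPd : DifferentiableOn ℂ P U := by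
    refine differentiableOn_fst.mul ?_
    have h1 : DifferentiableOn ℂ (fun p : ℂ × ℂ => G p.1 p.2) U := hG.1.differentiableOn
    have h2 : ∀ x ∈ U, (fun p : ℂ × ℂ => G p.1 p.2) x ≠ 0 := fun x hx => hx
    simp only [div_eq_mul_inv]
    exact (hDd.mono (subset_univ _)).mul (h1.inv h2)
  have hev : Ssum G A =ᶠ[𝓝 l0] fun l => ∑ a ∈ T, (2 * Real.pi * I)⁻¹ * ∮ z in C(a, ρ), P (z, l) := by
    filter_upwards [e1, e2, e3] with l h1 h2 h3
    set V := (hfin l).toFinset with hV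
    have hVm : ∀ a, a ∈ V ↔ (a, l) ∈ A := fun a => by
      rw [hV, Set.Finite.mem_toFinset]; rfl
    have hpi : (2 * Real.pi * I : ℂ) ≠ 0 := Complex.two_pi_I_ne_zero
    have hloc : ∀ a ∈ T, (2 * Real.pi * I : ℂ)⁻¹ * (∮ z in C(a, ρ), P (z, l)) =
        ∑ z ∈ V.filter (fun z => z ∈ ball a ρ),
          (analyticOrderNatAt (fun z => G z l) z : ℂ) * z := by
      intro a ha
      have h4 := arg_princ (c := a) hρ (V.filter (fun z => z ∈ ball a ρ)) (F_slice hG l) ?_ ?_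
      · have h5 : (∮ z in C(a, ρ), P (z, l)) =
            ∮ z in C(a, ρ), z * (deriv (fun w => G w l) z / G z l) := by
          simp only [hDeq, hP]
        rw [h5, h4, ← mul_assoc, inv_mul_cancel₀ hpi, one_mul]
      · intro z hz
        rw [Finset.mem_filter, hVm]
        constructor
        · intro h0
          have hz0 : (z, l) ∈ A ∪ B := by rw [hAB]; exact h0
          have hzb : z ∈ ball a ρ := by
            rcases (mem_closedBall.1 hz).lt_or_eq with h | h
            · exact h
            · exact absurd h0 (h2 a ha z h)
          rcases hz0 with h | h
          · exact ⟨h, hzb⟩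
          · exact absurd h (h3 a ha z hz)
        · intro h; exact hAZ h.1
      · intro z hz
        exact (Finset.mem_filter.1 hz).2
    rw [Finset.sum_congr rfl hloc, Ssum, finsum_mem_eq_finite_toFinset_sum _ (hfin l),
      ← Finset.sum_biUnion]
    · refine Finset.sum_congr ?_ fun _ _ => rfl
      ext z
      rw [Finset.mem_biUnion]
      constructor
      · intro hz
        obtain ⟨t, ht, hzt⟩ := h1 z ((hVm z).1 hz)
        exact ⟨t, ht, Finset.mem_filter.2 ⟨hz, hzt⟩⟩
      · rintro ⟨t, ht, hzt⟩
        exact (Finset.mem_filter.1 hzt).1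
    · intro a ha b hb' hab
      rw [Function.onFun, Finset.disjoint_left]
      intro z hz1 hz2
      exact hab (hsep a ha b hb' z (ball_subset_closedBall (Finset.mem_filter.1 hz1).2)
        (ball_subset_closedBall (Finset.mem_filter.1 hz2).2))
  refine DifferentiableAt.congr_of_eventuallyEq ?_ hev
  refine DifferentiableAt.fun_sum fun a ha => ?_
  exact (circ_param hUo hPd hρ (hsphU a ha)).const_mul _

end EQ

namespace EQ
open Metric Set MeasureTheory Topology

lemma herglotz {S : ℂ → ℂ} (hS : Differentiable ℂ S) (hp : ∀ z : ℂ, 0 < z.im → 0 ≤ (S z).im)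
    (hn : ∀ z : ℂ, z.im < 0 → (S z).im ≤ 0) (hr : ∀ z : ℂ, z.im = 0 → (S z).im = 0) :
    ∃ α β : ℝ, ∀ z, S z = α + β * z := by
  set D := dslope S 0 with hD
  have hDd : Differentiable ℂ D := by
    have := (Complex.differentiableOn_dslope (s := univ) (c := 0) univ_mem).2
      hS.differentiableOn
    exact differentiableOn_univ.1 this
  have hSD : ∀ z, z * D z = S z - S 0 := by
    intro z
    have := sub_smul_dslope S 0 z
    simpa using this
  have hS0 : (S 0).im = 0 := hr 0 (by simp)
  have key : ∀ z, ‖D z‖ ≤ (4 / 3) * (2 + 3 * ‖D 0‖) := by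
    intro z
    set R : ℝ := 2 * ‖z‖ + 1 with hR
    have hRp : 0 < R := by positivity
    have hRc : (R : ℂ) ≠ 0 := by exact_mod_cast hRp.ne'
    set h : ℂ → ℂ := fun w => D w * (1 - w ^ 2 / (R:ℂ) ^ 2) with hh
    have hhd : Differentiable ℂ h := by
      refine hDd.mul ?_
      fun_prop
    have hfr : ∀ w ∈ sphere (0:ℂ) R, 0 ≤ (h w).re := by
      intro w hw
      have hwn : ‖w‖ = R := mem_sphere_zero_iff_norm.1 hw
      have hw0 : w ≠ 0 := by
        rintro rfl
        rw [norm_zero] at hwn; linarith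
      have hcc : w * (starRingEnd ℂ) w = (R:ℂ) ^ 2 := by
        rw [Complex.mul_conj, Complex.normSq_eq_norm_sq, hwn]; push_cast; ring
      have e1 : (starRingEnd ℂ) w = w - 2 * w.im * I := by
        apply Complex.ext <;> simp; ring
      have e2 : h w = (S w - S 0) * ((-2 * w.im / R ^ 2 : ℝ) * I) := by
        rw [← hSD w, hh]
        simp only
        push_cast
        field_simp
        rw [← hcc, e1]; ring
      rw [e2]
      have e3 : ((S w - S 0) * ((-2 * w.im / R ^ 2 : ℝ) * I)).re = 2 / R ^ 2 * (w.im * (S w).im) := by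
        simp only [Complex.mul_re, Complex.mul_im, Complex.ofReal_re, Complex.ofReal_im,
          Complex.I_re, Complex.I_im, Complex.sub_re, Complex.sub_im, hS0]
        ring
      rw [e3]
      refine mul_nonneg (by positivity) ?_
      rcases lt_trichotomy w.im 0 with h1 | h1 | h1
      · exact mul_nonneg_of_nonpos_of_nonpos h1.le (hn w h1)
      · rw [h1, zero_mul]
      · exact mul_nonneg h1.le (hp w h1)
    have hin : ∀ w ∈ ball (0:ℂ) R, 0 ≤ (h w).re := by
      intro w hw
      have hmax := Complex.norm_le_of_forall_mem_frontier_norm_le (U := ball (0:ℂ) R)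
        (f := fun w => exp (-h w)) (C := 1) isBounded_ball
        (hhd.neg.cexp.diffContOnCl) ?_ (subset_closure hw)
      · rw [Complex.norm_exp] at hmax
        have := Real.exp_le_one_iff.1 hmax
        simpa using this
      · intro y hy
        rw [frontier_ball 0 hRp.ne'] at hy
        rw [Complex.norm_exp]
        refine Real.exp_le_one_iff.2 ?_
        simpa using hfr y hy
    have hzb : z ∈ ball (0:ℂ) R := by
      rw [mem_ball_zero_iff]; linarith [norm_nonneg z]
    have hbc := Complex.borelCaratheodory (f := fun w => -h w) (M := 1) (R := R) (z := z)
      one_pos hhd.neg.differentiableOn (fun w hw => by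
        have := hin w hw
        simp only [mem_ofPred_eq, Complex.neg_re]
        linarith) hRp hzb
    simp only [norm_neg] at hbc
    have hd0 : h 0 = D 0 := by simp [hh]
    rw [hd0] at hbc
    have hz0 := norm_nonneg z
    have q1 : 2 * 1 * ‖z‖ / (R - ‖z‖) ≤ 2 := by
      rw [div_le_iff₀ (by linarith)]; linarith
    have q2 : ‖D 0‖ * (R + ‖z‖) / (R - ‖z‖) ≤ 3 * ‖D 0‖ := by
      rw [div_le_iff₀ (by linarith)]
      nlinarith [norm_nonneg (D 0)]
    have q3 : ‖h z‖ = ‖D z‖ * ‖1 - z ^ 2 / (R:ℂ) ^ 2‖ := by rw [hh]; simp only [norm_mul]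
    have q4 : 3 / 4 ≤ ‖1 - z ^ 2 / (R:ℂ) ^ 2‖ := by
      have h1 := norm_sub_norm_le (1:ℂ) (z ^ 2 / (R:ℂ) ^ 2)
      have h2 : ‖z ^ 2 / (R:ℂ) ^ 2‖ ≤ 1 / 4 := by
        rw [norm_div, norm_pow, norm_pow, Complex.norm_real, Real.norm_of_nonneg hRp.le,
          div_le_iff₀ (by positivity)]
        nlinarith
      rw [norm_one] at h1
      linarith
    have := mul_le_mul_of_nonneg_left q4 (norm_nonneg (D z))
    linarith
  have hconst : ∀ z, D z = D 0 := fun z => hDd.apply_eq_apply_of_bounded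
    (isBounded_iff_forall_norm_le.2 ⟨_, by rintro _ ⟨w, rfl⟩; exact key w⟩) z 0
  have hSz : ∀ z, S z = S 0 + D 0 * z := by
    intro z
    have := hSD z
    rw [hconst z] at this
    linear_combination -this
  have hD0 : (D 0).im = 0 := by
    have h1 := hr 1 (by simp)
    rw [hSz 1] at h1
    simpa [hS0] using h1
  refine ⟨(S 0).re, (D 0).re, ?_⟩
  intro z
  rw [hSz z]
  congr 1
  · apply Complex.ext <;> simp [hS0]
  · congr 1
    apply Complex.ext <;> simp [hD0]

end EQ

namespace EQ
open Metric Set MeasureTheory Topology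

lemma proj_clopen {G : ℂ → ℂ → ℂ} (hG : Joint G) {A B : Set (ℂ × ℂ)} (hA : IsClosed A)
    (hB : IsClosed B) (hAB : A ∪ B = ZG G) (hdis : Disjoint A B) (hb : Bdd A) :
    IsClopen {l : ℂ | (fib A l).Nonempty} := by
  constructor
  · rw [← isOpen_compl_iff, isOpen_iff_mem_nhds]
    intro l0 hl0
    have hl0' : ¬ (fib A l0).Nonempty := hl0
    rw [Set.not_nonempty_iff_eq_empty] at hl0'
    have h1 := fib_near hA hb (l0 := l0) ∅ one_pos (fun a ha => by
      rw [hl0'] at ha; exact absurd ha (Set.notMem_empty a))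
    filter_upwards [h1] with l hl
    rintro ⟨a, ha⟩
    obtain ⟨t, ht, _⟩ := hl a ha
    exact absurd ht (Finset.notMem_empty t)
  · rw [isOpen_iff_mem_nhds]
    rintro l0 ⟨a0, ha0⟩
    have ha0' : (a0, l0) ∈ A := ha0
    have hnB : (a0, l0) ∉ B := disjoint_left.1 hdis ha0'
    have h0 : G a0 l0 = 0 := by
      have : (a0, l0) ∈ ZG G := hAB ▸ Or.inl ha0'
      exact this
    have hc : Continuous (fun q : ℂ × ℂ => G q.2 q.1) :=
      hG.1.continuous.comp (continuous_snd.prodMk continuous_fst)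
    obtain ⟨e, he, hball⟩ := Metric.nhds_basis_ball.eventually_iff.1
      (hB.isOpen_compl.mem_nhds hnB : ∀ᶠ q in 𝓝 (a0, l0), q ∈ Bᶜ)
    have h1 := hurwitz (Φ := fun l a => G a l) hc (fun l => F_slice hG l) h0 (hG.2 l0) he
    filter_upwards [h1, ball_mem_nhds l0 he] with l hl hl2
    obtain ⟨v, hv, hv0⟩ := hl
    have h2 : (v, l) ∈ A ∪ B := by rw [hAB]; exact hv0
    rcases h2 with h2 | h2
    · exact ⟨v, h2⟩
    · refine absurd h2 (hball ?_)
      rw [← ball_prod_same]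
      exact ⟨mem_ball_iff_norm.2 hv, hl2⟩

lemma order_pos {G : ℂ → ℂ → ℂ} (hG : Joint G) {a l : ℂ} (h : G a l = 0) :
    0 < analyticOrderNatAt (fun z => G z l) a := by
  obtain ⟨g, _, hga, hfg⟩ := factor_at (F_slice hG l) a (hG.2 l)
  rcases Nat.eq_zero_or_pos (analyticOrderNatAt (fun z => G z l) a) with h0 | h0
  · exfalso
    have := hfg a
    rw [h0, pow_zero, one_mul] at this
    exact hga (this ▸ h)
  · exact h0

lemma lemmaL {G : ℂ → ℂ → ℂ} (hG : Joint G) (hpos : ∀ a l : ℂ, G a l = 0 → 0 < l.im → 0 < a.im)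
    (hneg : ∀ a l : ℂ, G a l = 0 → l.im < 0 → a.im < 0)
    (hreal : ∀ a l : ℂ, G a l = 0 → l.im = 0 → a.im = 0)
    (hit : ∀ a : ℂ, ∀ t : ℝ, 0 < t → G a (t * I) = 0 → 24 * a.re + 7 * a.im < 0)
    {A B : Set (ℂ × ℂ)} (hA : IsClosed A)
    (hB : IsClosed B) (hAB : A ∪ B = ZG G) (hdis : Disjoint A B) (hb : Bdd A) : A = ∅ := by
  classical
  have hAZ : A ⊆ ZG G := hAB ▸ subset_union_left
  have hA0 : ∀ a l : ℂ, a ∈ fib A l → G a l = 0 := by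
    intro a l h
    have h1 : (a, l) ∈ A := h
    exact hAZ h1
  have hfin := fib_finite hG hAZ hb
  have hS := Ssum_differentiable hG hA hB hAB hdis hb
  have hSs : ∀ l, Ssum G A l = ∑ a ∈ (hfin l).toFinset,
      (analyticOrderNatAt (fun z => G z l) a : ℂ) * a := fun l =>
    finsum_mem_eq_finite_toFinset_sum _ (hfin l)
  have him : ∀ l, (Ssum G A l).im = ∑ a ∈ (hfin l).toFinset,
      (analyticOrderNatAt (fun z => G z l) a : ℝ) * a.im := by
    intro l
    rw [hSs l, Complex.im_sum]
    refine Finset.sum_congr rfl fun a _ => ?_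
    simp
  have hre : ∀ l, (Ssum G A l).re = ∑ a ∈ (hfin l).toFinset,
      (analyticOrderNatAt (fun z => G z l) a : ℝ) * a.re := by
    intro l
    rw [hSs l, Complex.re_sum]
    refine Finset.sum_congr rfl fun a _ => ?_
    simp
  have hmem : ∀ l a, a ∈ (hfin l).toFinset → G a l = 0 := fun l a ha =>
    hA0 a l ((Set.Finite.mem_toFinset _).1 ha)
  obtain ⟨α, β, hlin⟩ := herglotz hS
    (fun z hz => by
      rw [him z]
      exact Finset.sum_nonneg fun a ha =>
        mul_nonneg (Nat.cast_nonneg _) (hpos a z (hmem z a ha) hz).le)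
    (fun z hz => by
      rw [him z]
      exact Finset.sum_nonpos fun a ha =>
        mul_nonpos_of_nonneg_of_nonpos (Nat.cast_nonneg _) (hneg a z (hmem z a ha) hz).le)
    (fun z hz => by
      rw [him z]
      exact Finset.sum_eq_zero fun a ha => by rw [hreal a z (hmem z a ha) hz, mul_zero])
  rcases isClopen_iff.1 (proj_clopen hG hA hB hAB hdis hb) with h | h
  · rw [Set.eq_empty_iff_forall_notMem]
    rintro ⟨a, l⟩ hal
    have : l ∈ {l : ℂ | (fib A l).Nonempty} := ⟨a, hal⟩
    rw [h] at this
    exact this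
  · exfalso
    have hne : ∀ l, (hfin l).toFinset.Nonempty := by
      intro l
      rw [Set.Finite.toFinset_nonempty]
      have : l ∈ {l : ℂ | (fib A l).Nonempty} := by rw [h]; exact mem_univ l
      exact this
    have hI : ∀ t : ℝ, 0 < t → 0 < β * t := by
      intro t ht
      have h1 : 0 < (Ssum G A (t * I)).im := by
        rw [him]
        refine Finset.sum_pos (fun a ha => ?_) (hne _)
        refine mul_pos (by exact_mod_cast order_pos hG (hmem _ a ha)) ?_
        exact hpos a _ (hmem _ a ha) (by simpa using ht)
      rw [hlin] at h1
      simpa using h1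
    have hJ : ∀ t : ℝ, 0 < t → 24 * α + 7 * (β * t) < 0 := by
      intro t ht
      have h1 : 24 * (Ssum G A (t * I)).re + 7 * (Ssum G A (t * I)).im < 0 := by
        rw [him, hre, Finset.mul_sum, Finset.mul_sum, ← Finset.sum_add_distrib]
        refine Finset.sum_neg (fun a ha => ?_) (hne _)
        have e1 : (0:ℝ) < analyticOrderNatAt (fun z => G z (t * I)) a := by
          exact_mod_cast order_pos hG (hmem _ a ha)
        have e2 := hit a t ht (hmem _ a ha)
        nlinarith
      rw [hlin] at h1
      simpa using h1
    have hβ : 0 < β := by simpa using hI 1 one_pos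
    have h2 := hJ ((24 * |α| + 1) / (7 * β)) (by positivity)
    have h3 : 7 * (β * ((24 * |α| + 1) / (7 * β))) = 24 * |α| + 1 := by
      field_simp
    rw [h3] at h2
    linarith [neg_abs_le α]

end EQ

namespace EQ
open Metric Set MeasureTheory Topology

lemma no_circle_log {u : ℂ → ℂ} {β : ℝ} (hβ : 0 < β) (hu : ContinuousOn u (sphere 0 β))
    (he : ∀ b ∈ sphere (0:ℂ) β, exp (u b) = b) : False := by
  have hm : ∀ θ : ℝ, (circleMap 0 β θ) ∈ sphere (0:ℂ) β := fun θ => circleMap_mem_sphere 0 hβ.le θ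
  have hc : Continuous (fun θ : ℝ => u (circleMap 0 β θ)) :=
    hu.comp_continuous (continuous_circleMap 0 β) hm
  set q : ℝ → ℝ := fun θ => ((u (circleMap 0 β θ)).im - θ) / (2 * Real.pi) with hq
  have hqc : Continuous q := ((continuous_im.comp hc).sub continuous_id).div_const _
  have hpi := Real.pi_pos
  have hintg : ∀ θ, ∃ n : ℤ, q θ = n := by
    intro θ
    have h1 := he _ (hm θ)
    have h2 : exp (u (circleMap 0 β θ)) = exp (Real.log β + θ * I) := by
      rw [h1, Complex.exp_add, ← Complex.ofReal_exp, Real.exp_log hβ, circleMap, zero_add]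
    obtain ⟨n, hn⟩ := Complex.exp_eq_exp_iff_exists_int.1 h2
    refine ⟨n, ?_⟩
    rw [hq]
    simp only
    rw [hn]
    simp
  have h2pi : q (2 * Real.pi) = q 0 - 1 := by
    have : circleMap 0 β (2 * Real.pi) = circleMap 0 β 0 := by
      have := periodic_circleMap 0 β 0
      simpa using this
    simp only [hq, this]
    field_simp
    ring
  have hivt := intermediate_value_Icc' (by positivity : (0:ℝ) ≤ 2 * Real.pi)
    hqc.continuousOn
  obtain ⟨θ, _, hθ⟩ := hivt (show q 0 - 1 / 2 ∈ Icc (q (2 * Real.pi)) (q 0) from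
    ⟨by rw [h2pi]; linarith, by linarith⟩)
  obtain ⟨n, hn⟩ := hintg θ
  obtain ⟨m, hm'⟩ := hintg 0
  rw [hn, hm'] at hθ
  have h3 : (2 * n : ℝ) = 2 * m - 1 := by linarith
  have h4 : 2 * n = 2 * m - 1 := by exact_mod_cast h3
  omega

end EQ

namespace EQ
open Metric Set MeasureTheory Topology

lemma entire_log {f : ℂ → ℂ} (hf : Differentiable ℂ f) (h0 : ∀ z, f z ≠ 0) :
    ∃ g : ℂ → ℂ, Continuous g ∧ ∀ z, f z = exp (g z) := by
  have hd : Differentiable ℂ (deriv f) := by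
    have := (hf.differentiableOn (s := univ)).deriv isOpen_univ
    exact differentiableOn_univ.1 this
  have hq : Differentiable ℂ (fun z => deriv f z / f z) := fun z => (hd z).div (hf z) (h0 z)
  obtain ⟨g, hg0, hg⟩ := hq.isExactOn_univ.with_val_at 0 (log (f 0))
  have hg' : ∀ z, HasDerivAt g (deriv f z / f z) z := fun z => hg z (mem_univ z)
  have hder : ∀ z, HasDerivAt (fun z => f z * exp (-g z)) 0 z := by
    intro z
    have h1 := (hf z).hasDerivAt.mul ((hg' z).neg.cexp)
    refine h1.congr_deriv ?_
    have := h0 z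
    simp only [Pi.neg_apply]
    field_simp
    ring
  have hconst : ∀ z, f z * exp (-g z) = 1 := by
    intro z
    have h1 := is_const_of_deriv_eq_zero (f := fun z => f z * exp (-g z))
      (fun z => (hder z).differentiableAt) (fun z => (hder z).deriv) z 0
    rw [h1, hg0, Complex.exp_neg, Complex.exp_log (h0 0), mul_inv_cancel₀ (h0 0)]
  refine ⟨g, continuous_iff_continuousAt.2 fun z => (hg' z).continuousAt, fun z => ?_⟩
  have := hconst z
  rw [Complex.exp_neg] at this
  rw [← div_eq_mul_inv] at this
  exact (div_eq_one_iff_eq (Complex.exp_ne_zero _)).1 this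

lemma line_diff {G : ℂ → ℂ → ℂ} (hG : Differentiable ℂ (fun p : ℂ × ℂ => G p.1 p.2)) (p q r : ℂ) :
    Differentiable ℂ (fun b => G p ((q - b) * r)) := by
  have h2 : Differentiable ℂ (fun b : ℂ => (p, (q - b) * r)) := by fun_prop
  exact hG.comp h2

lemma zk_nonempty {κ : ℕ} (hκ : κ = 0 ∨ κ = 1) : (Zk κ).Nonempty := by
  by_contra hemp
  rw [Set.not_nonempty_iff_eq_empty] at hemp
  have hne : ∀ a l, F κ a l ≠ 0 := by
    intro a l h
    have : (a, l) ∈ Zk κ := h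
    rw [hemp] at this
    exact this
  obtain ⟨c0, hc0, C, _, h, hh, H⟩ := asymp hκ (β := 1 / 1000) (by norm_num) le_rfl
  have hv : ((c0 + 1 : ℝ) : ℂ) ∈ Ds c0 := by
    refine ⟨?_, ?_⟩
    · rw [Complex.norm_real, Real.norm_of_nonneg (by linarith)]; linarith
    · rw [Complex.ofReal_im, Complex.ofReal_re, abs_zero]; linarith
  have hc := w12_mem hv
  generalize w12 * ((c0 + 1 : ℝ) : ℂ) = c at hc
  obtain ⟨g, hgc, hg⟩ := entire_log (line_diff (F_differentiable hκ) (c ^ 4) (dd κ) (c ^ 2))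
    (fun b => hne _ _)
  have hN : ∀ b ∈ sphere (0:ℂ) (1 / 1000), b ∈ Nb κ (1 / 1000) := fun b hb =>
    (Bs_circ (mem_sphere_zero_iff_norm.1 hb)).1
  refine no_circle_log (u := fun b => g b - h (c, b) + c ^ 6 / 3) (β := 1 / 1000) (by norm_num) ?_ ?_
  · refine (hgc.continuousOn.sub ?_).add continuousOn_const
    exact hh.comp (Continuous.continuousOn (by fun_prop)) (fun b hb => ⟨hc, hN b hb⟩)
  · intro b hb
    have h1 := (H c hc b (hN b hb)).1
    have h2 := hg b
    rw [h2] at h1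
    rw [Complex.exp_add, Complex.exp_sub, h1]
    have e1 : exp (-c ^ 6 / 3) * exp (c ^ 6 / 3) = 1 := by
      rw [← Complex.exp_add]
      rw [show -c ^ 6 / 3 + c ^ 6 / 3 = 0 by ring, Complex.exp_zero]
    have e2 := Complex.exp_ne_zero (h (c, b))
    rw [mul_div_assoc, div_self e2, mul_one]
    linear_combination b * e1

lemma joint_F {κ : ℕ} (hκ : κ = 0 ∨ κ = 1) : Joint (F κ) := by
  refine ⟨F_differentiable hκ, ?_⟩
  intro l
  by_contra h
  push Not at h
  have h1 := nr_par hκ (h ((‖l‖ ^ 2 + 1 : ℝ) : ℂ))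
  rw [Complex.norm_real, Real.norm_of_nonneg (by positivity), Complex.ofReal_re] at h1
  linarith

lemma zk_lemmaL {κ : ℕ} (hκ : κ = 0 ∨ κ = 1) {A B : Set (ℂ × ℂ)} (hA : IsClosed A)
    (hB : IsClosed B) (hAB : A ∪ B = Zk κ) (hdis : Disjoint A B) (hb : Bdd A) : A = ∅ :=
  lemmaL (joint_F hκ) (fun _ _ h => nr_pos hκ h) (fun _ _ h => nr_neg hκ h)
    (fun _ _ h => nr_real hκ h) (fun _ _ ht h => nr_it hκ ht h) hA hB hAB hdis hb

lemma zk_connected {κ : ℕ} (hκ : κ = 0 ∨ κ = 1) : IsConnected (Zk κ) := by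
  refine ⟨zk_nonempty hκ, ?_⟩
  have hcl : IsClosed (Zk κ) := isClosed_eq (F_cont hκ) continuous_const
  rw [isPreconnected_closed_iff]
  intro t t' ht ht' hsub hn hn'
  by_contra hcon
  rw [Set.not_nonempty_iff_eq_empty] at hcon
  have hA : IsClosed (Zk κ ∩ t) := hcl.inter ht
  have hB : IsClosed (Zk κ ∩ t') := hcl.inter ht'
  have hAB : (Zk κ ∩ t) ∪ (Zk κ ∩ t') = Zk κ := by
    rw [← Set.inter_union_distrib_left]; exact Set.inter_eq_left.2 hsub
  have hdis : Disjoint (Zk κ ∩ t) (Zk κ ∩ t') := by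
    rw [Set.disjoint_left]
    intro x hx hx'
    have : x ∈ Zk κ ∩ (t ∩ t') := ⟨hx.1, hx.2, hx'.2⟩
    rw [hcon] at this
    exact this
  rcases not_both hκ hA hB hAB hdis with h | h
  · exact hn.ne_empty (zk_lemmaL hκ hA hB hAB hdis h)
  · exact hn'.ne_empty (zk_lemmaL hκ hB hA (by rw [Set.union_comm]; exact hAB) hdis.symm h)

lemma even_eq : evenQuarticLocusEven = Zk 0 := by
  ext ⟨a, l⟩
  exact even_iff a l

lemma odd_eq : evenQuarticLocusOdd = Zk 1 := by
  ext ⟨a, l⟩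
  exact odd_iff a l

end EQ

theorem even_quartic_locus_union_disjoint_connected :
    evenQuarticLocus = evenQuarticLocusEven ∪ evenQuarticLocusOdd ∧
    Disjoint evenQuarticLocusEven evenQuarticLocusOdd ∧
    evenQuarticLocusEven.Nonempty ∧ IsConnected evenQuarticLocusEven ∧
    evenQuarticLocusOdd.Nonempty ∧ IsConnected evenQuarticLocusOdd := by
  refine ⟨EQ.locus_union, EQ.locus_disjoint, ?_, ?_, ?_, ?_⟩
  · rw [EQ.even_eq]; exact EQ.zk_nonempty (Or.inl rfl)
  · rw [EQ.even_eq]; exact EQ.zk_connected (Or.inl rfl)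
  · rw [EQ.odd_eq]; exact EQ.zk_nonempty (Or.inr rfl)
  · rw [EQ.odd_eq]; exact EQ.zk_connected (Or.inr rfl)
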